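/- arXiv:2102.10993 — 17 statements merged into one kernel-verified Lean document; each statement's English description precedes it below -/
import Mathlib

section
/- Let X be a real normed space. Then the linear span of the set of continuous ridge functions on X, i.e. the linear span of { x ↦ g(φ(x)) : g ∈ C(ℝ), φ a continuous linear functional on X }, is dense in C(X) in the topology of uniform convergence on compact sets: for every nonempty compact K ⊆ X, every continuous h : X → ℝ, and every ε > 0, there exist finitely many g_i ∈ C(ℝ), continuous linear functionals φ_i on X, and scalars c_i ∈ ℝ such that sup_{x ∈ K} |h(x) − ∑_i c_i g_i(φ_i(x))| < ε. -/
/-- density of the span of continuous ridge functions in `C(X)`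
in the topology of uniform convergence on compact sets. -/
theorem ridge_span_dense (X : Type*) [NormedAddCommGroup X] [NormedSpace ℝ X]
    (K : Set X) (hK : IsCompact K) (hKne : K.Nonempty)
    (h : X → ℝ) (hh : Continuous h) (ε : ℝ) (hε : 0 < ε) :
    ∃ (n : ℕ) (g : Fin n → ℝ → ℝ) (φ : Fin n → X →L[ℝ] ℝ) (c : Fin n → ℝ),
      (∀ i, Continuous (g i)) ∧
      ∀ x ∈ K, |h x - ∑ i, c i * g i (φ i x)| < ε := by
  let e : (X →L[ℝ] ℝ) → C(X, ℝ) := fun φ => ⟨fun x => Real.exp (φ x), by fun_prop⟩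
  let M : Submonoid C(X, ℝ) :=
    { carrier := Set.range e
      one_mem' := ⟨0, by ext x; simp [e]⟩
      mul_mem' := by
        rintro _ _ ⟨φ, rfl⟩ ⟨ψ, rfl⟩
        exact ⟨φ + ψ, by ext x; simp [e, Real.exp_add]⟩ }
  have hsep : (Algebra.adjoin ℝ (M : Set C(X, ℝ))).SeparatesPoints := by
    intro x y hxy
    obtain ⟨φ, hφ⟩ := SeparatingDual.exists_separating_of_ne (R := ℝ) hxy
    refine ⟨e φ, ⟨e φ, Algebra.subset_adjoin ⟨φ, rfl⟩, rfl⟩, ?_⟩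
    exact fun H => hφ (Real.exp_injective H)
  obtain ⟨f, hf, hfK⟩ :=
    ContinuousMap.exists_mem_subalgebra_near_continuous_of_isCompact_of_separatesPoints
      hsep ⟨h, hh⟩ hK hε
  have hf' : f ∈ Submodule.span ℝ (M : Set C(X, ℝ)) := by
    have h1 : f ∈ Subalgebra.toSubmodule (Algebra.adjoin ℝ (M : Set C(X, ℝ))) := hf
    rwa [Algebra.adjoin_eq_span, Submonoid.closure_eq] at h1
  obtain ⟨n, c, s, hs⟩ := Submodule.mem_span_set'.1 hf'
  choose φ hφ using fun i => (s i).2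
  refine ⟨n, fun _ => Real.exp, φ, c, fun _ => Real.continuous_exp, fun x hx => ?_⟩
  have h2 : f x = ∑ i, c i * Real.exp (φ i x) := by
    rw [← hs, ContinuousMap.sum_apply]
    refine Finset.sum_congr rfl fun i _ => ?_
    rw [← hφ i]
    rfl
  rw [← h2, abs_sub_comm]
  first
  | exact hfK x hx
  | (rw [abs_sub_comm]; exact hfK x hx)
end

section
/- Let Ψ : ℝ → ℝ be any function. If Σ^1(Ψ) is dense in C(ℝ) in the topology of uniform convergence on compact sets, then for every r ≥ 1, Σ^r(Ψ) is dense in C(ℝ^r) in the topology of uniform convergence on compact sets. -/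
/-- A set `S` of real-valued functions on `X` is dense in `C(X)` in the topology of
uniform convergence on compact sets. -/
def DenseOnCompacts {X : Type*} [TopologicalSpace X] (S : Set (X → ℝ)) : Prop :=
  ∀ K : Set X, IsCompact K → K.Nonempty → ∀ g : X → ℝ, Continuous g → ∀ ε : ℝ, 0 < ε →
    ∃ f ∈ S, ∀ x ∈ K, |f x - g x| < ε

/-- `Σ^1(Ψ)`: one-dimensional feedforward three-layer neural networks. -/
def Sigma1 (Ψ : ℝ → ℝ) : Set (ℝ → ℝ) :=
  { f | ∃ (q : ℕ) (β w θ : Fin q → ℝ), f = fun x => ∑ j, β j * Ψ (w j * x + θ j) }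

/-- `Σ^r(Ψ)`: feedforward three-layer neural networks with input dimension `r`. -/
def SigmaNet (r : ℕ) (Ψ : ℝ → ℝ) : Set ((Fin r → ℝ) → ℝ) :=
  { f | ∃ (q : ℕ) (β θ : Fin q → ℝ) (w : Fin q → Fin r → ℝ),
      f = fun x => ∑ j, β j * Ψ ((∑ i, w j i * x i) + θ j) }

theorem sigmaNet_add {r : ℕ} {Ψ : ℝ → ℝ} {f g : (Fin r → ℝ) → ℝ}
    (hf : f ∈ SigmaNet r Ψ) (hg : g ∈ SigmaNet r Ψ) : (fun x => f x + g x) ∈ SigmaNet r Ψ := by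
  obtain ⟨q, β, θ, w, rfl⟩ := hf
  obtain ⟨q', β', θ', w', rfl⟩ := hg
  refine ⟨q + q', Fin.append β β', Fin.append θ θ', Fin.append w w', ?_⟩
  funext x
  simp [Fin.sum_univ_add]

theorem sigmaNet_smul {r : ℕ} {Ψ : ℝ → ℝ} {f : (Fin r → ℝ) → ℝ} (c : ℝ)
    (hf : f ∈ SigmaNet r Ψ) : (fun x => c * f x) ∈ SigmaNet r Ψ := by
  obtain ⟨q, β, θ, w, rfl⟩ := hf
  refine ⟨q, fun j => c * β j, θ, w, ?_⟩
  funext x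
  simp [Finset.mul_sum, mul_assoc]

/-- The exponential ridge functions, as a submonoid of `C(K, ℝ)`. -/
def expMonoid {r : ℕ} (K : Set (Fin r → ℝ)) : Submonoid C(K, ℝ) where
  carrier := { f | ∃ w : Fin r → ℝ, ∀ x : K, f x = Real.exp (∑ i, w i * x.1 i) }
  one_mem' := ⟨0, by simp⟩
  mul_mem' := by
    rintro f g ⟨w, hw⟩ ⟨v, hv⟩
    refine ⟨w + v, fun x => ?_⟩
    simp [hw, hv, add_mul, Finset.sum_add_distrib, Real.exp_add]

theorem span_approx {r : ℕ} {Ψ : ℝ → ℝ} (h1 : DenseOnCompacts (Sigma1 Ψ))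
    (K : Set (Fin r → ℝ)) (hK : IsCompact K) (hne : K.Nonempty) (f : C(K, ℝ))
    (hf : f ∈ Submodule.span ℝ (expMonoid K : Set C(K, ℝ))) :
    ∀ ε : ℝ, 0 < ε → ∃ h ∈ SigmaNet r Ψ, ∀ x : K, |h x - f x| < ε := by
  induction hf using Submodule.span_induction with
  | mem f hf =>
    intro ε hε
    obtain ⟨w, hw⟩ := hf
    have hc : Continuous (fun x : Fin r → ℝ => ∑ i, w i * x i) := by fun_prop
    obtain ⟨h, ⟨q, β, v, θ, rfl⟩, hh⟩ := h1 _ (hK.image hc) (hne.image _) Real.exp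
      Real.continuous_exp ε hε
    refine ⟨_, ⟨q, β, θ, fun j i => v j * w i, rfl⟩, fun x => ?_⟩
    have := hh _ ⟨x.1, x.2, rfl⟩
    simpa [hw, Finset.mul_sum, mul_assoc] using this
  | zero =>
    intro ε hε
    exact ⟨_, ⟨0, Fin.elim0, Fin.elim0, Fin.elim0, rfl⟩, fun x => by simpa using hε⟩
  | add f g _ _ hf hg =>
    intro ε hε
    obtain ⟨a, ha, ha'⟩ := hf (ε / 2) (by linarith)
    obtain ⟨b, hb, hb'⟩ := hg (ε / 2) (by linarith)
    refine ⟨_, sigmaNet_add ha hb, fun x => ?_⟩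
    have h1 := abs_lt.1 (ha' x)
    have h2 := abs_lt.1 (hb' x)
    simp only [ContinuousMap.add_apply]
    rw [abs_lt]
    constructor <;> linarith
  | smul c f _ hf =>
    intro ε hε
    have hp : 0 < |c| + 1 := by positivity
    obtain ⟨a, ha, ha'⟩ := hf (ε / (|c| + 1)) (by positivity)
    refine ⟨_, sigmaNet_smul c ha, fun x => ?_⟩
    have h2 := (lt_div_iff₀ hp).1 (ha' x)
    simp only [ContinuousMap.smul_apply, smul_eq_mul]
    rw [← mul_sub, abs_mul]
    nlinarith [abs_nonneg (a x - f x)]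

/-- if `Σ^1(Ψ)` is dense in `C(ℝ)`, then `Σ^r(Ψ)` is dense in `C(ℝ^r)`
for every `r ≥ 1`. -/
theorem sigma_dense_dim_one_suffices (Ψ : ℝ → ℝ) (h1 : DenseOnCompacts (Sigma1 Ψ)) :
    ∀ r : ℕ, 1 ≤ r → DenseOnCompacts (SigmaNet r Ψ) := by
  intro r _ K hK hne g hg ε hε
  have : CompactSpace K := isCompact_iff_compactSpace.1 hK
  let A : Subalgebra ℝ C(K, ℝ) := Algebra.adjoin ℝ (expMonoid K : Set C(K, ℝ))
  have hsep : A.SeparatesPoints := by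
    intro x y hxy
    have : ∃ i, x.1 i ≠ y.1 i := by
      by_contra! h
      exact hxy (Subtype.ext (funext h))
    obtain ⟨i, hi⟩ := this
    let e : C(K, ℝ) := ⟨fun x => Real.exp (x.1 i),
      Real.continuous_exp.comp ((continuous_apply i).comp continuous_subtype_val)⟩
    refine ⟨e, ⟨e, Algebra.subset_adjoin ⟨Pi.single i 1, fun x => ?_⟩, rfl⟩, ?_⟩
    · simp [e, Pi.single_apply]
    · simpa [e] using hi
  obtain ⟨⟨p, hp⟩, hp'⟩ :=
    ContinuousMap.exists_mem_subalgebra_near_continuous_of_separatesPoints A hsep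
      (fun x : K => g x.1) (by fun_prop) (ε / 2) (by linarith)
  have hp2 : p ∈ Submodule.span ℝ (expMonoid K : Set C(K, ℝ)) := by
    have h3 : p ∈ Subalgebra.toSubmodule (Algebra.adjoin ℝ (expMonoid K : Set C(K, ℝ))) := hp
    rwa [Algebra.adjoin_eq_span, Submonoid.closure_eq] at h3
  obtain ⟨h, hh, hh'⟩ := span_approx h1 K hK hne p hp2 (ε / 2) (by linarith)
  refine ⟨h, hh, fun x hx => ?_⟩
  have e1 := abs_lt.1 (hh' ⟨x, hx⟩)
  have e2 := hp' ⟨x, hx⟩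
  rw [Real.norm_eq_abs] at e2
  have e3 := abs_lt.1 e2
  simp only at e1 e3
  rw [abs_lt]
  constructor <;> linarith
end

section
/- (Lin–Pinkus) Let A ⊆ ℝ^r and let R(A) = { x ↦ f(w·x) : f ∈ C(ℝ), w ∈ A }. Then the linear span of R(A) is dense in C(ℝ^r) in the topology of uniform convergence on compact sets if and only if there is no nonzero homogeneous polynomial in r real variables that vanishes identically on A. -/
/-- The linear span of the ridge functions `x ↦ f(w·x)` with `f` continuous and `w ∈ A`. -/
def RidgeSpan (r : ℕ) (A : Set (Fin r → ℝ)) : Set ((Fin r → ℝ) → ℝ) :=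
  { F | ∃ (n : ℕ) (c : Fin n → ℝ) (f : Fin n → ℝ → ℝ) (w : Fin n → Fin r → ℝ),
      (∀ i, Continuous (f i)) ∧ (∀ i, w i ∈ A) ∧
      F = fun x => ∑ i, c i * f i (∑ j, w i j * x j) }

open MeasureTheory in
theorem lp_exp_int (r : ℕ) (p : MvPolynomial (Fin r) ℝ) :
    ∀ ψ : (Fin r → ℝ) → ℝ, ContDiff ℝ (⊤ : ℕ∞) ψ → HasCompactSupport ψ →
      ∃ φ : (Fin r → ℝ) → ℝ, ContDiff ℝ (⊤ : ℕ∞) φ ∧ HasCompactSupport φ ∧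
        ∀ w : Fin r → ℝ, ∫ x, Real.exp (∑ j, w j * x j) * φ x =
          MvPolynomial.eval w p * ∫ x, Real.exp (∑ j, w j * x j) * ψ x := by
  induction p using MvPolynomial.induction_on with
  | C a =>
    intro ψ h1 h2
    refine ⟨fun x => a * ψ x, by fun_prop, h2.mul_left, fun w => ?_⟩
    rw [MvPolynomial.eval_C, ← integral_const_mul]
    congr 1; ext x; ring
  | add p q hp hq =>
    intro ψ h1 h2
    obtain ⟨f, f1, f2, f3⟩ := hp ψ h1 h2
    obtain ⟨g, g1, g2, g3⟩ := hq ψ h1 h2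
    refine ⟨fun x => f x + g x, by fun_prop, f2.add g2, fun w => ?_⟩
    rw [map_add, add_mul, ← f3, ← g3, ← integral_add]
    · congr 1; ext x; ring
    · exact Continuous.integrable_of_hasCompactSupport
        ((by fun_prop : Continuous _).mul f1.continuous) f2.mul_left
    · exact Continuous.integrable_of_hasCompactSupport
        ((by fun_prop : Continuous _).mul g1.continuous) g2.mul_left
  | mul_X p i hp =>
    intro ψ h1 h2
    obtain ⟨f, f1, f2, f3⟩ := hp ψ h1 h2
    have e1 : ContDiff ℝ (⊤ : ℕ∞) (fun x => fderiv ℝ f x (Pi.single i 1)) :=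
      (f1.fderiv_right (m := (⊤ : ℕ∞)) (by simp)).clm_apply contDiff_const
    have e2 : HasCompactSupport (fun x => fderiv ℝ f x (Pi.single i 1)) :=
      f2.fderiv_apply ℝ _
    refine ⟨fun x => - fderiv ℝ f x (Pi.single i 1), e1.neg, e2.neg, fun w => ?_⟩
    have hd : ∀ x : Fin r → ℝ, HasFDerivAt (fun x : Fin r → ℝ => Real.exp (∑ j, w j * x j))
        (Real.exp (∑ j, w j * x j) • ∑ j, w j • ContinuousLinearMap.proj (R := ℝ) j) x := by
      intro x
      apply HasFDerivAt.exp
      apply HasFDerivAt.fun_sum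
      intro j _
      exact (hasFDerivAt_apply j x).const_mul (w j)
    have hd' : ∀ x : Fin r → ℝ, fderiv ℝ (fun x : Fin r → ℝ => Real.exp (∑ j, w j * x j)) x
        (Pi.single i 1) = w i * Real.exp (∑ j, w j * x j) := by
      intro x
      rw [(hd x).fderiv]
      simp [Pi.single_apply, mul_comm]
    have hi := integral_mul_fderiv_eq_neg_fderiv_mul_of_integrable
      (μ := (volume : Measure (Fin r → ℝ)))
      (f := fun x : Fin r → ℝ => Real.exp (∑ j, w j * x j)) (g := f) (v := Pi.single i 1)
      (by
        simp only [hd']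
        exact Continuous.integrable_of_hasCompactSupport
          ((by fun_prop : Continuous _).mul f1.continuous) f2.mul_left)
      (Continuous.integrable_of_hasCompactSupport
          ((by fun_prop : Continuous _).mul e1.continuous) e2.mul_left)
      (Continuous.integrable_of_hasCompactSupport
          ((by fun_prop : Continuous _).mul f1.continuous) f2.mul_left)
      (fun x _ => (hd x).differentiableAt)
      (fun x _ => (f1.differentiable (by simp)).differentiableAt)
    simp only [hd'] at hi
    simp only [mul_neg, integral_neg, hi, neg_neg, mul_assoc, integral_const_mul, f3, map_mul,
      MvPolynomial.eval_X]
    ring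

open MeasureTheory in
theorem lp_approx (r : ℕ) (φ : (Fin r → ℝ) → ℝ) (h1 : Continuous φ) (h2 : HasCompactSupport φ)
    (H : (Fin r → ℝ) → ℝ) (hH : Continuous H)
    (h : ∀ ε : ℝ, 0 < ε → ∃ F : (Fin r → ℝ) → ℝ, Continuous F ∧
      (∀ x ∈ tsupport φ, |F x - H x| < ε) ∧ ∫ x, F x * φ x = 0) :
    ∫ x, H x * φ x = 0 := by
  have hint : ∀ G : (Fin r → ℝ) → ℝ, Continuous G → Integrable (fun x => G x * φ x) := fun G hG =>
    Continuous.integrable_of_hasCompactSupport (hG.mul h1) h2.mul_left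
  have habs : Integrable (fun x => |φ x|) :=
    (h1.integrable_of_hasCompactSupport h2).abs
  set M := ∫ x, |φ x| with hM
  have hM0 : 0 ≤ M := integral_nonneg fun x => abs_nonneg _
  have key : ∀ ε : ℝ, 0 < ε → |∫ x, H x * φ x| ≤ ε * M := by
    intro ε hε
    obtain ⟨F, hF, hF1, hF2⟩ := h ε hε
    have e : ∫ x, H x * φ x = ∫ x, (H x * φ x - F x * φ x) := by
      rw [integral_sub (hint H hH) (hint F hF), hF2, sub_zero]
    rw [e, hM, ← integral_const_mul, ← Real.norm_eq_abs]
    apply norm_integral_le_of_norm_le (habs.const_mul ε)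
    filter_upwards with x
    rw [← sub_mul, norm_mul, Real.norm_eq_abs, Real.norm_eq_abs]
    by_cases hx : x ∈ tsupport φ
    · rw [abs_sub_comm]
      exact mul_le_mul_of_nonneg_right (hF1 x hx).le (abs_nonneg _)
    · simp [image_eq_zero_of_notMem_tsupport hx]
  by_contra hne
  have hp : 0 < |∫ x, H x * φ x| := abs_pos.2 hne
  have := key (|∫ x, H x * φ x| / (2 * (M + 1))) (by positivity)
  have h3 : |∫ x, H x * φ x| / (2 * (M + 1)) * M < |∫ x, H x * φ x| := by
    rw [div_mul_eq_mul_div, div_lt_iff₀ (by positivity)]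
    nlinarith
  linarith

theorem lp_eval_smul (r : ℕ) (p : MvPolynomial (Fin r) ℝ) (k : ℕ) (hp : p.IsHomogeneous k)
    (t : ℝ) (w : Fin r → ℝ) :
    MvPolynomial.eval (fun j => t * w j) p = t ^ k * MvPolynomial.eval w p := by
  rw [MvPolynomial.eval_eq, MvPolynomial.eval_eq, Finset.mul_sum]
  refine Finset.sum_congr rfl fun d hd => ?_
  have hk : ∑ i ∈ d.support, d i = k := by
    have := hp (MvPolynomial.mem_support_iff.1 hd)
    rw [Finsupp.weight_apply] at this
    simpa [Finsupp.sum] using this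
  simp only [mul_pow, Finset.prod_mul_distrib, Finset.prod_pow_eq_pow_sum, hk]
  ring

open MeasureTheory in
theorem lp_ridge (r : ℕ) (p : MvPolynomial (Fin r) ℝ) (k : ℕ) (hp : p.IsHomogeneous k)
    (w : Fin r → ℝ) (hw : MvPolynomial.eval w p = 0)
    (φ ψ : (Fin r → ℝ) → ℝ) (h1 : Continuous φ) (h2 : HasCompactSupport φ)
    (h : ∀ w : Fin r → ℝ, ∫ x, Real.exp (∑ j, w j * x j) * φ x =
          MvPolynomial.eval w p * ∫ x, Real.exp (∑ j, w j * x j) * ψ x)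
    (f : ℝ → ℝ) (hf : Continuous f) :
    ∫ x, f (∑ j, w j * x j) * φ x = 0 := by
  apply lp_approx r φ h1 h2 (fun x => f (∑ j, w j * x j)) (by fun_prop)
  intro ε hε
  have hK : IsCompact ((fun x : Fin r → ℝ => Real.exp (∑ j, w j * x j)) '' tsupport φ) :=
    IsCompact.image h2 (by fun_prop)
  have hK' : IsCompact ((fun x : Fin r → ℝ => (∑ j, w j * x j)) '' tsupport φ) :=
    IsCompact.image h2 (by fun_prop)
  obtain ⟨a, ha⟩ := hK'.bddBelow
  obtain ⟨b, hb⟩ := hK'.bddAbove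
  obtain ⟨q, hq⟩ := exists_polynomial_near_of_continuousOn (Real.exp a) (Real.exp b)
    (fun s => f (Real.log s)) (by
      apply hf.comp_continuousOn
      apply Real.continuousOn_log.mono
      intro s hs
      exact ((Real.exp_pos a).trans_le hs.1).ne') ε hε
  refine ⟨fun x => q.eval (Real.exp (∑ j, w j * x j)), ?_, ?_, ?_⟩
  · exact q.continuous.comp (by fun_prop)
  · intro x hx
    have := hq (Real.exp (∑ j, w j * x j)) ⟨Real.exp_le_exp.2 (ha ⟨x, hx, rfl⟩),
      Real.exp_le_exp.2 (hb ⟨x, hx, rfl⟩)⟩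
    simpa using this
  · have : ∀ x : Fin r → ℝ, q.eval (Real.exp (∑ j, w j * x j)) * φ x =
        ∑ n ∈ Finset.range (q.natDegree + 1),
          q.coeff n * (Real.exp (∑ j, ((n : ℝ) * w j) * x j) * φ x) := by
      intro x
      rw [Polynomial.eval_eq_sum_range, Finset.sum_mul]
      refine Finset.sum_congr rfl fun n _ => ?_
      rw [← Real.exp_nat_mul, Finset.mul_sum]
      simp only [mul_assoc]
    simp only [this]
    rw [integral_finsetSum]
    · refine Finset.sum_eq_zero fun n _ => ?_
      rw [integral_const_mul, h, lp_eval_smul r p k hp, hw]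
      simp
    · intro n _
      apply Integrable.const_mul
      exact Continuous.integrable_of_hasCompactSupport
        ((by fun_prop : Continuous _).mul h1) h2.mul_left

open MeasureTheory in
theorem lp_forward (r : ℕ) (A : Set (Fin r → ℝ)) (hd : DenseOnCompacts (RidgeSpan r A))
    (p : MvPolynomial (Fin r) ℝ) (k : ℕ) (hp : p.IsHomogeneous k)
    (hA : ∀ w ∈ A, MvPolynomial.eval w p = 0) : p = 0 := by
  obtain ⟨ψ, -, c1, s1, rg, o1⟩ := exists_contDiff_tsupport_subset (E := Fin r → ℝ) (x := 0)
    (n := ⊤) Filter.univ_mem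
  obtain ⟨φ, s2, c2, h⟩ := lp_exp_int r p ψ s1 c1
  have hφ : φ = 0 := by
    by_contra hne
    obtain ⟨x0, hx0⟩ := Function.ne_iff.1 hne
    have h0 : ∫ x, φ x * φ x = 0 := by
      apply lp_approx r φ s2.continuous c2 φ s2.continuous
      intro ε hε
      obtain ⟨F, ⟨n, c, f, w, hf, hw, rfl⟩, hF⟩ := hd (tsupport φ) c2
        ⟨x0, subset_tsupport _ hx0⟩ φ s2.continuous ε hε
      refine ⟨_, by fun_prop, hF, ?_⟩
      simp only [Finset.sum_mul, mul_assoc]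
      rw [integral_finsetSum]
      · refine Finset.sum_eq_zero fun i _ => ?_
        rw [integral_const_mul,
          lp_ridge r p k hp (w i) (hA _ (hw i)) φ ψ s2.continuous c2 h (f i) (hf i), mul_zero]
      · intro i _
        apply Integrable.const_mul
        have := hf i
        exact Continuous.integrable_of_hasCompactSupport
          ((by fun_prop : Continuous _).mul s2.continuous) c2.mul_left
    have := Continuous.integral_pos_of_hasCompactSupport_nonneg_nonzero
      (μ := (volume : Measure (Fin r → ℝ))) (f := fun x => φ x * φ x) (x := x0)
      (s2.continuous.mul s2.continuous) c2.mul_left (fun x => mul_self_nonneg _)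
      (mul_ne_zero hx0 hx0)
    linarith
  apply MvPolynomial.funext
  intro w
  have hw := h w
  have hpos : 0 < ∫ x, Real.exp (∑ j, w j * x j) * ψ x := by
    apply Continuous.integral_pos_of_hasCompactSupport_nonneg_nonzero (x := 0)
    · exact (by fun_prop : Continuous _).mul s1.continuous
    · exact c1.mul_left
    · intro x
      exact mul_nonneg (Real.exp_pos _).le (rg ⟨x, rfl⟩).1
    · simp [o1]
  simp only [hφ, Pi.zero_apply, mul_zero, integral_zero] at hw
  rw [map_zero]
  exact (mul_eq_zero.1 hw.symm).resolve_right hpos.ne'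

theorem lp_span (r : ℕ) (A : Set (Fin r → ℝ))
    (h : ∀ (p : MvPolynomial (Fin r) ℝ) (k : ℕ), p.IsHomogeneous k →
      (∀ w ∈ A, MvPolynomial.eval w p = 0) → p = 0) (d : Fin r →₀ ℕ) :
    MvPolynomial.monomial d (1 : ℝ) ∈ Submodule.span ℝ
      {P : MvPolynomial (Fin r) ℝ | ∃ w ∈ A, ∃ k : ℕ,
        P = (∑ j, MvPolynomial.C (w j) * MvPolynomial.X j) ^ k} := by
  by_contra hn
  obtain ⟨l, hl, hker⟩ := Submodule.exists_le_ker_of_notMem hn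
  set k := ∑ i, d i with hk
  let toF : (Fin r → ℕ) → (Fin r →₀ ℕ) := fun a => Finsupp.equivFunOnFinite.symm a
  have hpow : ∀ w : Fin r → ℝ,
      (∑ j, MvPolynomial.C (w j) * MvPolynomial.X j : MvPolynomial (Fin r) ℝ) ^ k =
      ∑ a ∈ Finset.piAntidiag Finset.univ k,
        ((Nat.multinomial Finset.univ a : ℝ) * ∏ i, w i ^ a i) •
          MvPolynomial.monomial (toF a) (1 : ℝ) := by
    intro w
    rw [Finset.sum_pow_eq_sum_piAntidiag]
    refine Finset.sum_congr rfl fun a _ => ?_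
    rw [MvPolynomial.monomial_eq, MvPolynomial.smul_eq_C_mul]
    simp only [mul_pow, Finset.prod_mul_distrib, map_mul, map_prod, map_pow, map_natCast, map_one,
      one_mul]
    rw [Finsupp.prod_fintype _ _ (by simp)]
    simp [toF, mul_assoc]
  let q : MvPolynomial (Fin r) ℝ := ∑ a ∈ Finset.piAntidiag Finset.univ k,
    MvPolynomial.monomial (toF a)
      ((Nat.multinomial Finset.univ a : ℝ) * l (MvPolynomial.monomial (toF a) 1))
  have hq : q = 0 := by
    apply h q k
    · apply MvPolynomial.IsHomogeneous.sum
      intro a ha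
      apply MvPolynomial.isHomogeneous_monomial
      rw [Finset.mem_piAntidiag] at ha
      rw [Finsupp.degree_eq_sum, ← ha.1]
      rfl
    · intro w hw
      have h0 : l ((∑ j, MvPolynomial.C (w j) * MvPolynomial.X j) ^ k) = 0 :=
        hker (Submodule.subset_span ⟨w, hw, k, rfl⟩)
      rw [hpow, map_sum] at h0
      rw [← h0, map_sum]
      refine Finset.sum_congr rfl fun a _ => ?_
      rw [MvPolynomial.eval_monomial, map_smul, Finsupp.prod_fintype _ _ (by simp), smul_eq_mul]
      simp [toF]
      ring
  have hc := congrArg (MvPolynomial.coeff d) hq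
  rw [MvPolynomial.coeff_sum, MvPolynomial.coeff_zero,
    Finset.sum_eq_single (d : Fin r → ℕ)] at hc
  · have e : toF d = d := by ext; simp [toF]
    rw [e, MvPolynomial.coeff_monomial, if_pos rfl] at hc
    have hm : (Nat.multinomial Finset.univ (d : Fin r → ℕ) : ℝ) ≠ 0 :=
      Nat.cast_ne_zero.2 (Nat.multinomial_pos _ _).ne'
    exact (mul_ne_zero hm hl) hc
  · intro a _ had
    rw [MvPolynomial.coeff_monomial, if_neg]
    intro e
    apply had
    rw [← e]
    ext; simp [toF]
  · intro hh
    exact absurd (by simp [hk]) hh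

theorem lp_poly_mem (r : ℕ) (A : Set (Fin r → ℝ))
    (h : ∀ (p : MvPolynomial (Fin r) ℝ) (k : ℕ), p.IsHomogeneous k →
      (∀ w ∈ A, MvPolynomial.eval w p = 0) → p = 0) (P : MvPolynomial (Fin r) ℝ) :
    (fun x => MvPolynomial.eval x P) ∈ RidgeSpan r A := by
  have hP : P ∈ Submodule.span ℝ
      {P : MvPolynomial (Fin r) ℝ | ∃ w ∈ A, ∃ k : ℕ,
        P = (∑ j, MvPolynomial.C (w j) * MvPolynomial.X j) ^ k} := by
    rw [P.as_sum]
    refine Submodule.sum_mem _ fun d _ => ?_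
    have := Submodule.smul_mem _ (P.coeff d) (lp_span r A h d)
    rwa [MvPolynomial.smul_monomial, smul_eq_mul, mul_one] at this
  obtain ⟨n, c, g, rfl⟩ := Submodule.mem_span_set'.1 hP
  choose w hw k hk using fun i => (g i).2
  refine ⟨n, c, fun i s => s ^ k i, w, fun i => by fun_prop, hw, ?_⟩
  ext x
  simp [hk, map_sum, MvPolynomial.smul_eval]

theorem lp_backward (r : ℕ) (A : Set (Fin r → ℝ))
    (h : ∀ (p : MvPolynomial (Fin r) ℝ) (k : ℕ), p.IsHomogeneous k →
      (∀ w ∈ A, MvPolynomial.eval w p = 0) → p = 0) : DenseOnCompacts (RidgeSpan r A) := by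
  intro K hK _ g hg ε hε
  have : CompactSpace K := isCompact_iff_compactSpace.1 hK
  let co : Fin r → C(K, ℝ) := fun j => ⟨fun x => (x : Fin r → ℝ) j, (continuous_apply j).comp continuous_subtype_val⟩
  let Φ : MvPolynomial (Fin r) ℝ →ₐ[ℝ] C(K, ℝ) := MvPolynomial.aeval co
  have hΦ : ∀ P (x : K), Φ P x = MvPolynomial.eval (x : Fin r → ℝ) P := by
    intro P x
    induction P using MvPolynomial.induction_on with
    | C a => simp [Φ]
    | add p q hp hq => simp [hp, hq]
    | mul_X p i hp => rw [map_mul, map_mul, ContinuousMap.mul_apply, hp]; simp [Φ, co]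
  have hsep : Φ.range.SeparatesPoints := by
    intro x y hxy
    have : ∃ j, (x : Fin r → ℝ) j ≠ (y : Fin r → ℝ) j := by
      by_contra! hc
      exact hxy (Subtype.ext (funext hc))
    obtain ⟨j, hj⟩ := this
    refine ⟨_, ⟨Φ (MvPolynomial.X j), ⟨_, rfl⟩, rfl⟩, ?_⟩
    simpa [hΦ] using hj
  obtain ⟨⟨_, P, rfl⟩, hG⟩ := ContinuousMap.exists_mem_subalgebra_near_continuous_of_separatesPoints
    Φ.range hsep (fun x : K => g x) (by fun_prop) ε hε
  refine ⟨_, lp_poly_mem r A h P, fun x hx => ?_⟩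
  have := hG ⟨x, hx⟩
  rw [← hΦ P ⟨x, hx⟩]
  exact this

/-- Lin–Pinkus: the span of `R(A)` is dense in `C(ℝ^r)` (uniform convergence on
compacta) iff no nonzero homogeneous polynomial in `r` variables vanishes identically on `A`. -/
theorem lin_pinkus (r : ℕ) (A : Set (Fin r → ℝ)) :
    DenseOnCompacts (RidgeSpan r A) ↔
      ¬ ∃ (p : MvPolynomial (Fin r) ℝ) (k : ℕ),
          p ≠ 0 ∧ p.IsHomogeneous k ∧ ∀ w ∈ A, MvPolynomial.eval w p = 0 := by
  constructor
  · rintro hd ⟨p, k, h0, hp, hA⟩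
    exact h0 (lp_forward r A hd p k hp hA)
  · intro h
    apply lp_backward
    intro p k hp hA
    by_contra h0
    exact h ⟨p, k, h0, hp, hA⟩
end

section
/- Let n, k ≥ 1 and let r = dim H_k(ℝ^n) = C(n−1+k, k) (the binomial coefficient). Then there exist vectors a_1, …, a_r ∈ ℝ^n such that the set of real polynomial functions on ℝ^n of total degree at most k equals the set of functions of the form x ↦ ∑_{i=1}^r g_i(a_i·x), where each g_i is a real univariate polynomial function of degree at most k. -/
open Finset in
lemma card_piAntidiag_le (n k d : ℕ) (hn : 1 ≤ n) (hd : d ≤ k) :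
    #(piAntidiag (univ : Finset (Fin n)) d) ≤ (n - 1 + k).choose k := by
  have h1 : #(piAntidiag (univ : Finset (Fin n)) d) = (n - 1 + d).choose d := by
    rw [← map_sym_eq_piAntidiag, Finset.card_map]
    have : (univ : Finset (Fin n)).sym d = univ := by
      ext; simp
    rw [this, Finset.card_univ, Sym.card_sym_eq_choose, Fintype.card_fin]
    congr 1
    omega
  rw [h1, ← Nat.choose_symm_add, ← Nat.choose_symm_add]
  exact Nat.choose_le_choose _ (by omega)

/-- Distinct exponent vectors give distinct products of prime powers. -/
lemma prime_node_injective (n : ℕ) :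
    Function.Injective (fun α : Fin n → ℕ => ((∏ j : Fin n, (Nat.nth Nat.Prime j) ^ α j : ℕ) : ℝ)) := by
  intro α β h
  have h' : (∏ j : Fin n, (Nat.nth Nat.Prime j) ^ α j : ℕ)
      = ∏ j : Fin n, (Nat.nth Nat.Prime j) ^ β j := by
    exact Nat.cast_injective (R := ℝ) h
  have key : ∀ (γ : Fin n → ℕ) (i : Fin n),
      (∏ j : Fin n, (Nat.nth Nat.Prime j) ^ γ j).factorization (Nat.nth Nat.Prime i) = γ i := by
    intro γ i
    rw [Nat.factorization_prod_apply
      (fun (j : Fin n) _ => pow_ne_zero _ (Nat.prime_nth_prime j).ne_zero)]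
    rw [Finset.sum_eq_single i]
    · rw [(Nat.prime_nth_prime i).factorization_pow]; simp
    · intro j _ hj
      rw [(Nat.prime_nth_prime j).factorization_pow, Finsupp.single_apply, if_neg]
      intro hh
      exact hj (Fin.ext (Nat.nth_injective Nat.infinite_setOfPred_prime hh))
    · simp
  funext i
  rw [← key α i, ← key β i, h']

open Finset in
lemma eval_eq_sum_piAntidiag (n k : ℕ) (p : MvPolynomial (Fin n) ℝ) (hp : p.totalDegree ≤ k)
    (x : Fin n → ℝ) :
    MvPolynomial.eval x p = ∑ d ∈ range (k + 1), ∑ α ∈ piAntidiag (univ : Finset (Fin n)) d,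
      p.coeff (Finsupp.equivFunOnFinite.symm α) * ∏ j, x j ^ α j := by
  rw [MvPolynomial.eval_eq']
  rw [← Finset.sum_fiberwise_of_maps_to (s := p.support) (t := range (k + 1))
    (g := fun s => ∑ i, s i)]
  · refine Finset.sum_congr rfl fun d _ => ?_
    have : ∑ α ∈ piAntidiag (univ : Finset (Fin n)) d,
        p.coeff (Finsupp.equivFunOnFinite.symm α) * ∏ j, x j ^ α j
        = ∑ s ∈ (piAntidiag (univ : Finset (Fin n)) d).map
            Finsupp.equivFunOnFinite.symm.toEmbedding,
          p.coeff s * ∏ j, x j ^ s j := by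
      rw [Finset.sum_map]
      simp
    rw [this]
    apply Finset.sum_subset
    · intro s hs
      rw [Finset.mem_filter] at hs
      rw [Finset.mem_map]
      exact ⟨s, by simpa using hs.2, by ext; simp⟩
    · intro s hs hs'
      rw [Finset.mem_map] at hs
      obtain ⟨α, hα, rfl⟩ := hs
      have hα' : ∑ i, α i = d := by simpa using hα
      have : p.coeff (Finsupp.equivFunOnFinite.symm.toEmbedding α) = 0 := by
        by_contra hne
        exact hs' (by
          rw [Finset.mem_filter, MvPolynomial.mem_support_iff]
          exact ⟨hne, by simpa using hα'⟩)
      rw [this, zero_mul]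
  · intro s hs
    have := MvPolynomial.le_totalDegree hs
    rw [Finsupp.sum_fintype _ _ (by simp)] at this
    rw [Finset.mem_range]
    omega

/-- with `r = C(n-1+k, k) = dim H_k(ℝ^n)`, there exist `a_1, …, a_r ∈ ℝ^n` such
that the polynomial functions on `ℝ^n` of total degree at most `k` are exactly the functions
`x ↦ ∑_{i=1}^r g_i(a_i · x)` with each `g_i` a univariate polynomial of degree at most `k`. -/
theorem poly_ridge_representation (n k : ℕ) (hn : 1 ≤ n) (hk : 1 ≤ k) :
    ∃ a : Fin ((n - 1 + k).choose k) → (Fin n → ℝ),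
      { F : (Fin n → ℝ) → ℝ |
          ∃ p : MvPolynomial (Fin n) ℝ, p.totalDegree ≤ k ∧
            F = fun x => MvPolynomial.eval x p }
      = { F : (Fin n → ℝ) → ℝ |
          ∃ g : Fin ((n - 1 + k).choose k) → Polynomial ℝ,
            (∀ i, (g i).natDegree ≤ k) ∧
            F = fun x => ∑ i, (g i).eval (∑ j, a i j * x j) } := by
  refine ⟨fun i j => ((Nat.nth Nat.Prime j : ℕ) : ℝ) ^ (i : ℕ), ?_⟩
  ext F
  constructor
  · rintro ⟨p, hp, rfl⟩
    let v : (Fin n → ℕ) → ℝ := fun α => ((∏ j : Fin n, (Nat.nth Nat.Prime j) ^ α j : ℕ) : ℝ)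
    let P : ℕ → Polynomial ℝ := fun d =>
      Lagrange.interpolate (Finset.piAntidiag (Finset.univ : Finset (Fin n)) d) v
        (fun α => p.coeff (Finsupp.equivFunOnFinite.symm α) / (Nat.multinomial Finset.univ α : ℝ))
    have hv : Function.Injective v := prime_node_injective n
    have hPd : ∀ d ≤ k, ∀ t : ℝ,
        ∑ i : Fin ((n - 1 + k).choose k), (P d).coeff i * t ^ (i : ℕ) = (P d).eval t := by
      intro d hd t
      rw [Fin.sum_univ_eq_sum_range (fun i => (P d).coeff i * t ^ i)]
      by_cases h0 : P d = 0
      · simp [h0]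
      rw [← Polynomial.eval_eq_sum_range']
      rw [Polynomial.natDegree_lt_iff_degree_lt h0]
      refine lt_of_lt_of_le (Lagrange.degree_interpolate_lt _ hv.injOn) ?_
      exact_mod_cast card_piAntidiag_le n k d hn hd
    refine ⟨fun i => ∑ d ∈ Finset.range (k + 1),
      Polynomial.C ((P d).coeff i) * Polynomial.X ^ d, ?_, ?_⟩
    · intro i
      refine Polynomial.natDegree_sum_le_of_forall_le _ _ fun d hd => ?_
      refine (Polynomial.natDegree_C_mul_X_pow_le _ _).trans ?_
      rw [Finset.mem_range] at hd
      omega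
    · funext x
      rw [eval_eq_sum_piAntidiag n k p hp x]
      simp only [Polynomial.eval_finsetSum, Polynomial.eval_mul, Polynomial.eval_C,
        Polynomial.eval_pow, Polynomial.eval_X]
      rw [Finset.sum_comm]
      refine Finset.sum_congr rfl fun d hd => ?_
      have hdk : d ≤ k := by rw [Finset.mem_range] at hd; omega
      simp_rw [Finset.sum_pow_eq_sum_piAntidiag, Finset.mul_sum]
      rw [Finset.sum_comm]
      refine Finset.sum_congr rfl fun α hα => ?_
      have h1 : ∀ i : Fin ((n - 1 + k).choose k),
          (∏ j : Fin n, (((Nat.nth Nat.Prime j : ℕ) : ℝ) ^ (i : ℕ) * x j) ^ α j)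
            = v α ^ (i : ℕ) * ∏ j, x j ^ α j := by
        intro i
        simp only [v, mul_pow, Finset.prod_mul_distrib]
        congr 1
        push_cast
        rw [← Finset.prod_pow]
        refine Finset.prod_congr rfl fun j _ => ?_
        rw [← pow_mul, ← pow_mul, mul_comm]
      have hm : (Nat.multinomial Finset.univ α : ℝ) ≠ 0 := by
        exact_mod_cast (Nat.multinomial_pos _ _).ne'
      have h2 : (P d).eval (v α) = p.coeff (Finsupp.equivFunOnFinite.symm α) /
          (Nat.multinomial Finset.univ α : ℝ) :=
        Lagrange.eval_interpolate_at_node _ hv.injOn hα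
      calc _ = (P d).eval (v α) * (Nat.multinomial Finset.univ α : ℝ) * ∏ j, x j ^ α j := by
            rw [h2]; field_simp
        _ = _ := by
            rw [← hPd d hdk, Finset.sum_mul, Finset.sum_mul]
            refine Finset.sum_congr rfl fun i _ => ?_
            rw [h1]; ring
  · rintro ⟨g, hg, rfl⟩
    refine ⟨∑ i, ∑ d ∈ Finset.range (k + 1), MvPolynomial.C ((g i).coeff d) *
      (∑ j : Fin n, MvPolynomial.C (((Nat.nth Nat.Prime j : ℕ) : ℝ) ^ (i : ℕ)) * MvPolynomial.X j) ^ d,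
      ?_, ?_⟩
    · refine MvPolynomial.totalDegree_finsetSum_le fun i _ => ?_
      refine MvPolynomial.totalDegree_finsetSum_le fun d hd => ?_
      refine (MvPolynomial.totalDegree_mul _ _).trans ?_
      rw [MvPolynomial.totalDegree_C, zero_add]
      refine (MvPolynomial.totalDegree_pow _ _).trans ?_
      have h1 : (∑ j : Fin n, MvPolynomial.C (((Nat.nth Nat.Prime j : ℕ) : ℝ) ^ (i : ℕ)) *
          (MvPolynomial.X j : MvPolynomial (Fin n) ℝ)).totalDegree ≤ 1 := by
        refine MvPolynomial.totalDegree_finsetSum_le fun j _ => ?_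
        refine (MvPolynomial.totalDegree_mul _ _).trans ?_
        rw [MvPolynomial.totalDegree_C, zero_add, MvPolynomial.totalDegree_X]
      rw [Finset.mem_range] at hd
      calc _ ≤ d * 1 := Nat.mul_le_mul_left d h1
        _ ≤ k := by omega
    · funext x
      simp only [map_sum, map_mul, map_pow, MvPolynomial.eval_C, MvPolynomial.eval_X]
      refine Finset.sum_congr rfl fun i _ => ?_
      rw [Polynomial.eval_eq_sum_range' (Nat.lt_succ_of_le (hg i))]
end

section
/- Let W ⊆ ℝ be a set with no isolated points such that 0 ∈ W, and let Ψ : ℝ → ℝ be infinitely differentiable on an open interval I and not equal on I to any polynomial. Then for every integer n ≥ 0, the monomial x ↦ x^n is uniformly approximable on every compact subset of ℝ by elements of N_1(Ψ, W, I) = span{ x ↦ Ψ(w x + b) : w ∈ W, b ∈ I }; consequently N_1(Ψ, W, I) is dense in C(ℝ) in the topology of uniform convergence on compact sets. -/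
/-- `N_1(Ψ, W, B) = span { x ↦ Ψ(w x + b) : w ∈ W, b ∈ B }`. -/
def NNet1 (Ψ : ℝ → ℝ) (W B : Set ℝ) : Set (ℝ → ℝ) :=
  { f | ∃ (q : ℕ) (c w b : Fin q → ℝ),
      (∀ j, w j ∈ W) ∧ (∀ j, b j ∈ B) ∧
      f = fun x => ∑ j, c j * Ψ (w j * x + b j) }

open Set Filter Topology in
/-- A smooth function with vanishing derivative of some order on a convex open set
is a polynomial there. -/
theorem exists_iter_ne (Ψ : ℝ → ℝ) (I : Set ℝ) (hIopen : IsOpen I) (hIconn : I.OrdConnected)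
    (hsmooth : ContDiffOn ℝ (⊤ : ℕ∞) Ψ I)
    (hpoly : ¬ ∃ P : Polynomial ℝ, ∀ x ∈ I, Ψ x = Polynomial.eval x P) (n : ℕ) :
    ∃ b ∈ I, iteratedDerivWithin n Ψ I b ≠ 0 := by
  by_contra! h
  apply hpoly
  cases n with
  | zero => exact ⟨0, fun x hx => by simpa using h x hx⟩
  | succ n =>
    rcases I.eq_empty_or_nonempty with rfl | ⟨a, ha⟩
    · exact ⟨0, by simp⟩
    have hu : UniqueDiffOn ℝ I := hIopen.uniqueDiffOn
    have hconst : ∀ x ∈ I, Ψ x = taylorWithinEval Ψ n I a x := by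
      intro x hx
      have hd : ∀ y ∈ I, HasDerivWithinAt (fun t => taylorWithinEval Ψ n I t x) 0 I y := by
        intro y hy
        have := hasDerivWithinAt_taylorWithinEval (f := Ψ) (x := x) (y := y) (n := n) hu
          self_mem_nhdsWithin hy subset_rfl (hsmooth.of_le (by exact_mod_cast le_top))
          (hsmooth.differentiableOn_iteratedDerivWithin
            (by exact_mod_cast ENat.natCast_lt_top n) hu y hy)
        simpa [h y hy] using this
      have := hIconn.convex.norm_image_sub_le_of_norm_hasDerivWithin_le (C := 0) hd
        (by simp) ha hx
      rw [taylorWithinEval_self] at this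
      simpa [sub_eq_zero] using this
    refine ⟨∑ k ∈ Finset.range (n + 1), Polynomial.C ((k.factorial : ℝ)⁻¹ *
      iteratedDerivWithin k Ψ I a) * (Polynomial.X - Polynomial.C a) ^ k, fun x hx => ?_⟩
    rw [hconst x hx, taylor_within_apply, Polynomial.eval_finsetSum]
    refine Finset.sum_congr rfl fun k _ => ?_
    simp
    ring

/-- `g` is uniformly approximable on `K` by elements of the network class. -/
def Apx (Ψ : ℝ → ℝ) (W I K : Set ℝ) (g : ℝ → ℝ) : Prop :=
  ∀ ε : ℝ, 0 < ε → ∃ f ∈ NNet1 Ψ W I, ∀ x ∈ K, |f x - g x| < ε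

theorem NNet1_add {Ψ : ℝ → ℝ} {W I : Set ℝ} {f g : ℝ → ℝ} (hf : f ∈ NNet1 Ψ W I)
    (hg : g ∈ NNet1 Ψ W I) : (fun x => f x + g x) ∈ NNet1 Ψ W I := by
  obtain ⟨p, c, w, b, hw, hb, rfl⟩ := hf
  obtain ⟨q, c', w', b', hw', hb', rfl⟩ := hg
  refine ⟨p + q, Fin.append c c', Fin.append w w', Fin.append b b', ?_, ?_, ?_⟩
  · intro j
    refine Fin.addCases (fun i => ?_) (fun i => ?_) j
    · simpa using hw i
    · simpa using hw' i
  · intro j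
    refine Fin.addCases (fun i => ?_) (fun i => ?_) j
    · simpa using hb i
    · simpa using hb' i
  · funext x
    simp [Fin.sum_univ_add]

theorem NNet1_smul {Ψ : ℝ → ℝ} {W I : Set ℝ} {f : ℝ → ℝ} (a : ℝ) (hf : f ∈ NNet1 Ψ W I) :
    (fun x => a * f x) ∈ NNet1 Ψ W I := by
  obtain ⟨p, c, w, b, hw, hb, rfl⟩ := hf
  refine ⟨p, fun j => a * c j, w, b, hw, hb, ?_⟩
  funext x
  simp [Finset.mul_sum, mul_assoc]

theorem Apx_of_mem {Ψ : ℝ → ℝ} {W I K : Set ℝ} {f : ℝ → ℝ} (hf : f ∈ NNet1 Ψ W I) :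
    Apx Ψ W I K f := fun ε hε => ⟨f, hf, fun x _ => by simpa using hε⟩

theorem Apx_zero {Ψ : ℝ → ℝ} {W I K : Set ℝ} : Apx Ψ W I K (fun _ => 0) :=
  Apx_of_mem ⟨0, Fin.elim0, Fin.elim0, Fin.elim0, fun j => j.elim0, fun j => j.elim0, by simp⟩

theorem Apx_add {Ψ : ℝ → ℝ} {W I K : Set ℝ} {f g : ℝ → ℝ} (hf : Apx Ψ W I K f)
    (hg : Apx Ψ W I K g) : Apx Ψ W I K (fun x => f x + g x) := by
  intro ε hε
  obtain ⟨u, hu, hu'⟩ := hf (ε / 2) (by positivity)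
  obtain ⟨v, hv, hv'⟩ := hg (ε / 2) (by positivity)
  refine ⟨_, NNet1_add hu hv, fun x hx => ?_⟩
  have h1 := abs_lt.1 (hu' x hx)
  have h2 := abs_lt.1 (hv' x hx)
  rw [abs_lt]
  constructor <;> linarith [h1.1, h1.2, h2.1, h2.2]

theorem Apx_smul {Ψ : ℝ → ℝ} {W I K : Set ℝ} {f : ℝ → ℝ} (a : ℝ) (hf : Apx Ψ W I K f) :
    Apx Ψ W I K (fun x => a * f x) := by
  intro ε hε
  obtain ⟨u, hu, hu'⟩ := hf (ε / (|a| + 1)) (by positivity)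
  refine ⟨_, NNet1_smul a hu, fun x hx => ?_⟩
  have h1 := hu' x hx
  rw [lt_div_iff₀ (by positivity)] at h1
  rw [← mul_sub, abs_mul]
  nlinarith [abs_nonneg (u x - f x)]

theorem Apx_sum {Ψ : ℝ → ℝ} {W I K : Set ℝ} (s : Finset ℕ) (a : ℕ → ℝ)
    (h : ∀ k ∈ s, Apx Ψ W I K (fun x => x ^ k)) :
    Apx Ψ W I K (fun x => ∑ k ∈ s, a k * x ^ k) := by
  induction s using Finset.induction_on with
  | empty => simpa using Apx_zero
  | insert k s hk ih =>
    simp only [Finset.sum_insert hk]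
    exact Apx_add (Apx_smul _ (h k (by simp))) (ih fun j hj => h j (by simp [hj]))

theorem Apx_closed {Ψ : ℝ → ℝ} {W I K : Set ℝ} {g : ℝ → ℝ}
    (h : ∀ ε : ℝ, 0 < ε → ∃ f, Apx Ψ W I K f ∧ ∀ x ∈ K, |f x - g x| < ε) :
    Apx Ψ W I K g := by
  intro ε hε
  obtain ⟨u, hu, hu'⟩ := h (ε / 2) (by positivity)
  obtain ⟨v, hv, hv'⟩ := hu (ε / 2) (by positivity)
  refine ⟨v, hv, fun x hx => ?_⟩
  have h1 := abs_lt.1 (hu' x hx)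
  have h2 := abs_lt.1 (hv' x hx)
  rw [abs_lt]
  constructor <;> linarith [h1.1, h1.2, h2.1, h2.2]

open Set Filter Topology in
theorem Apx_pow (W : Set ℝ)
    (hW : (0 : ℝ) ∈ closure (W \ {0}))
    (Ψ : ℝ → ℝ) (I : Set ℝ) (hIopen : IsOpen I) (hIconn : I.OrdConnected)
    (hsmooth : ContDiffOn ℝ (⊤ : ℕ∞) Ψ I)
    (hpoly : ¬ ∃ P : Polynomial ℝ, ∀ x ∈ I, Ψ x = Polynomial.eval x P)
    (K : Set ℝ) (hK : IsCompact K) (n : ℕ) : Apx Ψ W I K (fun x => x ^ n) := by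
  induction n using Nat.strong_induction_on with
  | _ n ih =>
  obtain ⟨b, hb, hne⟩ := exists_iter_ne Ψ I hIopen hIconn hsmooth hpoly n
  obtain ⟨M, hM0, hM⟩ : ∃ M : ℝ, 0 < M ∧ ∀ x ∈ K, |x| ≤ M := by
    obtain ⟨M, hM⟩ := hK.isBounded.exists_norm_le
    exact ⟨max M 1, by positivity, fun x hx => (hM x hx).trans (le_max_left _ _)⟩
  set D : ℝ := (n.factorial : ℝ)⁻¹ * iteratedDerivWithin n Ψ I b with hD
  have hD0 : D ≠ 0 := mul_ne_zero (by positivity) hne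
  suffices h : Apx Ψ W I K (fun x => D * x ^ n) by
    have := Apx_smul D⁻¹ h
    simpa [← mul_assoc, hD0] using this
  apply Apx_closed
  intro ε hε
  have hT := taylor_isLittleO (n := n) hIconn.convex hb
    (hsmooth.of_le (by exact_mod_cast le_top))
  rw [hIopen.nhdsWithin_eq hb] at hT
  have hc : 0 < ε / (2 * M ^ n) := by positivity
  have hT' := hT.bound hc
  obtain ⟨δ, hδ, hball⟩ := Metric.eventually_nhds_iff.1 hT'
  obtain ⟨w, ⟨hwW, hw0⟩, hwd⟩ := Metric.mem_closure_iff.1 hW (δ / M) (by positivity)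
  have hw0 : w ≠ 0 := hw0
  have hwd : |w| < δ / M := by simpa [Real.dist_eq] using hwd
  rw [lt_div_iff₀ hM0] at hwd
  let a : ℕ → ℝ := fun k => -(w ^ n)⁻¹ * ((k.factorial : ℝ)⁻¹ * w ^ k *
    iteratedDerivWithin k Ψ I b)
  refine ⟨fun x => (w ^ n)⁻¹ * Ψ (w * x + b) + ∑ k ∈ Finset.range n, a k * x ^ k,
    Apx_add (Apx_smul _ (Apx_of_mem ⟨1, fun _ => 1, fun _ => w, fun _ => b, fun _ => hwW,
      fun _ => hb, by simp⟩)) (Apx_sum _ _ fun k hk => ih k (by simpa using hk)), ?_⟩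
  intro x hx
  have hxM := hM x hx
  have hwx : |w * x| < δ := by
    rw [abs_mul]
    nlinarith [abs_nonneg w]
  have key := hball (y := w * x + b) (by simpa [Real.dist_eq] using hwx)
  rw [taylor_within_apply, Finset.sum_range_succ] at key
  simp only [add_sub_cancel_right, smul_eq_mul, Real.norm_eq_abs] at key
  have e : (w ^ n)⁻¹ * Ψ (w * x + b) + ∑ k ∈ Finset.range n, a k * x ^ k - D * x ^ n
      = (w ^ n)⁻¹ * (Ψ (w * x + b) - (∑ k ∈ Finset.range n, ((k.factorial : ℝ)⁻¹ * (w * x) ^ k) *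
        iteratedDerivWithin k Ψ I b + ((n.factorial : ℝ)⁻¹ * (w * x) ^ n) *
          iteratedDerivWithin n Ψ I b)) := by
    have e1 : ∑ k ∈ Finset.range n, a k * x ^ k = -(w ^ n)⁻¹ *
        ∑ k ∈ Finset.range n, ((k.factorial : ℝ)⁻¹ * (w * x) ^ k) *
          iteratedDerivWithin k Ψ I b := by
      rw [Finset.mul_sum]
      refine Finset.sum_congr rfl fun k _ => ?_
      simp only [a]
      rw [mul_pow]
      ring
    have hwn : w ^ n ≠ 0 := pow_ne_zero _ hw0
    rw [e1, hD, mul_pow]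
    field_simp
    ring
  rw [e, abs_mul, abs_inv, abs_pow]
  have hwn : 0 < |w| ^ n := by positivity
  have hxn : |x| ^ n ≤ M ^ n := pow_le_pow_left₀ (abs_nonneg _) hxM n
  rw [abs_pow, abs_mul w x, mul_pow |w| |x|] at key
  rw [inv_mul_lt_iff₀ hwn]
  refine key.trans_lt ?_
  calc ε / (2 * M ^ n) * (|w| ^ n * |x| ^ n) ≤ ε / (2 * M ^ n) * (|w| ^ n * M ^ n) := by gcongr
    _ = |w| ^ n * (ε / 2) := by field_simp
    _ < |w| ^ n * ε := by gcongr; linarith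

/-- if `W` has no isolated points with `0 ∈ W`, and `Ψ` is `C^∞` on an open
interval `I` and coincides with no polynomial on `I`, then every monomial `x ↦ x^n` is
uniformly approximable on compact sets by elements of `N_1(Ψ, W, I)`; consequently
`N_1(Ψ, W, I)` is dense in `C(ℝ)` in the topology of uniform convergence on compact sets. -/
theorem nnet1_approximates_monomials (W : Set ℝ) (hW0 : (0 : ℝ) ∈ W)
    (hWacc : ∀ w ∈ W, w ∈ closure (W \ {w}))
    (Ψ : ℝ → ℝ) (I : Set ℝ) (hIopen : IsOpen I) (hIconn : I.OrdConnected)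
    (hsmooth : ContDiffOn ℝ (⊤ : ℕ∞) Ψ I)
    (hpoly : ¬ ∃ P : Polynomial ℝ, ∀ x ∈ I, Ψ x = Polynomial.eval x P) :
    (∀ (n : ℕ) (K : Set ℝ), IsCompact K → K.Nonempty → ∀ ε : ℝ, 0 < ε →
        ∃ f ∈ NNet1 Ψ W I, ∀ x ∈ K, |f x - x ^ n| < ε) ∧
    DenseOnCompacts (NNet1 Ψ W I) := by
  have hP := Apx_pow W (hWacc 0 hW0) Ψ I hIopen hIconn hsmooth hpoly
  refine ⟨fun n K hK _ ε hε => hP K hK n ε hε, fun K hK _ g hg => ?_⟩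
  apply Apx_closed
  intro ε hε
  obtain ⟨M, hM⟩ := hK.isBounded.exists_norm_le
  obtain ⟨p, hp⟩ := exists_polynomial_near_of_continuousOn (-M) M g hg.continuousOn ε hε
  refine ⟨fun x => p.eval x, ?_, fun x hx => hp x (abs_le.1 (hM x hx))⟩
  simp only [Polynomial.eval_eq_sum_range]
  exact Apx_sum _ _ fun k _ => hP K hK k
end

section
/- (Chui–Li) Let σ : ℝ → ℝ be a continuous sigmoidal function. Then for every r ≥ 1, the linear span of { x ↦ σ(m·x + k) : m ∈ ℤ^r, k ∈ ℤ } is dense in C(ℝ^r) in the topology of uniform convergence on compact sets. -/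
/-- A function `σ : ℝ → ℝ` is sigmoidal if `σ(t) → 1` as `t → +∞` and `σ(t) → 0`
as `t → -∞`. -/
def Sigmoidal (σ : ℝ → ℝ) : Prop :=
  Filter.Tendsto σ Filter.atTop (nhds 1) ∧ Filter.Tendsto σ Filter.atBot (nhds 0)

/-- `span { x ↦ σ(m·x + k) : m ∈ ℤ^r, k ∈ ℤ }`. -/
def ChuiLiNet (r : ℕ) (σ : ℝ → ℝ) : Set ((Fin r → ℝ) → ℝ) :=
  { F | ∃ (n : ℕ) (c : Fin n → ℝ) (m : Fin n → Fin r → ℤ) (k : Fin n → ℤ),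
      F = fun x => ∑ j, c j * σ ((∑ i, (m j i : ℝ) * x i) + (k j : ℝ)) }

lemma cl_bdd (σ : ℝ → ℝ) (hc : Continuous σ) (hσ : Sigmoidal σ) :
    ∃ B : ℝ, 0 < B ∧ ∀ t, |σ t| ≤ B := by
  obtain ⟨h1, h0⟩ := hσ
  have e1 := h1.eventually (Metric.ball_mem_nhds (1:ℝ) one_pos)
  have e0 := h0.eventually (Metric.ball_mem_nhds (0:ℝ) one_pos)
  obtain ⟨T, hT⟩ := Filter.eventually_atTop.1 e1
  obtain ⟨S, hS⟩ := Filter.eventually_atBot.1 e0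
  obtain ⟨C, hC⟩ := (isCompact_Icc (a := S) (b := T)).exists_bound_of_continuousOn hc.continuousOn
  refine ⟨max C 2, lt_of_lt_of_le two_pos (le_max_right _ _), fun t => ?_⟩
  by_cases hT' : T ≤ t
  · have := hT t hT'
    rw [Real.dist_eq, abs_lt] at this
    refine le_trans ?_ (le_max_right _ _)
    rw [abs_le]; constructor <;> linarith
  by_cases hS' : t ≤ S
  · have := hS t hS'
    rw [Real.dist_eq, abs_lt] at this
    refine le_trans ?_ (le_max_right _ _)
    rw [abs_le]; constructor <;> linarith
  · exact (hC t ⟨by linarith, by linarith⟩).trans (le_max_left _ _)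

lemma cl_scale (σ : ℝ → ℝ) (hσ : Sigmoidal σ) (η : ℝ) (hη : 0 < η) :
    ∃ j : ℕ, (∀ v : ℝ, 1 ≤ v → |σ (j * v) - 1| < η) ∧ (∀ v : ℝ, v ≤ -1 → |σ (j * v)| < η) := by
  obtain ⟨h1, h0⟩ := hσ
  have e1 := h1.eventually (Metric.ball_mem_nhds (1:ℝ) hη)
  have e0 := h0.eventually (Metric.ball_mem_nhds (0:ℝ) hη)
  obtain ⟨T, hT⟩ := Filter.eventually_atTop.1 e1
  obtain ⟨S, hS⟩ := Filter.eventually_atBot.1 e0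
  obtain ⟨j, hj⟩ := exists_nat_ge (max T (-S))
  have hj1 := (le_max_left _ _).trans hj
  have hj2 := (le_max_right _ _).trans hj
  have hj0 : (0:ℝ) ≤ j := Nat.cast_nonneg j
  refine ⟨j, fun v hv => ?_, fun v hv => ?_⟩
  · have := hT (j * v) (by nlinarith)
    rwa [Real.dist_eq] at this
  · have := hS (j * v) (by nlinarith)
    rwa [Real.dist_eq, sub_zero] at this

lemma cl_step (h : ℝ → ℝ) (N n p : ℕ) (hp : p + 1 ≤ n) :
    h (((p + 1 : ℕ) : ℝ) / N) = h 0 + ∑ k ∈ Finset.range n,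
      (h (((k + 1 : ℕ) : ℝ) / N) - h ((k : ℝ) / N)) * (if k ≤ p then 1 else 0) := by
  simp only [mul_ite, mul_one, mul_zero]
  rw [← Finset.sum_filter]
  have : (Finset.range n).filter (fun k => k ≤ p) = Finset.range (p + 1) := by
    ext k; simp; omega
  rw [this, Finset.sum_range_sub (fun k : ℕ => h ((k : ℝ) / N))]
  simp

lemma cl_oned (σ : ℝ → ℝ) (hc : Continuous σ) (hσ : Sigmoidal σ) (g : ℝ → ℝ) (hg : Continuous g)
    (a : ℕ) (ε : ℝ) (hε : 0 < ε) :
    ∃ (c0 : ℝ) (k0 : ℤ) (n : ℕ) (c : ℕ → ℝ) (J : ℤ) (κ : ℕ → ℤ), ∀ t : ℝ, |t| ≤ a →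
      |c0 * σ k0 + ∑ k ∈ Finset.range n, c k * σ (J * t + κ k) - g t| < ε := by
  obtain ⟨B, hB0, hB⟩ := cl_bdd σ hc hσ
  obtain ⟨k0, hk0⟩ : ∃ k0 : ℤ, σ k0 ≠ 0 := by
    obtain ⟨j, hj, -⟩ := cl_scale σ hσ 1 one_pos
    refine ⟨j, fun h => ?_⟩
    have := hj 1 le_rfl
    simp at this h
    rw [h] at this
    norm_num at this
  set h : ℝ → ℝ := fun u => g (u - a) with hh
  have hhc : Continuous h := by fun_prop
  -- modulus of continuity
  set eps1 : ℝ := ε / (4 * (B + 2)) with heps1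
  have heps1_pos : 0 < eps1 := by positivity
  have huc := (isCompact_Icc (a := (0:ℝ)) (b := 2 * a + 1)).uniformContinuousOn_of_continuous
    hhc.continuousOn
  obtain ⟨δ, hδ, hdelta⟩ := Metric.uniformContinuousOn_iff.1 huc eps1 heps1_pos
  obtain ⟨M, hM⟩ := exists_nat_one_div_lt hδ
  set N : ℕ := M + 1 with hN
  have hNpos : (0:ℝ) < N := by positivity
  have hN1 : (1:ℝ) ≤ N := by rw [hN]; push_cast; linarith [Nat.cast_nonneg (α := ℝ) M]
  have hNδ : 1 / (N:ℝ) < δ := by rw [hN]; push_cast; exact hM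
  set n : ℕ := 2 * a * N + 1 with hn
  have hnpos : (0:ℝ) < n := by positivity
  have hnle : (n:ℝ) / N ≤ 2 * a + 1 := by
    rw [div_le_iff₀ hNpos, hn]; push_cast; nlinarith
  set Δ : ℕ → ℝ := fun k => h (((k + 1 : ℕ) : ℝ) / N) - h ((k : ℝ) / N) with hΔ
  have hΔle : ∀ k < n, |Δ k| ≤ eps1 := by
    intro k hk
    have hk' : ((k + 1 : ℕ) : ℝ) / N ≤ 2 * a + 1 :=
      le_trans (by gcongr; exact_mod_cast hk) hnle
    have hkk : ((k : ℕ) : ℝ) / N ≤ ((k + 1 : ℕ) : ℝ) / N := by gcongr; omega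
    have := hdelta (((k + 1 : ℕ) : ℝ) / N) ⟨by positivity, hk'⟩ ((k : ℝ) / N)
      ⟨by positivity, hkk.trans hk'⟩ (by
        rw [Real.dist_eq, ← sub_div]; push_cast
        rw [add_sub_cancel_left, abs_of_nonneg (by positivity)]; exact hNδ)
    rw [Real.dist_eq] at this
    exact this.le
  set η : ℝ := 1 / n with hη
  have hη0 : 0 < η := by positivity
  obtain ⟨j, hj1, hj0⟩ := cl_scale σ hσ η hη0
  refine ⟨h 0 / σ k0, k0, n, Δ, j * N, fun k => j * N * a - j * k, fun t ht => ?_⟩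
  rw [div_mul_cancel₀ _ hk0]
  set u : ℝ := t + a with hu
  have hta := abs_le.1 ht
  have hu0 : 0 ≤ u := by rw [hu]; linarith
  have hu2 : u ≤ 2 * a := by rw [hu]; linarith
  have harg : ∀ k : ℕ, (((j * N : ℤ) : ℝ) * t + ((j * N * a - j * k : ℤ) : ℝ)) = j * (N * u - k) := by
    intro k; push_cast; rw [hu]; ring
  simp only [harg]
  set p : ℕ := ⌊(N:ℝ) * u⌋₊ with hp
  have hNu : 0 ≤ (N:ℝ) * u := by positivity
  have hp1 : (p:ℝ) ≤ N * u := Nat.floor_le hNu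
  have hp2 : N * u < p + 1 := Nat.lt_floor_add_one _
  have hpn : p + 1 ≤ n := by
    have : (p:ℝ) ≤ (2 * a * N : ℕ) := by push_cast; nlinarith
    have : p ≤ 2 * a * N := by exact_mod_cast this
    omega
  have hS := cl_step h N n p hpn
  -- distance of step value
  have hSg : |h (((p + 1 : ℕ) : ℝ) / N) - g t| < eps1 := by
    have hgt : g t = h u := by simp [hh, hu]
    rw [hgt]
    have hle : ((p + 1 : ℕ) : ℝ) / N ≤ 2 * a + 1 :=
      le_trans (by gcongr) hnle
    have := hdelta (((p + 1 : ℕ) : ℝ) / N) ⟨by positivity, hle⟩ u ⟨hu0, by linarith⟩ (by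
      refine lt_of_le_of_lt ?_ hNδ
      rw [Real.dist_eq]
      have : ((p + 1 : ℕ) : ℝ) / N - u = (p + 1 - N * u) / N := by
        push_cast; field_simp
      rw [this, abs_of_nonneg (by apply div_nonneg <;> linarith)]
      gcongr; linarith)
    rwa [Real.dist_eq] at this
  -- termwise bound
  have hterm : ∀ k : ℕ, |σ (j * (N * u - k)) - (if k ≤ p then 1 else 0)| ≤
      η + (B + 1) * (if k ∈ ({p, p + 1} : Finset ℕ) then 1 else 0) := by
    intro k
    by_cases hk : k ∈ ({p, p + 1} : Finset ℕ)
    · rw [if_pos hk]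
      have hb := abs_le.1 (hB (j * (N * u - k)))
      rw [abs_le]
      split_ifs <;> constructor <;> linarith
    · rw [if_neg hk]
      simp at hk
      rcases lt_or_ge k p with hlt | hge
      · rw [if_pos hlt.le]
        have : (k:ℝ) + 1 ≤ p := by exact_mod_cast hlt
        have := hj1 (N * u - k) (by linarith)
        linarith
      · have hge' : p + 2 ≤ k := by omega
        rw [if_neg (by omega)]
        have : (p:ℝ) + 2 ≤ k := by exact_mod_cast hge'
        have := hj0 (N * u - k) (by linarith)
        rw [sub_zero]
        linarith
  have hdiff : |h 0 + ∑ k ∈ Finset.range n, Δ k * σ (j * (N * u - k)) -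
      h (((p + 1 : ℕ) : ℝ) / N)| ≤ eps1 * (1 + 2 * (B + 1)) := by
    rw [hS, add_sub_add_left_eq_sub, ← Finset.sum_sub_distrib]
    calc _ ≤ ∑ k ∈ Finset.range n, |Δ k * σ (j * (N * u - k)) - Δ k * (if k ≤ p then 1 else 0)| :=
          Finset.abs_sum_le_sum_abs _ _
      _ ≤ ∑ k ∈ Finset.range n,
          eps1 * (η + (B + 1) * (if k ∈ ({p, p + 1} : Finset ℕ) then 1 else 0)) := by
          refine Finset.sum_le_sum fun k hk => ?_
          rw [← mul_sub, abs_mul]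
          exact mul_le_mul (hΔle k (Finset.mem_range.1 hk)) (hterm k) (abs_nonneg _) heps1_pos.le
      _ = eps1 * (n * η + (B + 1) *
          ∑ k ∈ Finset.range n, (if k ∈ ({p, p + 1} : Finset ℕ) then (1:ℝ) else 0)) := by
          rw [← Finset.mul_sum, Finset.sum_add_distrib, ← Finset.mul_sum]; simp
      _ ≤ eps1 * (1 + 2 * (B + 1)) := by
          have h1 : (n:ℝ) * η = 1 := by rw [hη]; field_simp
          have h2 : ∑ k ∈ Finset.range n, (if k ∈ ({p, p + 1} : Finset ℕ) then (1:ℝ) else 0) ≤ 2 := by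
            rw [Finset.sum_boole]
            have : ((Finset.range n).filter (fun k => k ∈ ({p, p + 1} : Finset ℕ))).card ≤ 2 :=
              le_trans (Finset.card_le_card (fun k hk => (Finset.mem_filter.1 hk).2))
                Finset.card_le_two
            exact_mod_cast this
          rw [h1]
          refine mul_le_mul_of_nonneg_left ?_ heps1_pos.le
          nlinarith
  have hεε : eps1 * (4 * (B + 2)) = ε := by rw [heps1]; field_simp
  have := abs_sub_le (h 0 + ∑ k ∈ Finset.range n, Δ k * σ (j * (N * u - k)))
    (h (((p + 1 : ℕ) : ℝ) / N)) (g t)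
  nlinarith

lemma cl_cont {r : ℕ} (K : Set (Fin r → ℝ)) (m : Fin r → ℤ) :
    Continuous (fun x : K => ∑ i, (m i : ℝ) * x.1 i) :=
  continuous_finsetSum _ fun i _ =>
    continuous_const.mul ((continuous_apply i).comp continuous_subtype_val)

/-- The generators restricted to `K`. -/
noncomputable def clGen {r : ℕ} (K : Set (Fin r → ℝ)) (σ : ℝ → ℝ) (hc : Continuous σ)
    (p : (Fin r → ℤ) × ℤ) : C(K, ℝ) :=
  ⟨fun x => σ ((∑ i, (p.1 i : ℝ) * x.1 i) + p.2), hc.comp ((cl_cont K p.1).add continuous_const)⟩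

/-- Exponential ridge functions restricted to `K`. -/
noncomputable def clExp {r : ℕ} (K : Set (Fin r → ℝ)) :
    Multiplicative (Fin r → ℤ) →* C(K, ℝ) where
  toFun m := ⟨fun x => Real.exp (∑ i, (m.toAdd i : ℝ) * x.1 i), Real.continuous_exp.comp (cl_cont K _)⟩
  map_one' := by ext x; simp
  map_mul' m mm := by
    ext x
    simp [add_mul, Finset.sum_add_distrib, Real.exp_add]

lemma clExp_mem {r : ℕ} (K : Set (Fin r → ℝ)) [CompactSpace K] (σ : ℝ → ℝ) (hc : Continuous σ)
    (hσ : Sigmoidal σ) (m : Multiplicative (Fin r → ℤ)) :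
    clExp K m ∈ (Submodule.span ℝ (Set.range (clGen K σ hc))).topologicalClosure := by
  rw [← SetLike.mem_coe, Submodule.topologicalClosure_coe, Metric.mem_closure_iff]
  intro ε hε
  have hcont : Continuous (fun x : K => ∑ i, (m.toAdd i : ℝ) * x.1 i) := cl_cont K _
  obtain ⟨C, hC⟩ := (isCompact_univ (X := K)).exists_bound_of_continuousOn hcont.continuousOn
  obtain ⟨a, ha⟩ := exists_nat_ge C
  obtain ⟨c0, k0, n, c, J, κ, H⟩ := cl_oned σ hc hσ Real.exp Real.continuous_exp a ε hε
  refine ⟨c0 • clGen K σ hc (0, k0) +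
    ∑ k ∈ Finset.range n, c k • clGen K σ hc (J • m.toAdd, κ k), ?_, ?_⟩
  · refine Submodule.add_mem _ (Submodule.smul_mem _ _ (Submodule.subset_span ⟨_, rfl⟩)) ?_
    exact Submodule.sum_mem _ fun k _ =>
      Submodule.smul_mem _ _ (Submodule.subset_span ⟨_, rfl⟩)
  · rw [dist_comm, ContinuousMap.dist_lt_iff hε]
    intro x
    have := H (∑ i, (m.toAdd i : ℝ) * x.1 i) ((hC x trivial).trans ha)
    rw [Real.dist_eq]
    simpa [clGen, clExp, ContinuousMap.sum_apply, Finset.mul_sum, mul_assoc] using this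

lemma cl_top {r : ℕ} (K : Set (Fin r → ℝ)) [CompactSpace K] (σ : ℝ → ℝ) (hc : Continuous σ)
    (hσ : Sigmoidal σ) (g : C(K, ℝ)) :
    g ∈ (Submodule.span ℝ (Set.range (clGen K σ hc))).topologicalClosure := by
  set W := (Submodule.span ℝ (Set.range (clGen K σ hc))).topologicalClosure with hW
  let A : Subalgebra ℝ C(K, ℝ) := Algebra.adjoin ℝ (MonoidHom.mrange (clExp K) : Set C(K, ℝ))
  have hAW : ∀ f ∈ A, f ∈ W := by
    intro f hf
    have hf' : f ∈ Subalgebra.toSubmodule A := hf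
    rw [Algebra.adjoin_eq_span_of_subset _ (by
      rw [Submonoid.closure_eq]; exact Submodule.subset_span)] at hf'
    refine (Submodule.span_le.2 ?_) hf'
    rintro _ ⟨m, rfl⟩
    exact clExp_mem K σ hc hσ m
  have hsep : A.SeparatesPoints := by
    intro x y hxy
    have : ∃ i, x.1 i ≠ y.1 i := by
      by_contra hcon
      push Not at hcon
      exact hxy (Subtype.ext (funext hcon))
    obtain ⟨i, hi⟩ := this
    refine ⟨_, ⟨clExp K (Multiplicative.ofAdd (Pi.single i 1)), Algebra.subset_adjoin ⟨_, rfl⟩, rfl⟩, ?_⟩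
    simpa [clExp, Pi.single_apply] using hi
  have htop := ContinuousMap.subalgebra_topologicalClosure_eq_top_of_separatesPoints A hsep
  have hg : g ∈ A.topologicalClosure := by rw [htop]; trivial
  have hg' : g ∈ closure (A : Set C(K, ℝ)) := hg
  have hcl : IsClosed (W : Set C(K, ℝ)) := Submodule.isClosed_topologicalClosure _
  exact closure_minimal hAW hcl hg'

/-- Chui–Li: for a continuous sigmoidal `σ` and every `r ≥ 1`, the span of
`{ x ↦ σ(m·x + k) : m ∈ ℤ^r, k ∈ ℤ }` is dense in `C(ℝ^r)` in the topology of uniform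
convergence on compact sets. -/
theorem chui_li (σ : ℝ → ℝ) (hc : Continuous σ) (hσ : Sigmoidal σ)
    (r : ℕ) (hr : 1 ≤ r) :
    DenseOnCompacts (ChuiLiNet r σ) := by
  intro K hK _ g hg ε hε
  have : CompactSpace K := isCompact_iff_compactSpace.1 hK
  have h := cl_top K σ hc hσ ⟨fun x => g x.1, by fun_prop⟩
  rw [← SetLike.mem_coe, Submodule.topologicalClosure_coe, Metric.mem_closure_iff] at h
  obtain ⟨f, hf, hd⟩ := h ε hε
  obtain ⟨n, c, G, rfl⟩ := Submodule.mem_span_set'.1 hf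
  choose p hp using fun j => (G j).2
  refine ⟨_, ⟨n, c, fun j => (p j).1, fun j => (p j).2, rfl⟩, fun x hx => ?_⟩
  rw [dist_comm, ContinuousMap.dist_lt_iff hε] at hd
  have := hd ⟨x, hx⟩
  rw [Real.dist_eq] at this
  simpa [← hp, clGen, ContinuousMap.sum_apply] using this
end

section
/- Let X ⊆ ℝ^r be a nonempty compact set and let σ : ℝ → ℝ be a bounded Borel-measurable sigmoidal function. If μ is a finite signed Borel measure on X such that ∫_X σ(m·x + k) dμ(x) = 0 for every m ∈ ℤ^r and every k ∈ ℤ, then μ = 0. -/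
open MeasureTheory

open MeasureTheory Filter Topology

lemma sig_lim1 {E : Type*} [MeasurableSpace E] (μ : Measure E) [IsFiniteMeasure μ]
    (σ : ℝ → ℝ) (C : ℝ) (hb : ∀ t, |σ t| ≤ C) (hmeas : Measurable σ) (hσ : Sigmoidal σ)
    (h : E → ℝ) (hh : Measurable h) (j : ℝ) :
    Tendsto (fun n : ℕ => ∫ x, σ ((n : ℝ) * h x + j) ∂μ) atTop
      (𝓝 (∫ x, (if 0 < h x then 1 else if h x = 0 then σ j else 0) ∂μ)) := by
  refine tendsto_integral_of_dominated_convergence (fun _ => C) ?_ (integrable_const _) ?_ ?_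
  · intro n
    exact (hmeas.comp ((hh.const_mul _).add_const _)).aestronglyMeasurable
  · intro n
    exact Eventually.of_forall fun x => by simpa using hb _
  · refine Eventually.of_forall fun x => ?_
    rcases lt_trichotomy (h x) 0 with hx | hx | hx
    · rw [if_neg (by linarith), if_neg hx.ne]
      refine hσ.2.comp ?_
      exact tendsto_atBot_add_const_right _ _
        ((tendsto_natCast_atTop_atTop (R := ℝ)).atTop_mul_const_of_neg hx)
    · simp [hx]
    · rw [if_pos hx]
      refine hσ.1.comp ?_
      exact tendsto_atTop_add_const_right _ _
        ((tendsto_natCast_atTop_atTop (R := ℝ)).atTop_mul_const hx)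

lemma sig_lim2 {E : Type*} [MeasurableSpace E] (μ : Measure E) [IsFiniteMeasure μ]
    (σ : ℝ → ℝ) (C : ℝ) (hb : ∀ t, |σ t| ≤ C) (hσ : Sigmoidal σ)
    (h : E → ℝ) (hh : Measurable h) :
    Tendsto (fun l : ℕ => ∫ x, (if 0 < h x then 1 else if h x = 0 then σ (-(l : ℝ)) else 0) ∂μ)
      atTop (𝓝 (μ.real {x | 0 < h x})) := by
  have hms : MeasurableSet {x | 0 < h x} := measurableSet_lt measurable_const hh
  have hms0 : MeasurableSet {x | h x = 0} := hh (measurableSet_singleton 0)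
  have e : μ.real {x | 0 < h x} = ∫ x, (if 0 < h x then (1 : ℝ) else 0) ∂μ := by
    rw [← integral_indicator_one hms]
    rfl
  rw [e]
  have hC : 0 ≤ C := (abs_nonneg _).trans (hb 0)
  refine tendsto_integral_of_dominated_convergence (fun _ => max 1 C) ?_ (integrable_const _) ?_ ?_
  · intro n
    exact (Measurable.ite hms measurable_const
      (Measurable.ite hms0 measurable_const measurable_const)).aestronglyMeasurable
  · intro n
    refine Eventually.of_forall fun x => ?_
    split_ifs
    · simp
    · exact (hb _).trans (le_max_right _ _)
    · simp
  · refine Eventually.of_forall fun x => ?_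
    by_cases h1 : 0 < h x
    · simp [h1]
    by_cases h2 : h x = 0
    · simp only [h2, lt_irrefl, if_false, if_true]
      exact hσ.2.comp (tendsto_neg_atTop_atBot.comp tendsto_natCast_atTop_atTop)
    · simp [h1, h2]

lemma sig_half {E : Type*} [MeasurableSpace E] (μ ν : Measure E) [IsFiniteMeasure μ]
    [IsFiniteMeasure ν]
    (σ : ℝ → ℝ) (C : ℝ) (hb : ∀ t, |σ t| ≤ C) (hmeas : Measurable σ) (hσ : Sigmoidal σ)
    (h : E → ℝ) (hh : Measurable h)
    (H : ∀ n l : ℕ, ∫ x, σ ((n : ℝ) * h x + -(l : ℝ)) ∂μ = ∫ x, σ ((n : ℝ) * h x + -(l : ℝ)) ∂ν) :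
    μ {x | 0 < h x} = ν {x | 0 < h x} := by
  have A : ∀ l : ℕ, ∫ x, (if 0 < h x then 1 else if h x = 0 then σ (-(l : ℝ)) else 0) ∂μ
      = ∫ x, (if 0 < h x then 1 else if h x = 0 then σ (-(l : ℝ)) else 0) ∂ν := by
    intro l
    refine tendsto_nhds_unique (sig_lim1 μ σ C hb hmeas hσ h hh (-(l : ℝ))) ?_
    simp_rw [H]
    exact sig_lim1 ν σ C hb hmeas hσ h hh (-(l : ℝ))
  have B : μ.real {x | 0 < h x} = ν.real {x | 0 < h x} := by
    refine tendsto_nhds_unique (sig_lim2 μ σ C hb hσ h hh) ?_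
    simp_rw [A]
    exact sig_lim2 ν σ C hb hσ h hh
  exact (measureReal_eq_measureReal_iff).1 B

lemma map_eq_of_rat {E : Type*} [MeasurableSpace E] (μ ν : Measure E) [IsFiniteMeasure μ]
    [IsFiniteMeasure ν] (f : E → ℝ) (hf : Measurable f) (hu : μ Set.univ = ν Set.univ)
    (H : ∀ c : ℚ, μ {x | (c : ℝ) < f x} = ν {x | (c : ℝ) < f x}) : μ.map f = ν.map f := by
  refine ext_of_generate_finite _ (BorelSpace.measurable_eq.trans Real.borel_eq_generateFrom_Ioi_rat)
    Real.isPiSystem_Ioi_rat ?_ ?_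
  · intro s hs
    simp only [Set.mem_iUnion, Set.mem_singleton_iff] at hs
    obtain ⟨c, rfl⟩ := hs
    rw [Measure.map_apply hf measurableSet_Ioi, Measure.map_apply hf measurableSet_Ioi]
    exact H c
  · rw [Measure.map_apply hf MeasurableSet.univ, Measure.map_apply hf MeasurableSet.univ]
    exact hu

lemma cont_char {r : ℕ} (μ : Measure (Fin r → ℝ)) [IsFiniteMeasure μ] :
    Continuous (fun a : Fin r → ℝ => ∫ x, Complex.exp ((∑ i, a i * x i : ℝ) * Complex.I) ∂μ) := by
  refine continuous_of_dominated (bound := fun _ => 1) ?_ ?_ (integrable_const _) ?_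
  · intro a
    exact Continuous.aestronglyMeasurable (by fun_prop)
  · intro a
    exact Eventually.of_forall fun x => (Complex.norm_exp_ofReal_mul_I _).le
  · exact Eventually.of_forall fun x => by fun_prop

/-- a bounded Borel-measurable sigmoidal function is discriminatory.  A finite
signed Borel measure on a compact set `X ⊆ ℝ^r` is represented as the difference `μ - ν` of
two finite Borel measures concentrated on `X`; if all the integrals
`∫_X σ(m·x + k) d(μ - ν)` vanish, then `μ - ν = 0`, i.e. `μ = ν`. -/
theorem bounded_sigmoidal_discriminatory (r : ℕ) (X : Set (Fin r → ℝ))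
    (hX : IsCompact X) (hXne : X.Nonempty)
    (σ : ℝ → ℝ) (hb : ∃ C : ℝ, ∀ t, |σ t| ≤ C) (hmeas : Measurable σ)
    (hσ : Sigmoidal σ)
    (μ ν : Measure (Fin r → ℝ)) [IsFiniteMeasure μ] [IsFiniteMeasure ν]
    (hμ : μ Xᶜ = 0) (hν : ν Xᶜ = 0)
    (hint : ∀ (m : Fin r → ℤ) (k : ℤ),
      ∫ x in X, σ ((∑ i, (m i : ℝ) * x i) + (k : ℝ)) ∂μ
        = ∫ x in X, σ ((∑ i, (m i : ℝ) * x i) + (k : ℝ)) ∂ν) :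
    μ = ν := by
  obtain ⟨C, hb⟩ := hb
  rw [Measure.restrict_eq_self_of_ae_mem (show ∀ᵐ x ∂μ, x ∈ X from hμ),
    Measure.restrict_eq_self_of_ae_mem (show ∀ᵐ x ∂ν, x ∈ X from hν)] at hint
  have lin : ∀ a : Fin r → ℝ, Measurable (fun x : Fin r → ℝ => ∑ i, a i * x i) := fun a =>
    Continuous.measurable (by fun_prop)
  have half : ∀ (m : Fin r → ℤ) (p : ℤ), μ {x | 0 < (∑ i, (m i : ℝ) * x i) + (p : ℝ)}
      = ν {x | 0 < (∑ i, (m i : ℝ) * x i) + (p : ℝ)} := by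
    intro m p
    refine sig_half μ ν σ C hb hmeas hσ _ ((lin _).add_const _) ?_
    intro n l
    have := hint (fun i => n * m i) (n * p - l)
    have e : ∀ x : Fin r → ℝ, (∑ i, (((n * m i : ℤ)) : ℝ) * x i) + ((n * p - l : ℤ) : ℝ)
        = (n : ℝ) * ((∑ i, (m i : ℝ) * x i) + (p : ℝ)) + -(l : ℝ) := by
      intro x
      push_cast
      simp_rw [mul_assoc]
      rw [← Finset.mul_sum]
      ring
    simp_rw [e] at this
    exact this
  have hu : μ Set.univ = ν Set.univ := by
    have := half 0 1
    simpa using this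
  have mapZ : ∀ m : Fin r → ℤ, μ.map (fun x => ∑ i, (m i : ℝ) * x i)
      = ν.map (fun x => ∑ i, (m i : ℝ) * x i) := by
    intro m
    refine map_eq_of_rat μ ν _ (lin _) hu ?_
    intro c
    have hd : (0 : ℝ) < c.den := by exact_mod_cast c.den_pos
    have e : {x : Fin r → ℝ | (c : ℝ) < ∑ i, (m i : ℝ) * x i}
        = {x | 0 < (∑ i, (((c.den * m i : ℤ)) : ℝ) * x i) + ((-c.num : ℤ) : ℝ)} := by
      ext x
      simp only [Set.mem_setOf_eq]
      push_cast
      simp_rw [mul_assoc]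
      rw [← Finset.mul_sum, Rat.cast_def, div_lt_iff₀ hd]
      constructor <;> intro h <;> linarith
    rw [e]
    exact half (fun i => c.den * m i) (-c.num)
  have charQ : ∀ q : Fin r → ℚ,
      ∫ x, Complex.exp ((∑ i, (q i : ℝ) * x i : ℝ) * Complex.I) ∂μ
      = ∫ x, Complex.exp ((∑ i, (q i : ℝ) * x i : ℝ) * Complex.I) ∂ν := by
    intro q
    obtain ⟨D, hD, m, hm⟩ : ∃ D : ℕ, (D : ℝ) ≠ 0 ∧ ∃ m : Fin r → ℤ,
        ∀ i, (q i : ℝ) = (D : ℝ)⁻¹ * m i := by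
      have hD : ((∏ i, (q i).den : ℕ) : ℝ) ≠ 0 := by
        exact_mod_cast Finset.prod_ne_zero_iff.2 fun i _ => (q i).den_nz
      refine ⟨∏ i, (q i).den, hD, fun i => (q i).num * (∏ j ∈ Finset.univ.erase i, (q j).den : ℕ), ?_⟩
      intro i
      rw [eq_inv_mul_iff_mul_eq₀ hD, ← Finset.mul_prod_erase _ _ (Finset.mem_univ i)]
      have : ((q i).den : ℝ) ≠ 0 := by exact_mod_cast (q i).den_nz
      rw [Rat.cast_def (q i)]
      push_cast
      field_simp
    have key : ∀ ρ : Measure (Fin r → ℝ),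
        ∫ x, Complex.exp ((∑ i, (q i : ℝ) * x i : ℝ) * Complex.I) ∂ρ
        = ∫ t, Complex.exp (((D : ℝ)⁻¹ * t : ℝ) * Complex.I)
            ∂(ρ.map (fun x => ∑ i, (m i : ℝ) * x i)) := by
      intro ρ
      rw [integral_map (lin _).aemeasurable (Continuous.aestronglyMeasurable (by fun_prop))]
      congr 1
      ext x
      simp_rw [hm, mul_assoc]
      rw [← Finset.mul_sum]
    rw [key, key, mapZ]
  have dense : DenseRange (fun (q : Fin r → ℚ) (i : Fin r) => (q i : ℝ)) :=
    DenseRange.piMap (fun _ => Rat.denseRange_cast)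
  have charR := dense.equalizer (cont_char μ) (cont_char ν) (funext charQ)
  refine Measure.ext_of_charFunDual ?_
  ext L
  have eL : ∀ x, L x = ∑ i, L (Pi.single i 1) * x i := by
    intro x
    conv_lhs => rw [pi_eq_sum_univ' x]
    simp [mul_comm]
  rw [charFunDual_apply, charFunDual_apply]
  have c := congrFun charR (fun i => L (Pi.single i 1))
  simp only [← eL] at c
  exact c
end

section
/- (Sun–Cheney) Let X be a real normed space with X ≠ {0}, and let F be a set of continuous linear functionals on X such that { f/‖f‖ : f ∈ F, f ≠ 0 } is dense, with respect to the operator norm, in the unit sphere { φ ∈ X* : ‖φ‖ = 1 } of the dual space X*. Let σ : ℝ → ℝ be a continuous sigmoidal function. Then the linear span of { x ↦ σ(k f(x) + j) : k, j ∈ ℤ, f ∈ F } is dense in C(X) in the topology of uniform convergence on compact subsets of X. -/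
open Filter Topology

lemma sc_bounded (σ : ℝ → ℝ) (hc : Continuous σ) (hσ : Sigmoidal σ) :
    ∃ B : ℝ, 0 ≤ B ∧ ∀ t, |σ t| ≤ B := by
  have h1 := hσ.1.eventually (Metric.ball_mem_nhds (1:ℝ) one_pos)
  have h2 := hσ.2.eventually (Metric.ball_mem_nhds (0:ℝ) one_pos)
  obtain ⟨a, ha⟩ := eventually_atTop.1 h1
  obtain ⟨b, hb⟩ := eventually_atBot.1 h2
  obtain ⟨C, hC⟩ := (isCompact_Icc (a := b) (b := a)).exists_bound_of_continuousOn hc.continuousOn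
  refine ⟨max 2 C, by positivity, fun t => ?_⟩
  by_cases hta : a ≤ t
  · have := ha t hta
    rw [Real.dist_eq, abs_lt] at this
    exact le_max_of_le_left (abs_le.2 ⟨by linarith, by linarith⟩)
  by_cases htb : t ≤ b
  · have := hb t htb
    rw [Real.dist_eq, abs_lt] at this
    exact le_max_of_le_left (abs_le.2 ⟨by linarith, by linarith⟩)
  · push Not at hta htb
    exact le_max_of_le_right (hC t ⟨htb.le, hta.le⟩)

/-- the one-dimensional span -/
def scSpan (σ : ℝ → ℝ) : Submodule ℝ (ℝ → ℝ) :=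
  Submodule.span ℝ {v | ∃ k j : ℤ, v = fun t => σ (k * t + j)}

lemma sc_scale (σ : ℝ → ℝ) (hσ : Sigmoidal σ) (η : ℝ) (hη : 0 < η) :
    ∃ m : ℕ, ∀ s : ℝ, (1 ≤ s → |σ (m * s) - 1| ≤ η) ∧ (s ≤ -1 → |σ (m * s)| ≤ η) := by
  have h1 := hσ.1.eventually (Metric.ball_mem_nhds (1:ℝ) hη)
  have h2 := hσ.2.eventually (Metric.ball_mem_nhds (0:ℝ) hη)
  obtain ⟨a, ha⟩ := eventually_atTop.1 h1
  obtain ⟨b, hb⟩ := eventually_atBot.1 h2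
  obtain ⟨m, hm⟩ := exists_nat_ge (max a (-b))
  have hma := (le_max_left _ _).trans hm
  have hmb := (le_max_right _ _).trans hm
  have hm0 : (0:ℝ) ≤ m := by positivity
  refine ⟨m, fun s => ⟨fun hs => ?_, fun hs => ?_⟩⟩
  · have := ha (m * s) (by nlinarith)
    rw [Real.dist_eq] at this
    exact this.le
  · have := hb (m * s) (by nlinarith)
    rw [Real.dist_eq, sub_zero] at this
    exact this.le

lemma sc_step (σ : ℝ → ℝ) (B : ℝ) (hB0 : 0 ≤ B) (hB : ∀ t, |σ t| ≤ B) (η : ℝ) (hη : 0 < η) (m : ℕ)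
    (hm : ∀ s : ℝ, (1 ≤ s → |σ (m * s) - 1| ≤ η) ∧ (s ≤ -1 → |σ (m * s)| ≤ η))
    (N : ℕ) (a : ℕ → ℝ) (δ : ℝ) (hδ : 0 ≤ δ) (ha : ∀ i < N, |a (i+1) - a i| ≤ δ)
    (u : ℝ) (hu0 : 0 ≤ u) (huN : u ≤ N) :
    |a 0 + ∑ i ∈ Finset.range N, (a (i+1) - a i) * σ (m * (u - i)) - a ⌊u⌋₊|
      ≤ δ * (N * η + 2 * (B + 1)) := by
  set p := ⌊u⌋₊ with hp
  have hpu : (p:ℝ) ≤ u := Nat.floor_le hu0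
  have hup : u < p + 1 := Nat.lt_floor_add_one u
  have hpN : p ≤ N := by
    have : (p:ℝ) ≤ N := hpu.trans huN
    exact_mod_cast this
  have e1 : a p - a 0 = ∑ i ∈ Finset.range N, (a (i+1) - a i) * (if i < p then 1 else 0) := by
    rw [← Finset.sum_range_sub]
    simp only [mul_ite, mul_one, mul_zero]
    rw [← Finset.sum_filter]
    congr 1
    ext i; simp; omega
  have e2 : a 0 + ∑ i ∈ Finset.range N, (a (i+1) - a i) * σ (m * (u - i)) - a p
      = ∑ i ∈ Finset.range N, (a (i+1) - a i) * (σ (m * (u - i)) - (if i < p then 1 else 0)) := by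
    simp only [mul_sub (_ - _)]
    rw [Finset.sum_sub_distrib, ← e1]; ring
  rw [e2]
  have key : ∀ i ∈ Finset.range N,
      |(a (i+1) - a i) * (σ (m * (u - i)) - (if i < p then 1 else 0))|
        ≤ δ * (η + ((if i = p then (B+1) else 0) + (if i = p + 1 then (B+1) else 0))) := by
    intro i hi
    rw [abs_mul]
    refine mul_le_mul (ha i (Finset.mem_range.1 hi)) ?_ (abs_nonneg _) hδ
    have hb := hB (m * (u - i))
    rcases lt_trichotomy i p with h | h | h
    · have : (i:ℝ) + 1 ≤ p := by exact_mod_cast h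
      have := (hm (u - i)).1 (by linarith)
      have h' : i ≠ p := by omega
      have h'' : i ≠ p + 1 := by omega
      simpa [h, h', h''] using this
    · have h' : ¬ i < p := by omega
      have h'' : i ≠ p + 1 := by omega
      rw [if_neg h', if_pos h, if_neg h'', sub_zero]
      linarith
    · have h' : ¬ i < p := by omega
      have h1 : i ≠ p := by omega
      rw [if_neg h', if_neg h1, sub_zero]
      by_cases h'' : i = p + 1
      · rw [if_pos h'']; linarith
      · have h3 : p + 2 ≤ i := by omega
        have : (p:ℝ) + 2 ≤ i := by exact_mod_cast h3
        have := (hm (u - i)).2 (by linarith)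
        simpa [h''] using this
  refine (Finset.abs_sum_le_sum_abs _ _).trans ((Finset.sum_le_sum key).trans ?_)
  rw [← Finset.mul_sum]
  refine mul_le_mul_of_nonneg_left ?_ hδ
  rw [Finset.sum_add_distrib, Finset.sum_add_distrib, Finset.sum_ite_eq', Finset.sum_ite_eq']
  simp only [Finset.sum_const, Finset.card_range, nsmul_eq_mul]
  split_ifs <;> linarith

lemma sc_one_dim (σ : ℝ → ℝ) (hc : Continuous σ) (hσ : Sigmoidal σ) (g : ℝ → ℝ)
    (hg : Continuous g) (M : ℕ) (ε : ℝ) (hε : 0 < ε) :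
    ∃ v ∈ scSpan σ, ∀ t : ℝ, |t| ≤ M → |v t - g t| < ε := by
  obtain ⟨B, hB0, hB⟩ := sc_bounded σ hc hσ
  set δ := ε / (2 * (2 * B + 4)) with hδd
  have hδ : 0 < δ := by positivity
  have huc := (isCompact_Icc (a := -(M:ℝ)) (b := M)).uniformContinuousOn_of_continuous
    hg.continuousOn
  obtain ⟨d, hd, hdg⟩ := Metric.uniformContinuousOn_iff.1 huc δ hδ
  obtain ⟨n, hn⟩ := exists_nat_gt (1 / d)
  have hn0 : (0:ℝ) < n := lt_trans (by positivity) hn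
  have hnd : 1 / (n:ℝ) < d := by
    rw [div_lt_iff₀ hn0]; rw [div_lt_iff₀ hd] at hn; linarith
  set L := n * M with hL
  have hLr : (L:ℝ) = n * M := by simp [hL]
  set N := 2 * L with hN
  have hNr : (N:ℝ) = 2 * L := by simp [hN]
  set h : ℝ → ℝ := fun u => g ((u - L) / n) with hh
  have hosc : ∀ u w : ℝ, 0 ≤ u → u ≤ N → 0 ≤ w → w ≤ N → |u - w| ≤ 1 → |h u - h w| ≤ δ := by
    intro u w hu0 hu1 hw0 hw1 huw
    have A : ∀ u : ℝ, 0 ≤ u → u ≤ N → (u - L) / n ∈ Set.Icc (-(M:ℝ)) M := by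
      intro u h0 h1
      constructor
      · rw [le_div_iff₀ hn0]; nlinarith
      · rw [div_le_iff₀ hn0]; nlinarith
    have := hdg _ (A u hu0 hu1) _ (A w hw0 hw1) (by
      rw [Real.dist_eq, ← sub_div, abs_div, abs_of_pos hn0, sub_sub_sub_cancel_right]
      refine lt_of_le_of_lt ?_ hnd
      gcongr)
    rw [Real.dist_eq] at this
    exact this.le
  set η := 1 / ((N:ℝ) + 1) with hη
  have hη0 : 0 < η := by positivity
  obtain ⟨m, hm⟩ := sc_scale σ hσ η hη0
  have hj : ∃ j : ℤ, σ j ≠ 0 := by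
    have h1 := (hσ.1.comp tendsto_natCast_atTop_atTop).eventually (Metric.ball_mem_nhds (1:ℝ) one_pos)
    obtain ⟨j, hj⟩ := h1.exists
    refine ⟨j, fun h0 => ?_⟩
    rw [Real.dist_eq, Function.comp] at hj
    have h0' : σ (j:ℝ) = 0 := by simpa using h0
    rw [h0'] at hj
    norm_num at hj
  obtain ⟨j, hj⟩ := hj
  refine ⟨(h 0 / σ j) • (fun t => σ (((0:ℤ):ℝ) * t + (j:ℤ))) +
    ∑ i ∈ Finset.range N, (h ((i+1 : ℕ)) - h (i:ℕ)) •
      (fun t => σ (((m * n : ℤ) : ℝ) * t + ((m * (L - i) : ℤ) : ℝ))), ?_, ?_⟩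
  · refine Submodule.add_mem _ (Submodule.smul_mem _ _ (Submodule.subset_span ⟨_, _, rfl⟩))
      (Submodule.sum_mem _ fun i _ => Submodule.smul_mem _ _ (Submodule.subset_span ⟨_, _, rfl⟩))
  · intro t ht
    rw [abs_le] at ht
    have hu0 : 0 ≤ n * t + L := by rw [hLr]; nlinarith
    have hu1 : n * t + L ≤ N := by rw [hNr, hLr]; nlinarith
    have hstep := sc_step σ B hB0 hB η hη0 m hm N (fun i => h (i:ℕ)) δ hδ.le (by
      intro i hi
      have hi' : (i:ℝ) + 1 ≤ N := by exact_mod_cast hi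
      have hi0 : (0:ℝ) ≤ i := by positivity
      refine hosc _ _ (by positivity) (by push_cast; linarith) hi0 (by linarith) ?_
      push_cast; simp) (n * t + L) hu0 hu1
    set p := ⌊n * t + L⌋₊ with hp
    have hpu : (p:ℝ) ≤ n * t + L := Nat.floor_le hu0
    have hup : n * t + L < p + 1 := Nat.lt_floor_add_one _
    have hlast := hosc p (n * t + L) (by positivity) (by linarith) hu0 hu1
      (abs_le.2 ⟨by linarith, by linarith⟩)
    have hgt : h (n * t + L) = g t := by
      simp only [hh]; congr 1; field_simp; ring
    rw [hgt] at hlast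
    have hval : ((h 0 / σ j) • (fun t => σ (((0:ℤ):ℝ) * t + (j:ℤ))) +
      ∑ i ∈ Finset.range N, (h ((i+1 : ℕ)) - h (i:ℕ)) •
        (fun t => σ (((m * n : ℤ) : ℝ) * t + ((m * (L - i) : ℤ) : ℝ)))) t
        = h ((0:ℕ):ℝ) + ∑ i ∈ Finset.range N, (h ((i+1 : ℕ)) - h (i:ℕ)) *
          σ (m * (n * t + L - i)) := by
      simp only [Pi.add_apply, Finset.sum_apply, Pi.smul_apply, smul_eq_mul]
      congr 1
      · simp [hj]
      · refine Finset.sum_congr rfl fun i _ => ?_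
        congr 2; push_cast; ring
    rw [hval]
    have hNη : N * η ≤ 1 := by
      rw [hη, mul_one_div, div_le_one (by positivity)]; linarith
    have : δ * (N * η + 2 * (B + 1)) ≤ δ * (2 * B + 3) := by
      refine mul_le_mul_of_nonneg_left (by linarith) hδ.le
    have h4 : δ * (2 * B + 3) + δ = ε / 2 := by
      rw [hδd]; field_simp; ring
    calc _ ≤ _ := abs_sub_le _ (h (p:ℝ)) _
      _ ≤ δ * (2 * B + 3) + δ := add_le_add (hstep.trans this) hlast
      _ < ε := by rw [h4]; linarith

/-- Sun–Cheney: let `X ≠ {0}` be a real normed space, `F` a family of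
continuous linear functionals whose normalizations are dense in the unit sphere of `X*`,
and `σ` a continuous sigmoidal function.  Then the span of
`{ x ↦ σ(k f(x) + j) : k, j ∈ ℤ, f ∈ F }` is dense in `C(X)` in the topology of uniform
convergence on compact sets. -/
theorem sun_cheney (X : Type*) [NormedAddCommGroup X] [NormedSpace ℝ X]
    (hX : ∃ x : X, x ≠ 0)
    (F : Set (X →L[ℝ] ℝ))
    (hF : ∀ φ : X →L[ℝ] ℝ, ‖φ‖ = 1 → ∀ ε : ℝ, 0 < ε →
      ∃ f ∈ F, f ≠ 0 ∧ ‖(‖f‖⁻¹ : ℝ) • f - φ‖ < ε)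
    (σ : ℝ → ℝ) (hc : Continuous σ) (hσ : Sigmoidal σ) :
    DenseOnCompacts { h : X → ℝ |
      ∃ (n : ℕ) (c : Fin n → ℝ) (k j : Fin n → ℤ) (f : Fin n → X →L[ℝ] ℝ),
        (∀ i, f i ∈ F) ∧
        h = fun x => ∑ i, c i * σ ((k i : ℝ) * f i x + (j i : ℝ)) } := by
  intro K hK hKne g hg ε hε
  have : CompactSpace K := isCompact_iff_compactSpace.1 hK
  set G : Set C(K, ℝ) := {w | ∃ f ∈ F, ∃ k j : ℤ, ∀ x : K, w x = σ (k * f x + j)} with hG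
  set V : Submodule ℝ C(K, ℝ) := Submodule.span ℝ G with hV
  obtain ⟨R, hR⟩ := hK.isBounded.exists_norm_le
  have hR0 : 0 ≤ R := by
    obtain ⟨x, hx⟩ := hKne
    exact (norm_nonneg x).trans (hR x hx)
  -- ridge functions lie in the closure
  have ridge : ∀ f ∈ F, ∀ q : ℝ → ℝ, Continuous q → ∀ w : C(K, ℝ), (∀ x : K, w x = q (f x)) →
      w ∈ V.topologicalClosure := by
    intro f hf q hq w hw
    rw [← SetLike.mem_coe, Submodule.topologicalClosure_coe, Metric.mem_closure_iff]
    intro e he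
    obtain ⟨M, hM⟩ := exists_nat_ge (‖f‖ * R)
    obtain ⟨v, hv, hvq⟩ := sc_one_dim σ hc hσ q hq M e he
    have lift : ∃ z ∈ V, ∀ x : K, z x = v (f x) := by
      refine Submodule.span_induction (p := fun v _ => ∃ z ∈ V, ∀ x : K, z x = v (f x))
        ?_ ?_ ?_ ?_ hv
      · rintro _ ⟨k, j, rfl⟩
        refine ⟨⟨fun x : K => σ (k * f x + j), by fun_prop⟩,
          Submodule.subset_span ⟨f, hf, k, j, fun x => rfl⟩, fun x => rfl⟩
      · exact ⟨0, V.zero_mem, fun x => rfl⟩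
      · rintro a b _ _ ⟨z, hz, h1⟩ ⟨y, hy, h2⟩
        exact ⟨z + y, V.add_mem hz hy, fun x => by simp [h1, h2]⟩
      · rintro c a _ ⟨z, hz, h1⟩
        exact ⟨c • z, V.smul_mem c hz, fun x => by simp [h1]⟩
    obtain ⟨z, hz, hzv⟩ := lift
    refine ⟨z, hz, ?_⟩
    rw [ContinuousMap.dist_lt_iff he]
    intro x
    rw [hw, hzv, dist_comm, Real.dist_eq]
    apply hvq
    calc |f x| ≤ ‖f‖ * ‖(x:X)‖ := f.le_opNorm _
      _ ≤ ‖f‖ * R := by gcongr; exact hR x x.2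
      _ ≤ M := hM
  -- restriction of functionals
  let r : (X →L[ℝ] ℝ) → C(K, ℝ) := fun φ => ⟨fun x => φ x, by fun_prop⟩
  let E : (X →L[ℝ] ℝ) → C(K, ℝ) := fun φ => ⟨fun x => Real.exp (φ x), by fun_prop⟩
  have hEcont : Continuous E := by
    refine ContinuousMap.continuous_of_continuous_uncurry _ ?_
    simp only [E, Function.uncurry_def, ContinuousMap.coe_mk]
    fun_prop
  -- exponentials lie in the closure
  have hexp1 : ∀ φ : X →L[ℝ] ℝ, ‖φ‖ = 1 → ∀ s : ℝ, E (s • φ) ∈ V.topologicalClosure := by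
    intro φ hφ s
    have hcl : φ ∈ closure {ψ : X →L[ℝ] ℝ | ∃ f ∈ F, ψ = (‖f‖⁻¹ : ℝ) • f} := by
      rw [Metric.mem_closure_iff]
      intro e he
      obtain ⟨f, hf, -, h⟩ := hF φ hφ e he
      exact ⟨_, ⟨f, hf, rfl⟩, by rwa [dist_comm, dist_eq_norm]⟩
    have hcont : Continuous fun ψ : X →L[ℝ] ℝ => E (s • ψ) :=
      hEcont.comp (continuous_const_smul s)
    have hclosed : IsClosed {ψ : X →L[ℝ] ℝ | E (s • ψ) ∈ V.topologicalClosure} :=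
      V.isClosed_topologicalClosure.preimage hcont
    refine closure_minimal ?_ hclosed hcl
    rintro _ ⟨f, hf, rfl⟩
    refine ridge f hf (fun t => Real.exp (s * (‖f‖⁻¹ * t))) (by fun_prop) _ fun x => ?_
    simp [E]
  obtain ⟨φ₀, hφ₀⟩ : ∃ φ : X →L[ℝ] ℝ, ‖φ‖ = 1 := by
    obtain ⟨x, hx⟩ := hX
    obtain ⟨φ, h, -⟩ := exists_dual_vector ℝ x (by simpa using hx)
    exact ⟨φ, h⟩
  have hexp : ∀ φ : X →L[ℝ] ℝ, E φ ∈ V.topologicalClosure := by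
    intro φ
    by_cases h0 : φ = 0
    · have := hexp1 φ₀ hφ₀ 0
      rwa [zero_smul, ← h0] at this
    · have hn : ‖φ‖ ≠ 0 := norm_ne_zero_iff.2 h0
      have := hexp1 ((‖φ‖⁻¹ : ℝ) • φ) (by rw [norm_smul, norm_inv, norm_norm, inv_mul_cancel₀ hn]) ‖φ‖
      rwa [smul_smul, mul_inv_cancel₀ hn, one_smul] at this
  -- the algebra
  let S : Submonoid C(K, ℝ) :=
    { carrier := Set.range E
      one_mem' := ⟨0, by ext x; simp [E]⟩
      mul_mem' := by
        rintro _ _ ⟨a, rfl⟩ ⟨b, rfl⟩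
        exact ⟨a + b, by ext x; simp [E, Real.exp_add]⟩ }
  set A : Subalgebra ℝ C(K, ℝ) := Algebra.adjoin ℝ (S : Set C(K, ℝ)) with hA
  have hAV : ∀ w ∈ A, w ∈ V.topologicalClosure := by
    intro w hw
    rw [hA, ← Subalgebra.mem_toSubmodule, Algebra.adjoin_eq_span, Submonoid.closure_eq] at hw
    refine Submodule.span_le.2 ?_ hw
    rintro _ ⟨φ, rfl⟩
    exact hexp φ
  have hsep : A.SeparatesPoints := by
    intro x y hxy
    have hxy' : (x:X) - y ≠ 0 := fun h => hxy (Subtype.ext (sub_eq_zero.1 h))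
    obtain ⟨φ, -, h⟩ := exists_dual_vector ℝ ((x:X) - y) (by simpa using hxy')
    refine ⟨E φ, ⟨E φ, Algebra.subset_adjoin ⟨φ, rfl⟩, rfl⟩, fun he => ?_⟩
    have he' : φ x = φ y := Real.exp_injective he
    rw [map_sub, he', sub_self] at h
    exact hxy' (norm_eq_zero.1 (by simpa using h.symm))
  have htop := ContinuousMap.subalgebra_topologicalClosure_eq_top_of_separatesPoints A hsep
  let g' : C(K, ℝ) := ⟨fun x => g x, by fun_prop⟩
  have hgA : g' ∈ closure (A : Set C(K, ℝ)) := by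
    rw [← Subalgebra.topologicalClosure_coe, htop]; trivial
  have hgV : g' ∈ closure (V : Set C(K, ℝ)) := by
    rw [← Submodule.topologicalClosure_coe]
    exact closure_minimal hAV V.isClosed_topologicalClosure hgA
  obtain ⟨w, hw, hwd⟩ := Metric.mem_closure_iff.1 hgV ε hε
  obtain ⟨n, c, e, hsum⟩ := Submodule.mem_span_set'.1 hw
  have hch : ∀ i, ∃ f ∈ F, ∃ k j : ℤ, ∀ x : K, (e i : C(K, ℝ)) x = σ (k * f x + j) :=
    fun i => (e i).2
  choose f hf k j hkj using hch
  refine ⟨_, ⟨n, c, k, j, f, hf, rfl⟩, fun x hx => ?_⟩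
  have h1 := (ContinuousMap.dist_lt_iff hε).1 hwd ⟨x, hx⟩
  rw [dist_comm, Real.dist_eq, ← hsum] at h1
  simpa [hkj, g', ContinuousMap.sum_apply] using h1
end

section
/- Let G : ℝ → ℝ be a continuous nonconstant function. Then for every r ≥ 1, the set ΣΠ^r(G) of all functions ℝ^r → ℝ of the form x ↦ ∑_{j=1}^q β_j ∏_{k=1}^{l_j} G(A_{j,k}(x)), with q ∈ ℕ, l_j ∈ ℕ, β_j ∈ ℝ, and each A_{j,k} : ℝ^r → ℝ affine, is dense in C(ℝ^r) in the topology of uniform convergence on compact sets. -/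
/-- `ΣΠ^r(G)`: sums of products of `G` composed with affine functions. -/
def SigmaPiNet (r : ℕ) (G : ℝ → ℝ) : Set ((Fin r → ℝ) → ℝ) :=
  { F | ∃ (q : ℕ) (β : Fin q → ℝ) (l : Fin q → ℕ)
        (w : (j : Fin q) → Fin (l j) → Fin r → ℝ) (b : (j : Fin q) → Fin (l j) → ℝ),
      F = fun x => ∑ j, β j * ∏ k, G ((∑ i, w j k i * x i) + b j k) }

def unitCM (r : ℕ) (G : ℝ → ℝ) (hc : Continuous G) (p : (Fin r → ℝ) × ℝ) : C(Fin r → ℝ, ℝ) :=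
  ⟨fun x => G ((∑ i, p.1 i * x i) + p.2), by fun_prop⟩

lemma closure_list (r : ℕ) (G : ℝ → ℝ) (hc : Continuous G) (f : C(Fin r → ℝ, ℝ))
    (hf : f ∈ Submonoid.closure (Set.range (unitCM r G hc))) :
    ∃ L : List ((Fin r → ℝ) × ℝ),
      ∀ x, f x = (L.map fun p => G ((∑ i, p.1 i * x i) + p.2)).prod := by
  induction hf using Submonoid.closure_induction with
  | mem x hx =>
    obtain ⟨p, rfl⟩ := hx
    exact ⟨[p], fun x => by simp [unitCM]⟩
  | one => exact ⟨[], fun x => by simp⟩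
  | mul f g _ _ hf hg =>
    obtain ⟨L, hL⟩ := hf
    obtain ⟨M, hM⟩ := hg
    exact ⟨L ++ M, fun x => by simp [hL, hM]⟩

lemma adjoin_net (r : ℕ) (G : ℝ → ℝ) (hc : Continuous G) (f : C(Fin r → ℝ, ℝ))
    (hf : f ∈ Algebra.adjoin ℝ (Set.range (unitCM r G hc))) :
    (f : (Fin r → ℝ) → ℝ) ∈ SigmaPiNet r G := by
  rw [← Subalgebra.mem_toSubmodule, Algebra.adjoin_eq_span, Submodule.mem_span_set'] at hf
  obtain ⟨q, β, g, rfl⟩ := hf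
  choose L hL using fun j => closure_list r G hc (g j) (g j).2
  refine ⟨q, β, fun j => (L j).length, fun j k => ((L j).get k).1,
    fun j k => ((L j).get k).2, ?_⟩
  funext x
  simp only [ContinuousMap.coe_sum, Finset.sum_apply, ContinuousMap.coe_smul, Pi.smul_apply,
    smul_eq_mul]
  refine Finset.sum_congr rfl fun j _ => ?_
  rw [hL j x, ← Fin.prod_univ_fun_getElem]
  rfl

/-- for a continuous nonconstant `G` and every `r ≥ 1`, the set `ΣΠ^r(G)` is
dense in `C(ℝ^r)` in the topology of uniform convergence on compact sets. -/
theorem sigma_pi_dense (G : ℝ → ℝ) (hc : Continuous G) (hnc : ∃ s t : ℝ, G s ≠ G t)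
    (r : ℕ) (hr : 1 ≤ r) :
    DenseOnCompacts (SigmaPiNet r G) := by
  intro K hK _ g hg ε hε
  obtain ⟨s, t, hst⟩ := hnc
  have hsep : (Algebra.adjoin ℝ (Set.range (unitCM r G hc))).SeparatesPoints := by
    intro x y hxy
    obtain ⟨i, hi⟩ := Function.ne_iff.mp hxy
    have hi' : x i - y i ≠ 0 := sub_ne_zero.mpr hi
    set c : ℝ := (s - t) / (x i - y i) with hcdef
    refine ⟨_, ⟨unitCM r G hc (Pi.single i c, s - c * x i),
      Algebra.subset_adjoin ⟨_, rfl⟩, rfl⟩, ?_⟩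
    have e : c * (x i - y i) = s - t := div_mul_cancel₀ _ hi'
    have hx : c * x i + (s - c * x i) = s := by ring
    have hy : c * y i + (s - c * x i) = t := by linarith
    simpa [unitCM, Pi.single_apply, hx, hy] using hst
  obtain ⟨f, hf, h⟩ :=
    ContinuousMap.exists_mem_subalgebra_near_continuous_of_isCompact_of_separatesPoints
      hsep ⟨g, hg⟩ hK hε
  refine ⟨f, adjoin_net r G hc f hf, fun x hx => ?_⟩
  have := h x hx
  simpa [Real.norm_eq_abs, abs_sub_comm] using this
end

section
/- Let Ψ : ℝ → ℝ be a squashing function. Then for every continuous squashing function F : ℝ → ℝ and every ε > 0 there exists H ∈ Σ^1(Ψ) such that sup_{x ∈ ℝ} |F(x) − H(x)| < ε. -/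
/-- A squashing function: `[0,1]`-valued, monotone nondecreasing, with limits `1` at `+∞`
and `0` at `-∞`. -/
def Squashing (Ψ : ℝ → ℝ) : Prop :=
  (∀ t, Ψ t ∈ Set.Icc (0 : ℝ) 1) ∧ Monotone Ψ ∧
  Filter.Tendsto Ψ Filter.atTop (nhds 1) ∧ Filter.Tendsto Ψ Filter.atBot (nhds 0)

lemma squash_L (Ψ : ℝ → ℝ) (hΨ : Squashing Ψ) (δ : ℝ) (hδ : 0 < δ) :
    ∃ L : ℝ, 0 < L ∧ (∀ t, t ≤ -L → Ψ t ≤ δ) ∧ (∀ t, L ≤ t → 1 - δ ≤ Ψ t) := by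
  obtain ⟨_, _, h1, h0⟩ := hΨ
  obtain ⟨A, hA⟩ := Filter.eventually_atTop.1 (h1.eventually_const_lt (by linarith : 1 - δ < 1))
  obtain ⟨B, hB⟩ := Filter.eventually_atBot.1 (h0.eventually_lt_const hδ)
  refine ⟨|A| + |B| + 1, by positivity, fun t ht => (hB t ?_).le, fun t ht => (hA t ?_).le⟩
  · linarith [neg_abs_le B, abs_nonneg A]
  · linarith [le_abs_self A, abs_nonneg B]

lemma squash_step (Ψ : ℝ → ℝ) (hΨ : Squashing Ψ) (F : ℝ → ℝ) (hFc : Continuous F)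
    (hF : Squashing F) (δ : ℝ) (hδ : 0 < δ) (a b : ℝ) (hab : a < b) :
    ∃ w θ : ℝ, ∀ x, (F x < a → Ψ (w * x + θ) ≤ δ) ∧ (b < F x → 1 - δ ≤ Ψ (w * x + θ)) := by
  obtain ⟨L, hL, hlo, hhi⟩ := squash_L Ψ hΨ δ hδ
  obtain ⟨hr, hm, h1, h0⟩ := hF
  by_cases ha : a ≤ 0
  · refine ⟨0, L, fun x => ⟨fun h => ?_, fun _ => hhi _ (by simp)⟩⟩
    linarith [(hr x).1]
  by_cases hb : 1 ≤ b
  · refine ⟨0, -L, fun x => ⟨fun _ => hlo _ (by simp), fun h => ?_⟩⟩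
    linarith [(hr x).2]
  push Not at ha hb
  have ivt : ∀ c, 0 < c → c < 1 → ∃ p, F p = c := by
    intro c hc0 hc1
    obtain ⟨u, hu⟩ := (h0.eventually_lt_const hc0).exists
    obtain ⟨v, hv⟩ := (h1.eventually_const_lt hc1).exists
    exact mem_range_of_exists_le_of_exists_ge hFc ⟨u, hu.le⟩ ⟨v, hv.le⟩
  obtain ⟨p, hp⟩ := ivt a ha (by linarith)
  obtain ⟨q, hq⟩ := ivt b (by linarith) hb
  have hpq : p < q := hm.reflect_lt (by rw [hp, hq]; exact hab)
  have hd : 0 < q - p := by linarith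
  have hw : 0 < 2 * L / (q - p) := by positivity
  have hwe : 2 * L / (q - p) * (q - p) = 2 * L := by field_simp
  set w := 2 * L / (q - p)
  refine ⟨w, -L - w * p, fun x => ⟨fun h => hlo _ ?_, fun h => hhi _ ?_⟩⟩
  · have : x < p := hm.reflect_lt (by rw [hp]; exact h)
    nlinarith
  · have : q < x := hm.reflect_lt (by rw [hq]; exact h)
    nlinarith

lemma squash_sum (h : ℕ → ℝ) (y δ : ℝ) (hδ : 0 < δ) (hy : 0 ≤ y)
    (hh : ∀ k, 0 ≤ h k ∧ h k ≤ 1)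
    (h1 : ∀ k : ℕ, y < k → h k ≤ δ) (h2 : ∀ k : ℕ, (k : ℝ) + 1 < y → 1 - δ ≤ h k) (m : ℕ) :
    ∑ k ∈ Finset.range m, h k ≤ m ∧ ∑ k ∈ Finset.range m, h k ≤ y + 1 + m * δ ∧
    min (m : ℝ) (y - 1) - m * δ ≤ ∑ k ∈ Finset.range m, h k := by
  induction m with
  | zero => simp; linarith
  | succ m ih =>
    obtain ⟨i1, i2, i3⟩ := ih
    obtain ⟨k0, k1⟩ := hh m
    have hmd : 0 ≤ (m : ℝ) * δ := by positivity
    rw [Finset.sum_range_succ]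
    push_cast
    refine ⟨by linarith, ?_, ?_⟩
    · rcases lt_or_ge y m with c | c
      · linarith [h1 m c]
      · linarith
    · rcases lt_or_ge ((m : ℝ) + 1) y with c | c
      · have := h2 m c
        rw [min_eq_left (by linarith)] at i3
        linarith [min_le_left ((m : ℝ) + 1) (y - 1)]
      · rw [min_eq_right (by linarith)] at i3
        linarith [min_le_right ((m : ℝ) + 1) (y - 1)]

/-- for a squashing function `Ψ`, every continuous squashing function `F`
can be uniformly approximated on all of `ℝ` by elements of `Σ^1(Ψ)`. -/
theorem squashing_uniform_approx (Ψ : ℝ → ℝ) (hΨ : Squashing Ψ)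
    (F : ℝ → ℝ) (hFc : Continuous F) (hF : Squashing F)
    (ε : ℝ) (hε : 0 < ε) :
    ∃ H ∈ Sigma1 Ψ, ∀ x : ℝ, |F x - H x| < ε := by
  obtain ⟨N, hN⟩ := exists_nat_gt (2 / ε)
  have hN0 : (0 : ℝ) < N := lt_trans (by positivity) hN
  have hδ : (0 : ℝ) < 1 / N := by positivity
  have hNδ : (N : ℝ) * (1 / N) = 1 := by field_simp
  choose w θ hwθ using fun k : ℕ => squash_step Ψ hΨ F hFc hF (1 / N) hδ (k / N) ((k + 1) / N)
    (by gcongr; linarith)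
  refine ⟨_, ⟨N, fun _ => 1 / N, fun j => w j, fun j => θ j, rfl⟩, fun x => ?_⟩
  obtain ⟨f0, f1⟩ := hF.1 x
  obtain ⟨-, s2, s3⟩ := squash_sum (fun k => Ψ (w k * x + θ k)) (N * F x) (1 / N) hδ (by positivity)
    (fun k => hΨ.1 _)
    (fun k hk => (hwθ k x).1 (by rw [lt_div_iff₀ hN0]; linarith))
    (fun k hk => (hwθ k x).2 (by rw [div_lt_iff₀ hN0]; linarith)) N
  rw [hNδ] at s2 s3
  rw [min_eq_right (by nlinarith)] at s3
  simp only
  rw [← Finset.mul_sum, Fin.sum_univ_eq_sum_range (fun k => Ψ (w k * x + θ k)) N]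
  set S := ∑ k ∈ Finset.range N, Ψ (w k * x + θ k)
  have e : F x - 1 / N * S = (N * F x - S) / N := by field_simp
  rw [e, abs_div, abs_of_pos hN0, div_lt_iff₀ hN0]
  rw [div_lt_iff₀ hε] at hN
  have : |N * F x - S| ≤ 2 := abs_le.2 ⟨by linarith, by linarith⟩
  linarith
end

section
/- (Hornik 1989) Let Ψ : ℝ → ℝ be a squashing function. Then for every r ≥ 1, Σ^r(Ψ) is dense in C(ℝ^r) in the topology of uniform convergence on compact sets. -/
/-- The span of the elementary units. -/
def hornikSpan (r : ℕ) (Ψ : ℝ → ℝ) : Submodule ℝ ((Fin r → ℝ) → ℝ) :=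
  Submodule.span ℝ
    (Set.range fun p : (Fin r → ℝ) × ℝ => fun x : Fin r → ℝ => Ψ ((∑ i, p.1 i * x i) + p.2))

lemma hornikSpan_sub (r : ℕ) (Ψ : ℝ → ℝ) (f : (Fin r → ℝ) → ℝ) (hf : f ∈ hornikSpan r Ψ) :
    f ∈ SigmaNet r Ψ := by
  unfold hornikSpan at hf
  rw [Submodule.mem_span_set'] at hf
  obtain ⟨n, c, g, rfl⟩ := hf
  choose p hp using fun i => (g i).2
  refine ⟨n, c, fun j => (p j).2, fun j => (p j).1, ?_⟩
  funext x
  rw [Finset.sum_apply]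
  refine Finset.sum_congr rfl fun j _ => ?_
  rw [← hp j]
  rfl

/-- One-dimensional approximation of `exp`. -/
lemma hornik_exp_approx (Ψ : ℝ → ℝ) (hΨ : Squashing Ψ) (M ε : ℝ) (hε : 0 < ε) :
    ∃ (N : ℕ) (h A : ℝ) (s : ℕ → ℝ), ∀ t, t ≤ M →
      |(∑ k ∈ Finset.range N, h * Ψ (A * (t - s k))) - Real.exp t| < ε := by
  obtain ⟨h01, hmono, htop, hbot⟩ := hΨ
  obtain ⟨h, hh0, hh⟩ : ∃ h : ℝ, 0 < h ∧ 3 * h < ε := ⟨ε / 4, by positivity, by linarith⟩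
  obtain ⟨N, hN⟩ := exists_nat_gt (Real.exp M / h)
  have hNpos : (0:ℝ) < N := lt_trans (by positivity) hN
  set η : ℝ := 1 / N with hη
  have hη0 : 0 < η := by positivity
  have hNη : N * η = 1 := by rw [hη]; field_simp
  obtain ⟨B1, hB1⟩ := Filter.eventually_atTop.1 (htop.eventually (lt_mem_nhds (show 1 - η < 1 by linarith)))
  obtain ⟨B2, hB2⟩ := Filter.eventually_atBot.1 (hbot.eventually (gt_mem_nhds hη0))
  set δ : ℝ := 1 / (N + 1) with hδ
  have hδ0 : 0 < δ := by positivity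
  set A : ℝ := (|B1| + |B2|) / δ with hA
  have hA0 : 0 ≤ A := by positivity
  have hAδ : A * δ = |B1| + |B2| := by rw [hA]; field_simp
  have hlo : ∀ u, δ ≤ u → 1 - η ≤ Ψ (A * u) := fun u hu => by
    refine (hB1 _ ?_).le
    have := mul_le_mul_of_nonneg_left hu hA0
    linarith [le_abs_self B1, abs_nonneg B2]
  have hup : ∀ u, u ≤ -δ → Ψ (A * u) ≤ η := fun u hu => by
    refine (hB2 _ ?_).le
    have := mul_le_mul_of_nonneg_left hu hA0
    linarith [neg_abs_le B2, abs_nonneg B1]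
  refine ⟨N, h, A, fun k => Real.log ((k + 1) * h), fun t ht => ?_⟩
  -- gap in logarithms
  have hgap : ∀ a : ℝ, 0 < a → a ≤ N → Real.log (a * h) + δ ≤ Real.log ((a + 1) * h) := by
    intro a ha haN
    rw [Real.log_mul ha.ne' hh0.ne', Real.log_mul (by positivity) hh0.ne']
    have h1 := Real.one_sub_inv_le_log_of_pos (show 0 < (a + 1) / a by positivity)
    rw [Real.log_div (by positivity) ha.ne'] at h1
    have h2 : 1 - ((a + 1) / a)⁻¹ = 1 / (a + 1) := by field_simp; ring
    have h3 : δ ≤ 1 / (a + 1) := by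
      rw [hδ]; apply one_div_le_one_div_of_le <;> linarith
    linarith
  set y := Real.exp t with hy
  have hy0 : 0 < y := Real.exp_pos t
  have hyN : y / h < N := lt_of_le_of_lt
    (div_le_div_of_nonneg_right (Real.exp_le_exp.2 ht) hh0.le) hN
  have hty : t = Real.log y := by simp [hy]
  set j := ⌊y / h⌋₊ with hj
  have hj1 : (j : ℝ) ≤ y / h := Nat.floor_le (by positivity)
  have hj2 : y / h < j + 1 := Nat.lt_floor_add_one _
  have hj1' : j * h ≤ y := (le_div_iff₀ hh0).1 hj1
  have hj2' : y < (j + 1) * h := (div_lt_iff₀ hh0).1 hj2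
  have hjN : j < N := by exact_mod_cast lt_of_le_of_lt hj1 hyN
  have hT1 : ∀ k ∈ Finset.range N,
      (if k < j - 1 then (1:ℝ) else 0) - η ≤ Ψ (A * (t - Real.log ((k + 1) * h))) := by
    intro k hk
    split_ifs with hkj
    · apply hlo
      have hkN : ((k:ℝ) + 1) ≤ N := by
        have := Finset.mem_range.1 hk
        exact_mod_cast this
      have := hgap (k + 1) (by positivity) hkN
      have h2 : ((k:ℝ) + 1 + 1) * h ≤ y := by
        refine le_trans ?_ hj1'
        gcongr
        have : k + 1 + 1 ≤ j := by omega
        exact_mod_cast this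
      have := Real.log_le_log (by positivity) h2
      rw [hty]; linarith
    · linarith [(h01 (A * (t - Real.log ((k + 1) * h)))).1]
  have hT2 : ∀ k ∈ Finset.range N,
      Ψ (A * (t - Real.log ((k + 1) * h))) ≤ (if k < j + 1 then (1:ℝ) else 0) + η := by
    intro k hk
    split_ifs with hkj
    · linarith [(h01 (A * (t - Real.log ((k + 1) * h)))).2]
    · rw [zero_add]
      apply hup
      have hkN : (k:ℝ) ≤ N := by
        have := Finset.mem_range.1 hk
        exact_mod_cast this.le
      have hkj' : j + 1 ≤ k := by omega
      have hk0 : (0:ℝ) < k := by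
        have : 0 < k := by omega
        exact_mod_cast this
      have := hgap k hk0 hkN
      have h2 : y ≤ k * h := by
        refine le_trans hj2'.le ?_
        gcongr
        exact_mod_cast hkj'
      have := Real.log_le_log hy0 h2
      rw [hty]; linarith
  have hcard : ∀ m, m ≤ N → ∑ k ∈ Finset.range N, (if k < m then (1:ℝ) else 0) = m := by
    intro m hm
    rw [← Finset.sum_filter]
    have : (Finset.range N).filter (fun k => k < m) = Finset.range m := by
      ext k; simp; omega
    rw [this]; simp
  have hS1 := Finset.sum_le_sum hT1
  have hS2 := Finset.sum_le_sum hT2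
  rw [Finset.sum_sub_distrib, hcard _ (by omega)] at hS1
  rw [Finset.sum_add_distrib, hcard _ (by omega)] at hS2
  simp only [Finset.sum_const, Finset.card_range, nsmul_eq_mul, hNη] at hS1 hS2
  have hjj : (j:ℝ) - 1 ≤ ((j - 1 : ℕ) : ℝ) := by
    have : j ≤ (j - 1) + 1 := by omega
    have : (j:ℝ) ≤ ((j - 1 : ℕ) : ℝ) + 1 := by exact_mod_cast this
    linarith
  push_cast at hS2
  rw [← Finset.mul_sum]
  set S := ∑ k ∈ Finset.range N, Ψ (A * (t - Real.log ((k + 1) * h)))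
  rw [abs_lt]
  constructor <;> nlinarith

/-- The exponential functions on a set `K`, as a monoid homomorphism. -/
noncomputable def hornikExp (r : ℕ) (K : Set (Fin r → ℝ)) :
    Multiplicative (Fin r → ℝ) →* C(K, ℝ) where
  toFun w := ⟨fun x => Real.exp (∑ i, w.toAdd i * x.1 i),
    Real.continuous_exp.comp (continuous_finsetSum _ fun i _ =>
      continuous_const.mul ((continuous_apply i).comp continuous_subtype_val))⟩
  map_one' := by ext x; simp
  map_mul' v w := by
    ext x
    simp [add_mul, Finset.sum_add_distrib, Real.exp_add]

lemma hornik_exp_net (Ψ : ℝ → ℝ) (hΨ : Squashing Ψ) (r : ℕ) (K : Set (Fin r → ℝ))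
    (hK : IsCompact K) (w : Fin r → ℝ) (ε : ℝ) (hε : 0 < ε) :
    ∃ f ∈ hornikSpan r Ψ, ∀ x ∈ K, |f x - Real.exp (∑ i, w i * x i)| < ε := by
  obtain ⟨M, hM⟩ := (hK.image_of_continuousOn
    (f := fun x : Fin r → ℝ => ∑ i, w i * x i) (by fun_prop)).bddAbove
  obtain ⟨N, h, A, s, H⟩ := hornik_exp_approx Ψ hΨ M ε hε
  refine ⟨∑ k ∈ Finset.range N, h • fun x => Ψ ((∑ i, (A • w) i * x i) + -(A * s k)), ?_, ?_⟩
  · refine Submodule.sum_mem _ fun k _ => Submodule.smul_mem _ _ (Submodule.subset_span ?_)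
    exact ⟨(A • w, -(A * s k)), rfl⟩
  · intro x hx
    have := H (∑ i, w i * x i) (hM ⟨x, hx, rfl⟩)
    convert this using 3
    rw [Finset.sum_apply]
    refine Finset.sum_congr rfl fun k _ => ?_
    simp only [Pi.smul_apply, smul_eq_mul, mul_assoc, ← Finset.mul_sum]
    congr 2
    ring

/-- Hornik 1989: for a squashing function `Ψ` and every `r ≥ 1`, `Σ^r(Ψ)` is
dense in `C(ℝ^r)` in the topology of uniform convergence on compact sets. -/
theorem hornik_1989 (Ψ : ℝ → ℝ) (hΨ : Squashing Ψ) (r : ℕ) (hr : 1 ≤ r) :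
    DenseOnCompacts (SigmaNet r Ψ) := by
  intro K hK _ g hg ε hε
  haveI : CompactSpace K := isCompact_iff_compactSpace.1 hK
  let S : Submonoid C(K, ℝ) := MonoidHom.mrange (hornikExp r K)
  let Alg : Subalgebra ℝ C(K, ℝ) := Algebra.adjoin ℝ (S : Set C(K, ℝ))
  have hsep : Alg.SeparatesPoints := by
    intro x y hxy
    have hne : x.1 ≠ y.1 := fun h => hxy (Subtype.ext h)
    obtain ⟨i, hi⟩ := Function.ne_iff.1 hne
    refine ⟨_, ⟨hornikExp r K (Multiplicative.ofAdd (Pi.single i 1)),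
      Algebra.subset_adjoin ⟨_, rfl⟩, rfl⟩, ?_⟩
    simpa [hornikExp, Pi.single_apply] using hi
  obtain ⟨⟨p, hp⟩, hpg⟩ := ContinuousMap.exists_mem_subalgebra_near_continuous_of_separatesPoints
    Alg hsep (fun x : K => g x.1) (by fun_prop) (ε / 2) (by positivity)
  have key : ∀ ε : ℝ, 0 < ε → ∃ f ∈ hornikSpan r Ψ, ∀ x : K, |f x.1 - p x| < ε := by
    have hp' : p ∈ Submodule.span ℝ (S : Set C(K, ℝ)) := by
      have h1 : p ∈ Subalgebra.toSubmodule Alg := hp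
      rwa [Algebra.adjoin_eq_span, Submonoid.closure_eq] at h1
    clear hpg hp
    induction hp' using Submodule.span_induction with
    | mem p hp =>
      obtain ⟨w, rfl⟩ := hp
      intro ε hε
      obtain ⟨f, hf, hfx⟩ := hornik_exp_net Ψ hΨ r K hK w.toAdd ε hε
      exact ⟨f, hf, fun x => hfx x.1 x.2⟩
    | zero => exact fun ε hε => ⟨0, Submodule.zero_mem _, fun x => by simpa using hε⟩
    | add p q _ _ ihp ihq =>
      intro ε hε
      obtain ⟨f, hf, hfx⟩ := ihp (ε / 2) (by positivity)
      obtain ⟨f', hf', hfx'⟩ := ihq (ε / 2) (by positivity)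
      refine ⟨f + f', Submodule.add_mem _ hf hf', fun x => ?_⟩
      have h1 := abs_lt.1 (hfx x)
      have h2 := abs_lt.1 (hfx' x)
      simp only [Pi.add_apply, ContinuousMap.add_apply]
      rw [abs_lt]
      constructor <;> linarith
    | smul c p _ ih =>
      intro ε hε
      obtain ⟨f, hf, hfx⟩ := ih (ε / (|c| + 1)) (by positivity)
      refine ⟨c • f, Submodule.smul_mem _ _ hf, fun x => ?_⟩
      simp only [Pi.smul_apply, ContinuousMap.smul_apply, smul_eq_mul]
      rw [← mul_sub, abs_mul]
      have h1 := (lt_div_iff₀ (by positivity)).1 (hfx x)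
      nlinarith [abs_nonneg (f x.1 - p x)]
  obtain ⟨f, hf, hfx⟩ := key (ε / 2) (by positivity)
  refine ⟨f, hornikSpan_sub r Ψ f hf, fun x hx => ?_⟩
  have h1 := abs_lt.1 (hfx ⟨x, hx⟩)
  have h2 : |p ⟨x, hx⟩ - g x| < ε / 2 := hpg ⟨x, hx⟩
  have h2 := abs_lt.1 h2
  rw [abs_lt]
  constructor <;> linarith
end

section
/- Let Ψ : ℝ → ℝ be such that Σ^r(Ψ) is dense in C(ℝ^r) in the topology of uniform convergence on compact sets, and let μ be a finite Borel measure on ℝ^r for which there exists a compact set K ⊆ ℝ^r with μ(K) = μ(ℝ^r). Then for every p ∈ [1, ∞), Σ^r(Ψ) is dense in L^p(ℝ^r, μ): for every Borel-measurable g with ∫ |g|^p dμ < ∞ and every ε > 0 there exists f ∈ Σ^r(Ψ) with (∫_{ℝ^r} |f − g|^p dμ)^{1/p} < ε. -/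
open MeasureTheory

/-- if `Σ^r(Ψ)` is dense in `C(ℝ^r)` (uniform convergence on compacta) and `μ`
is a finite Borel measure on `ℝ^r` whose total mass is carried by some compact set, then for
every `p ∈ [1, ∞)`, `Σ^r(Ψ)` is dense in `L^p(ℝ^r, μ)`: for every Borel-measurable `g` with
`∫ |g|^p dμ < ∞` and every `ε > 0` there is `f ∈ Σ^r(Ψ)` with `(∫ |f - g|^p dμ)^{1/p} < ε`,
i.e. `∫ |f - g|^p dμ < ε^p`. -/
theorem sigma_dense_Lp (r : ℕ) (Ψ : ℝ → ℝ)
    (hdense : DenseOnCompacts (SigmaNet r Ψ))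
    (μ : Measure (Fin r → ℝ)) [IsFiniteMeasure μ]
    (hK : ∃ K : Set (Fin r → ℝ), IsCompact K ∧ μ K = μ Set.univ)
    (p : ℝ) (hp : 1 ≤ p)
    (g : (Fin r → ℝ) → ℝ) (hg : Measurable g)
    (hgp : ∫⁻ x, ENNReal.ofReal (|g x| ^ p) ∂μ < ⊤)
    (ε : ℝ) (hε : 0 < ε) :
    ∃ f ∈ SigmaNet r Ψ,
      ∫⁻ x, ENNReal.ofReal (|f x - g x| ^ p) ∂μ < ENNReal.ofReal (ε ^ p) := by
  obtain ⟨K, hKc, hKμ⟩ := hK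
  have hp0 : 0 < p := by linarith
  have hP0 : ENNReal.ofReal p ≠ 0 := by simpa using hp0
  have hPt : ENNReal.ofReal p ≠ ⊤ := ENNReal.ofReal_ne_top
  have hPr : (ENNReal.ofReal p).toReal = p := ENNReal.toReal_ofReal hp0.le
  have hP1 : 1 ≤ ENNReal.ofReal p := by simpa using hp
  have key : ∀ u : (Fin r → ℝ) → ℝ, ∫⁻ x, ENNReal.ofReal (|u x| ^ p) ∂μ
      = ∫⁻ x, ‖u x‖ₑ ^ p ∂μ := by
    intro u
    refine lintegral_congr fun x => ?_
    rw [← ENNReal.ofReal_rpow_of_nonneg (abs_nonneg _) hp0.le, ← Real.norm_eq_abs,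
      ofReal_norm_eq_enorm]
  have hae : ∀ᵐ x ∂μ, x ∈ K := by
    rw [ae_iff]
    change μ Kᶜ = 0
    rw [measure_compl hKc.measurableSet (measure_ne_top _ _), hKμ, tsub_self]
  have hgm : MemLp g (ENNReal.ofReal p) μ := by
    refine ⟨hg.aestronglyMeasurable, ?_⟩
    rw [eLpNorm_lt_top_iff_lintegral_rpow_enorm_lt_top hP0 hPt, hPr, ← key]
    exact hgp
  have hε4 : ENNReal.ofReal (ε / 4) ≠ 0 := by simpa using hε
  obtain ⟨h, hh, hhm⟩ := hgm.exists_boundedContinuous_eLpNorm_sub_le hPt hε4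
  set M : ℝ := (μ Set.univ).toReal ^ (1 / p) with hM
  have hM0 : 0 ≤ M := by positivity
  set δ : ℝ := ε / (4 * (M + 1)) with hδ
  have hδ0 : 0 < δ := by positivity
  have hδM : δ * M ≤ ε / 4 := by
    rw [hδ, div_mul_eq_mul_div, div_le_div_iff₀ (by positivity) (by positivity)]
    nlinarith
  obtain ⟨f, hf, hfK⟩ := hdense (insert 0 K) (hKc.insert 0) (Set.insert_nonempty _ _) h
    h.continuous δ hδ0
  refine ⟨f, hf, ?_⟩
  let D : (Fin r → ℝ) → ℝ := fun _ => δ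
  let G : (Fin r → ℝ) → ℝ := fun x => ‖(g - (h : (Fin r → ℝ) → ℝ)) x‖
  have hD : eLpNorm D (ENNReal.ofReal p) μ ≤ ENNReal.ofReal (ε / 4) := by
    rw [eLpNorm_const' δ hP0 hPt, hPr, ← ofReal_norm_eq_enorm, Real.norm_of_nonneg hδ0.le,
      ← ENNReal.ofReal_toReal (measure_ne_top μ Set.univ),
      ENNReal.ofReal_rpow_of_nonneg ENNReal.toReal_nonneg (by positivity),
      ← ENNReal.ofReal_mul hδ0.le]
    exact ENNReal.ofReal_le_ofReal hδM
  have hG : eLpNorm G (ENNReal.ofReal p) μ ≤ ENNReal.ofReal (ε / 4) := by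
    rw [eLpNorm_norm]; exact hh
  have hF : eLpNorm (D + G) (ENNReal.ofReal p) μ < ENNReal.ofReal ε := by
    calc _ ≤ eLpNorm D (ENNReal.ofReal p) μ + eLpNorm G (ENNReal.ofReal p) μ :=
          eLpNorm_add_le aestronglyMeasurable_const
            (hgm.aestronglyMeasurable.sub hhm.aestronglyMeasurable).norm hP1
      _ ≤ ENNReal.ofReal (ε / 4) + ENNReal.ofReal (ε / 4) := add_le_add hD hG
      _ = ENNReal.ofReal (ε / 2) := by
          rw [← ENNReal.ofReal_add (by positivity) (by positivity)]; congr 1; ring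
      _ < ENNReal.ofReal ε := by
          rw [ENNReal.ofReal_lt_ofReal_iff hε]; linarith
  calc ∫⁻ x, ENNReal.ofReal (|f x - g x| ^ p) ∂μ
      ≤ ∫⁻ x, ENNReal.ofReal (|(D + G) x| ^ p) ∂μ := by
        refine lintegral_mono_ae ?_
        filter_upwards [hae] with x hx
        refine ENNReal.ofReal_le_ofReal (Real.rpow_le_rpow (abs_nonneg _) ?_ hp0.le)
        have h1 := (hfK x (Set.mem_insert_of_mem _ hx)).le
        have h2 : |f x - g x| ≤ |f x - h x| + |g x - h x| := by
          rw [abs_sub_comm (g x)]; exact abs_sub_le _ _ _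
        refine le_trans ?_ (le_abs_self _)
        change _ ≤ δ + |g x - h x|
        linarith
    _ = eLpNorm (D + G) (ENNReal.ofReal p) μ ^ p := by
        rw [key, eLpNorm_eq_lintegral_rpow_enorm_toReal hP0 hPt, hPr, ← ENNReal.rpow_mul,
          one_div_mul_cancel hp0.ne', ENNReal.rpow_one]
    _ < ENNReal.ofReal ε ^ p := ENNReal.rpow_lt_rpow hF hp0
    _ = ENNReal.ofReal (ε ^ p) := ENNReal.ofReal_rpow_of_nonneg hε.le hp0.le
end

section
/- Let Ψ : ℝ → ℝ be a squashing function for which there exist z₀, z₁ ∈ ℝ with Ψ(z₀) = 0 and Ψ(z₁) = 1. Then for any pairwise distinct points x₁, …, x_n ∈ ℝ^r and any function g : ℝ^r → ℝ, there exists f ∈ Σ^r(Ψ) with f(x_j) = g(x_j) for all j = 1, …, n. -/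
theorem separating_direction_aux (r n : ℕ) (x : Fin n → Fin r → ℝ)
    (hx : Function.Injective x) :
    ∃ p : Fin r → ℝ, Function.Injective fun j => ∑ i, p i * x j i := by
  obtain ⟨φ, hφ⟩ := Module.exists_dual_forall_apply_ne_zero (K := ℝ)
    (fun k : {k : Fin n × Fin n // k.1 ≠ k.2} => x k.1.1 - x k.1.2)
    (fun k => sub_ne_zero.mpr (fun h => k.2 (hx h)))
  have key : ∀ v : Fin r → ℝ, φ v = ∑ i, φ (Pi.single i 1) * v i := by
    intro v
    rw [LinearMap.pi_apply_eq_sum_univ φ v]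
    refine Finset.sum_congr rfl fun i _ => ?_
    rw [smul_eq_mul, mul_comm]
    congr 2
    ext j
    simp [Pi.single_apply, eq_comm]
  refine ⟨fun i => φ (Pi.single i 1), fun a b hab => ?_⟩
  by_contra hne
  apply hφ ⟨(a, b), hne⟩
  simp only [← key] at hab
  simp [hab]

/-- Finite sums indexed by any finite type are networks. -/
theorem sigmaNet_of_fintype_aux (r : ℕ) (Ψ : ℝ → ℝ) {ι : Type} [Fintype ι]
    (β θ : ι → ℝ) (w : ι → Fin r → ℝ) :
    (fun x => ∑ j, β j * Ψ ((∑ i, w j i * x i) + θ j)) ∈ SigmaNet r Ψ := by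
  let e := (Fintype.equivFin ι).symm
  refine ⟨Fintype.card ι, β ∘ e, θ ∘ e, w ∘ e, ?_⟩
  funext x
  exact (Equiv.sum_comp e (fun j => β j * Ψ ((∑ i, w j i * x i) + θ j))).symm

/-- a squashing function `Ψ` attaining the values `0` and `1` allows exact
interpolation: for pairwise distinct points `x₁, …, x_n ∈ ℝ^r` and any `g : ℝ^r → ℝ`, some
`f ∈ Σ^r(Ψ)` satisfies `f(x_j) = g(x_j)` for all `j`. -/
theorem squashing_interpolation (r : ℕ) (Ψ : ℝ → ℝ) (hΨ : Squashing Ψ)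
    (z₀ z₁ : ℝ) (h0 : Ψ z₀ = 0) (h1 : Ψ z₁ = 1)
    (n : ℕ) (x : Fin n → Fin r → ℝ) (hx : Function.Injective x)
    (g : (Fin r → ℝ) → ℝ) :
    ∃ f ∈ SigmaNet r Ψ, ∀ j, f (x j) = g (x j) := by
  obtain ⟨hI, hmono, -, -⟩ := hΨ
  have lo : ∀ t, t ≤ z₀ → Ψ t = 0 := fun t ht => le_antisymm (h0 ▸ hmono ht) (hI t).1
  have hi : ∀ t, z₁ ≤ t → Ψ t = 1 := fun t ht => le_antisymm (hI t).2 (h1 ▸ hmono ht)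
  obtain ⟨p, hp⟩ := separating_direction_aux r n x hx
  set y : Fin n → ℝ := fun j => ∑ i, p i * x j i with hy
  obtain ⟨M, hM⟩ := Finite.exists_le (fun k : Fin n × Fin n => |z₁ - z₀| / |y k.1 - y k.2|)
  set a : ℝ := max M 0 with ha
  have ha0 : 0 ≤ a := le_max_right _ _
  have gap : ∀ j k, y j < y k → z₁ - z₀ ≤ a * (y k - y j) := by
    intro j k hjk
    have hpos : 0 < y k - y j := sub_pos.mpr hjk
    have h := (hM (k, j)).trans (le_max_left M 0)
    simp only [abs_of_pos hpos] at h
    rw [div_le_iff₀ hpos] at h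
    exact (le_abs_self _).trans h
  refine ⟨_, sigmaNet_of_fintype_aux r Ψ (ι := Fin n × Bool)
    (fun k => if k.2 then g (x k.1) else -g (x k.1))
    (fun k => (if k.2 then z₁ else z₀) - a * y k.1) (fun _ i => a * p i), fun j => ?_⟩
  have hs : ∑ i, a * p i * x j i = a * y j := by
    rw [hy, Finset.mul_sum]
    exact Finset.sum_congr rfl fun i _ => mul_assoc _ _ _
  simp only [hs, Fintype.sum_prod_type, Fintype.sum_bool, if_true, Bool.false_eq_true, if_false]
  rw [Finset.sum_eq_single j]
  · rw [hi _ (by linarith), lo _ (by linarith)]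
    ring
  · intro k _ hk
    rcases lt_or_gt_of_ne (fun h => hk (hp h) : y k ≠ y j) with h | h
    · have := gap k j h
      rw [hi _ (by nlinarith [mul_nonneg ha0 (sub_pos.mpr h).le]), hi _ (by linarith)]
      ring
    · have := gap j k h
      rw [lo _ (by linarith), lo _ (by nlinarith [mul_nonneg ha0 (sub_pos.mpr h).le])]
      ring
  · simp
end

section
/- (Pinkus) Let Ψ : ℝ → ℝ be continuous and not equal to a polynomial on some open interval. Then for any α₁, …, α_k ∈ ℝ and any pairwise distinct points x₁, …, x_k ∈ ℝ^r, there exist w₁, …, w_k ∈ ℝ^r and c₁, …, c_k, b₁, …, b_k ∈ ℝ such that ∑_{j=1}^k c_j Ψ(w_j·x_i + b_j) = α_i for every i = 1, …, k. -/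
open fwdDiff in
lemma pk_newton (f : ℝ → ℝ) (n : ℕ) (h a : ℝ) (hd : ∀ y, (fwdDiff h)^[n] f y = 0) :
    ∃ Q : Polynomial ℝ, ∀ m : ℕ, f (a + m * h) = Q.eval (m : ℝ) := by
  have hd' : ∀ k, n ≤ k → (fwdDiff h)^[k] f a = 0 := by
    intro k hk
    obtain ⟨j, rfl⟩ := Nat.exists_eq_add_of_le hk
    have h0 : (fwdDiff h)^[n] f = fun _ => 0 := funext hd
    rw [add_comm, Function.iterate_add_apply, h0]
    clear hk hd h0
    have : ∀ j : ℕ, (fwdDiff h)^[j] (fun _ : ℝ => (0 : ℝ)) = fun _ => 0 := by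
      intro j
      induction j with
      | zero => rfl
      | succ j ih => rw [Function.iterate_succ_apply, fwdDiff_const, ih]
    rw [this]
  refine ⟨∑ k ∈ Finset.range n,
    Polynomial.C ((fwdDiff h)^[k] f a / (k.factorial : ℝ)) * descPochhammer ℝ k, fun m => ?_⟩
  have h1 := shift_eq_sum_fwdDiff_iter h f m a
  rw [nsmul_eq_mul] at h1
  rw [h1, Polynomial.eval_finsetSum]
  have e1 : ∀ k : ℕ, (Polynomial.C ((fwdDiff h)^[k] f a / (k.factorial : ℝ)) *
      descPochhammer ℝ k).eval (m : ℝ) = m.choose k • (fwdDiff h)^[k] f a := by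
    intro k
    rw [Polynomial.eval_mul, Polynomial.eval_C, descPochhammer_eval_eq_descFactorial,
      Nat.descFactorial_eq_factorial_mul_choose, nsmul_eq_mul]
    have : (k.factorial : ℝ) ≠ 0 := by positivity
    push_cast
    field_simp
  simp only [e1]
  rw [Finset.sum_subset (s₁ := Finset.range (m+1)) (s₂ := Finset.range (m + 1 + n)),
    Finset.sum_subset (s₁ := Finset.range n) (s₂ := Finset.range (m + 1 + n))]
  · intro k hk; simp at hk ⊢; omega
  · intro k _ hk
    rw [hd' k (by simpa using hk), smul_zero]
  · intro k hk; simp at hk ⊢; omega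
  · intro k _ hk
    rw [Nat.choose_eq_zero_of_lt (by simp at hk; omega), zero_smul]

lemma pk_poly (f : ℝ → ℝ) (hc : Continuous f) (n : ℕ)
    (hd : ∀ h y, (fwdDiff h)^[n] f y = 0) (a : ℝ) :
    ∃ P : Polynomial ℝ, ∀ x, a ≤ x → f x = P.eval x := by
  obtain ⟨Q, hQ⟩ := pk_newton f n 1 a (hd 1)
  have key : ∀ m N : ℕ, 0 < N → f (a + m / N) = Q.eval ((m : ℝ) / N) := by
    intro m N hN
    have hN' : (N : ℝ) ≠ 0 := by positivity
    obtain ⟨R, hR⟩ := pk_newton f n (1 / N) a (hd _)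
    have hRQ : R.comp (Polynomial.C (N : ℝ) * Polynomial.X) = Q := by
      apply Polynomial.eq_of_infinite_eval_eq
      refine (Set.infinite_range_of_injective (Nat.cast_injective (R := ℝ))).mono ?_
      rintro _ ⟨j, rfl⟩
      have h1 := hR (N * j)
      have h2 := hQ j
      simp only [Set.mem_ofPred_eq, Polynomial.eval_comp, Polynomial.eval_mul,
        Polynomial.eval_C, Polynomial.eval_X]
      rw [← h2]
      push_cast at h1
      rw [← h1]
      congr 1
      field_simp
    rw [← hRQ]
    simp only [Polynomial.eval_comp, Polynomial.eval_mul,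
        Polynomial.eval_C, Polynomial.eval_X]
    rw [mul_div_cancel₀ _ hN', ← hR m]
    congr 1
    ring
  have hE : (fun t : ℝ => f (a + |t|)) = fun t => Q.eval |t| := by
    refine Continuous.ext_on (Rat.denseRange_cast (𝕜 := ℝ)) (by fun_prop) (by fun_prop) ?_
    rintro _ ⟨q, rfl⟩
    have : |(q : ℝ)| = (q.num.natAbs : ℝ) / q.den := by
      rw [Nat.cast_natAbs, Int.cast_abs]
      conv_lhs => rw [Rat.cast_def]
      rw [abs_div, Nat.abs_cast]
    simp only [this]
    exact key _ _ q.den_pos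
  refine ⟨Q.comp (Polynomial.X - Polynomial.C a), fun x hx => ?_⟩
  have := congrFun hE (x - a)
  simp only [abs_of_nonneg (sub_nonneg.2 hx)] at this
  simpa using this

lemma pk_elim {ι : Type*} [DecidableEq ι] (t : ι → ℝ) (t0 h : ℝ) (S : Finset ι) :
    ∀ (f : ℝ → ℝ) (g : ι → ℝ → ℝ), (∀ j ∈ S, t0 ≠ t j) →
      (∀ s b, f (s * t0 + b) + ∑ j ∈ S, g j (s * t j + b) = 0) →
      ∀ y, (fwdDiff h)^[S.card] f y = 0 := by
  induction S using Finset.induction_on with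
  | empty =>
    intro f g _ H y
    simpa using H 0 y
  | insert j S hj ih =>
    intro f g ht H y
    rw [Finset.card_insert_of_notMem hj, Function.iterate_succ_apply]
    have hne : t0 - t j ≠ 0 := sub_ne_zero.2 (ht j (by simp))
    refine ih (fwdDiff h f)
      (fun l y => g l (y + h / (t0 - t j) * (t l - t j)) - g l y)
      (fun l hl => ht l (by simp [hl])) ?_ y
    intro s b
    have h1 := H s b
    have h2 := H (s + h / (t0 - t j)) (b - h / (t0 - t j) * t j)
    rw [Finset.sum_insert hj] at h1 h2
    have e0 : (s + h / (t0 - t j)) * t0 + (b - h / (t0 - t j) * t j) = s * t0 + b + h := by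
      field_simp; ring
    have e1 : (s + h / (t0 - t j)) * t j + (b - h / (t0 - t j) * t j) = s * t j + b := by
      ring
    have e2 : ∀ l, (s + h / (t0 - t j)) * t l + (b - h / (t0 - t j) * t j)
        = s * t l + b + h / (t0 - t j) * (t l - t j) := by
      intro l; ring
    rw [e0, e1] at h2
    simp only [e2] at h2
    simp only [fwdDiff, Finset.sum_sub_distrib]
    linarith

lemma pk_dir (r k : ℕ) (x : Fin k → Fin r → ℝ) (hx : Function.Injective x) (i : Fin k) :
    ∃ u : Fin r → ℝ, ∀ j, j ≠ i → ∑ l, u l * x i l ≠ ∑ l, u l * x j l := by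
  let p : Fin k → Polynomial ℝ := fun j =>
    ∑ l : Fin r, Polynomial.C (x i l - x j l) * Polynomial.X ^ (l : ℕ)
  have hp : ∀ j, j ≠ i → p j ≠ 0 := by
    intro j hj h0
    apply hj
    apply hx
    funext l
    have h1 : (p j).coeff l = 0 := by rw [h0]; simp
    simp only [p, Polynomial.finsetSum_coeff, Polynomial.coeff_C_mul, Polynomial.coeff_X_pow,
      Fin.val_inj] at h1
    simp at h1
    linarith
  have hprod : (∏ j ∈ Finset.univ.erase i, p j) ≠ 0 :=
    Finset.prod_ne_zero_iff.2 fun j hj => hp j (Finset.ne_of_mem_erase hj)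
  obtain ⟨θ, hθ⟩ : ∃ θ : ℝ, (∏ j ∈ Finset.univ.erase i, p j).eval θ ≠ 0 := by
    by_contra! h
    exact hprod (Polynomial.funext (by simpa using h))
  refine ⟨fun l => θ ^ (l : ℕ), fun j hj h => ?_⟩
  rw [Polynomial.eval_prod, Finset.prod_ne_zero_iff] at hθ
  apply hθ j (by simp [hj])
  simp only [p, Polynomial.eval_finsetSum, Polynomial.eval_mul, Polynomial.eval_C,
    Polynomial.eval_pow, Polynomial.eval_X, sub_mul, Finset.sum_sub_distrib]
  simp only [mul_comm (θ ^ _)] at h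
  linarith

/-- Pinkus: if `Ψ` is continuous and coincides with no polynomial on some
open interval, then for any values `α₁, …, α_k` and pairwise distinct points
`x₁, …, x_k ∈ ℝ^r` there exist weights `w_j ∈ ℝ^r` and scalars `c_j, b_j` with
`∑_j c_j Ψ(w_j·x_i + b_j) = α_i` for every `i`. -/
theorem pinkus_interpolation (r : ℕ) (Ψ : ℝ → ℝ) (hc : Continuous Ψ)
    (hpoly : ∃ a b : ℝ, a < b ∧
      ¬ ∃ P : Polynomial ℝ, ∀ x ∈ Set.Ioo a b, Ψ x = Polynomial.eval x P)
    (k : ℕ) (α : Fin k → ℝ) (x : Fin k → Fin r → ℝ) (hx : Function.Injective x) :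
    ∃ (w : Fin k → Fin r → ℝ) (c b : Fin k → ℝ),
      ∀ i, ∑ j, c j * Ψ ((∑ l, w j l * x i l) + b j) = α i := by
  let v : (Fin r → ℝ) × ℝ → (Fin k → ℝ) := fun q i => Ψ ((∑ l, q.1 l * x i l) + q.2)
  have hspan : ⊤ ≤ Submodule.span ℝ (Set.range v) := by
    by_contra hlt
    obtain ⟨φ, hφ0, hφ⟩ := Submodule.exists_le_ker_of_lt_top _
      (lt_top_iff_ne_top.2 fun h => hlt h.ge)
    let β : Fin k → ℝ := fun i => φ fun j => if i = j then 1 else 0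
    have hβ : ∀ z, φ z = ∑ i, z i * β i := fun z => by
      rw [LinearMap.pi_apply_eq_sum_univ]; rfl
    obtain ⟨i, hi⟩ : ∃ i, β i ≠ 0 := by
      by_contra! h
      apply hφ0
      refine LinearMap.ext fun z => ?_
      simp [h, hβ]
    obtain ⟨u, hu⟩ := pk_dir r k x hx i
    obtain ⟨a, b, -, hP⟩ := hpoly
    apply hP
    have hd : ∀ h y, (fwdDiff h)^[(Finset.univ.erase i).card] Ψ y = 0 := by
      intro h y
      refine pk_elim (fun j => ∑ l, u l * x j l) (∑ l, u l * x i l) h (Finset.univ.erase i) Ψ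
        (fun j y => (β i)⁻¹ * (Ψ y * β j)) (fun j hj => hu j (Finset.ne_of_mem_erase hj)) ?_ y
      intro s b
      have h1 : φ (v (fun l => s * u l, b)) = 0 := hφ (Submodule.subset_span ⟨_, rfl⟩)
      rw [hβ, ← Finset.add_sum_erase _ _ (Finset.mem_univ i)] at h1
      simp only [v, mul_assoc s, ← Finset.mul_sum] at h1
      rw [← Finset.mul_sum]
      have h2 : (β i)⁻¹ * β i = 1 := inv_mul_cancel₀ hi
      linear_combination (β i)⁻¹ * h1 - Ψ (s * ∑ l, u l * x i l + b) * h2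
    obtain ⟨P, hP⟩ := pk_poly Ψ hc _ hd a
    exact ⟨P, fun y hy => hP y hy.1.le⟩
  let B := Module.Basis.ofSpan hspan
  have : Fintype _ := Module.Basis.fintypeIndexOfRankLtAleph0 B (Module.rank_lt_aleph0 ℝ _)
  let e := Fintype.equivFinOfCardEq
    ((Module.finrank_eq_card_basis B).symm.trans (Module.finrank_fin_fun ℝ))
  let B' := B.reindex e
  have hB : ∀ j, ∃ q, v q = B' j := fun j =>
    Module.Basis.ofSpan_subset hspan ⟨e.symm j, by simp [B', B]⟩
  choose q hq using hB
  refine ⟨fun j => (q j).1, fun j => B'.repr α j, fun j => (q j).2, fun i => ?_⟩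
  have h1 := congrFun (B'.sum_repr α) i
  rw [Finset.sum_apply] at h1
  rw [← h1]
  refine Finset.sum_congr rfl fun j _ => ?_
  rw [← hq j]
  rfl
end

section
/- (Park–Sandberg) Let K : ℝ^r → ℝ be a bounded function that is Lebesgue integrable on ℝ^r with ∫_{ℝ^r} K dx ≠ 0, and whose set of discontinuity points has Lebesgue measure zero. Then for every p ∈ [1, ∞), the set S_K of radial-basis-function networks, i.e. of functions x ↦ ∑_{i=1}^M w_i K((x − z_i)/σ) with M ∈ ℕ, w_i ∈ ℝ, z_i ∈ ℝ^r, σ > 0, is dense in L^p(ℝ^r) with respect to Lebesgue measure: for every f ∈ L^p(ℝ^r) and every ε > 0 there exists q ∈ S_K with (∫_{ℝ^r} |f − q|^p dx)^{1/p} < ε. -/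
open MeasureTheory
open scoped ENNReal Topology

namespace PS

lemma memLp_bdd_int {α : Type*} [MeasurableSpace α] {μ : Measure α} {K : α → ℝ}
    (hint : Integrable K μ) {C : ℝ} (hC : ∀ x, |K x| ≤ C) (p : ℝ) (hp : 1 ≤ p) :
    MemLp K (ENNReal.ofReal p) μ := by
  have hp0 : 0 < p := by linarith
  rw [← integrable_norm_rpow_iff hint.aestronglyMeasurable (by simpa using hp0) ENNReal.ofReal_ne_top,
    ENNReal.toReal_ofReal hp0.le]
  refine (hint.norm.mul_const (C ^ (p - 1))).mono' ?_ ?_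
  · exact (hint.aestronglyMeasurable.norm.aemeasurable.pow_const p).aestronglyMeasurable
  · refine Filter.Eventually.of_forall fun x => ?_
    rw [Real.norm_of_nonneg (by positivity)]
    have h1 : ‖K x‖ ^ p = ‖K x‖ * ‖K x‖ ^ (p - 1) := by
      have := Real.rpow_add_of_nonneg (norm_nonneg (K x)) zero_le_one (sub_nonneg.2 hp)
      rw [Real.rpow_one] at this
      rw [← this]; ring_nf
    rw [h1]
    exact mul_le_mul_of_nonneg_left
      (Real.rpow_le_rpow (norm_nonneg _) (hC x) (by linarith)) (norm_nonneg _)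

variable {r : ℕ} {P : ℝ≥0∞}

noncomputable def T (z : Fin r → ℝ) (h : Lp ℝ P (volume : Measure (Fin r → ℝ))) :
    Lp ℝ P (volume : Measure (Fin r → ℝ)) := DomAddAct.mk (-z) +ᵥ h

lemma T_norm (z : Fin r → ℝ) (h : Lp ℝ P (volume : Measure (Fin r → ℝ))) : ‖T z h‖ = ‖h‖ :=
  DomAddAct.norm_vadd_Lp _ _

lemma T_zero (h : Lp ℝ P (volume : Measure (Fin r → ℝ))) : T 0 h = h := by
  simp [T]

lemma T_cont [Fact (1 ≤ P)] [Fact (P ≠ ∞)] (h : Lp ℝ P (volume : Measure (Fin r → ℝ))) :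
    Continuous fun z => T z h := by
  have : Continuous fun z : Fin r → ℝ => DomAddAct.mk (-z) :=
    DomAddAct.continuous_mk.comp continuous_neg
  exact this.vadd continuous_const

lemma T_ae (z : Fin r → ℝ) {f : (Fin r → ℝ) → ℝ} (hf : MemLp f P volume) :
    T z (hf.toLp f) =ᵐ[volume] fun x => f (x - z) := by
  unfold T
  rw [DomAddAct.mk_vadd_toLp]
  refine (MemLp.coeFn_toLp _).trans (Filter.Eventually.of_forall fun x => ?_)
  simp [sub_eq_add_neg, add_comm]

/-- set integral as a functional -/
lemma exists_clm [Fact (1 ≤ P)] {s : Set (Fin r → ℝ)} (hs : MeasurableSet s)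
    (hμ : volume s ≠ ∞) :
    ∃ L : Lp ℝ P (volume : Measure (Fin r → ℝ)) →L[ℝ] ℝ,
      ∀ h : Lp ℝ P volume, L h = ∫ x in s, h x := by
  obtain ⟨Q, hQ⟩ : ∃ Q : ℝ≥0∞, ENNReal.HolderConjugate P Q :=
    ⟨_, ENNReal.HolderConjugate.conjExponent Fact.out⟩
  have : Fact (1 ≤ Q) := ⟨ENNReal.HolderConjugate.symm.one_le (p := Q) (q := P)⟩
  refine ⟨((ContinuousLinearMap.mul ℝ ℝ).lpPairing volume P Q).flip
    (indicatorConstLp Q hs hμ 1), fun h => ?_⟩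
  rw [ContinuousLinearMap.flip_apply, ContinuousLinearMap.lpPairing_eq_integral,
    ← integral_indicator hs]
  refine integral_congr_ae ?_
  filter_upwards [indicatorConstLp_coeFn (p := Q) (hs := hs) (hμs := hμ) (c := (1 : ℝ))] with x hx
  rw [hx]
  by_cases h : x ∈ s <;> simp [h]

lemma clm_T {s : Set (Fin r → ℝ)} {f : (Fin r → ℝ) → ℝ} (hf : MemLp f P volume)
    (hs : MeasurableSet s) (z : Fin r → ℝ) :
    ∫ x in s, T z (hf.toLp f) x = ∫ y, f y * s.indicator 1 (y + z) := by
  rw [← integral_indicator hs, ← integral_add_right_eq_self _ z]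
  have h1 := T_ae z hf
  have h2 := (measurePreserving_add_right (volume : Measure (Fin r → ℝ)) z).quasiMeasurePreserving.ae h1
  refine integral_congr_ae ?_
  filter_upwards [h2] with y hy
  by_cases h : y + z ∈ s <;> simp [h, hy]

lemma key [Fact (1 ≤ P)] [hPt : Fact (P ≠ ∞)] {K g : (Fin r → ℝ) → ℝ} (hint : Integrable K volume)
    (hg : Continuous g) (hgs : HasCompactSupport g) (hgP : MemLp g P volume)
    {σ : ℝ} (hσ : 0 < σ) (hKP : MemLp (fun x => K (σ⁻¹ • x)) P volume) :
    ∫ z, g z • T z (hKP.toLp _) = σ ^ r • ∫ u, K u • T (σ • u) (hgP.toLp g) := by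
  have i1 : Integrable (fun z => g z • T z (hKP.toLp _)) volume :=
    (hg.smul (T_cont _)).integrable_of_hasCompactSupport hgs.smul_right
  have i2 : Integrable (fun u => K u • T (σ • u) (hgP.toLp g)) volume := by
    refine (hint.norm.mul_const ‖hgP.toLp g‖).mono' (hint.aestronglyMeasurable.smul
      ((T_cont _).comp (continuous_const_smul σ)).aestronglyMeasurable) ?_
    exact Filter.Eventually.of_forall fun u => by rw [norm_smul, T_norm]
  apply Lp.ext
  have hP1 : 1 ≤ P := Fact.out
  have ion : ∀ (h : Lp ℝ P (volume : Measure (Fin r → ℝ))) s, MeasurableSet s → volume s < ∞ →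
      IntegrableOn h s volume := fun h s hs hμ => by
    have : IsFiniteMeasure (volume.restrict s) := ⟨by simpa using hμ⟩
    exact ((Lp.memLp h).restrict s).integrable hP1
  refine Lp.ae_eq_of_forall_setIntegral_eq _ _ (by positivity) hPt.out (ion _) (ion _) ?_
  intro s hs hμ
  obtain ⟨L, hL⟩ := exists_clm (P := P) hs hμ.ne
  rw [← hL, ← hL, map_smul, ← L.integral_comp_comm i1, ← L.integral_comp_comm i2]
  simp_rw [map_smul, hL, clm_T _ hs]
  have e1 : ∀ z, ∫ y, K (σ⁻¹ • y) * s.indicator 1 (y + z)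
      = σ ^ r * ∫ u, K u * s.indicator 1 (σ • u + z) := fun z => by
    have := Measure.integral_comp_inv_smul_of_nonneg (volume : Measure (Fin r → ℝ))
      (fun u => K u * s.indicator 1 (σ • u + z)) hσ.le
    simpa [smul_smul, hσ.ne'] using this
  simp_rw [e1, smul_eq_mul, ← integral_const_mul]
  rw [integral_integral_swap]
  · congr 1; ext u; congr 1; ext z
    rw [add_comm]; ring
  · have hgi : Integrable g volume := hg.integrable_of_hasCompactSupport hgs
    have h1 := hgi.mul_prod hint
    have hm : Measurable fun q : (Fin r → ℝ) × (Fin r → ℝ) =>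
        s.indicator (1 : (Fin r → ℝ) → ℝ) (σ • q.2 + q.1) :=
      (measurable_one.indicator hs).comp (by fun_prop)
    have h2 := (h1.mul_bdd (c := 1) hm.aestronglyMeasurable
      (Filter.Eventually.of_forall fun q => by
        by_cases h : σ • q.2 + q.1 ∈ s <;> simp [h])).const_mul (σ ^ r)
    refine h2.congr (Filter.Eventually.of_forall fun q => ?_)
    simp only [Function.uncurry]
    ring

lemma mem_closure [Fact (1 ≤ P)] [hPt : Fact (P ≠ ∞)] {g : (Fin r → ℝ) → ℝ}
    (k : Lp ℝ P (volume : Measure (Fin r → ℝ))) :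
    ∫ z, g z • T z k ∈ (Submodule.span ℝ (Set.range fun z => T z k)).topologicalClosure := by
  set V := (Submodule.span ℝ (Set.range fun z => T z k)).topologicalClosure with hV
  have : CompleteSpace V := (Submodule.isClosed_topologicalClosure _).completeSpace_coe
  have hmem : ∀ z, g z • T z k ∈ V := fun z => V.smul_mem _
    (Submodule.le_topologicalClosure _ (Submodule.subset_span ⟨z, rfl⟩))
  have := V.subtypeₗᵢ.integral_comp_comm (μ := volume) (fun z => (⟨_, hmem z⟩ : V))
  change ∫ z, g z • T z k = _ at this
  rw [this]
  exact Subtype.coe_prop _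

lemma tendsto_G [Fact (1 ≤ P)] [hPt : Fact (P ≠ ∞)] {K : (Fin r → ℝ) → ℝ}
    (hint : Integrable K volume) (g : Lp ℝ P (volume : Measure (Fin r → ℝ))) :
    Filter.Tendsto (fun σ : ℝ => ∫ u, K u • T (σ • u) g) (𝓝[>] 0) (𝓝 ((∫ u, K u) • g)) := by
  rw [← integral_smul_const]
  refine tendsto_integral_filter_of_dominated_convergence (fun u => ‖K u‖ * ‖g‖) ?_ ?_ ?_ ?_
  · exact Filter.Eventually.of_forall fun σ => hint.aestronglyMeasurable.smul
      ((T_cont _).comp (continuous_const_smul σ)).aestronglyMeasurable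
  · exact Filter.Eventually.of_forall fun σ => Filter.Eventually.of_forall fun u => by
      rw [norm_smul, T_norm]
  · exact hint.norm.mul_const _
  · refine Filter.Eventually.of_forall fun u => ?_
    have h : Continuous fun σ : ℝ => K u • T (σ • u) g :=
      ((T_cont g).comp (g := fun z => T z g) (f := fun σ : ℝ => σ • u)
        (by fun_prop)).const_smul (K u)
    have := h.tendsto 0
    rw [zero_smul, T_zero] at this
    exact this.mono_left nhdsWithin_le_nhds

lemma elp {h : (Fin r → ℝ) → ℝ} {p : ℝ} (hp : 1 ≤ p) :
    ∫⁻ x, ENNReal.ofReal (|h x| ^ p) = (eLpNorm h (ENNReal.ofReal p) volume) ^ p := by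
  have hp0 : 0 < p := by linarith
  rw [eLpNorm_eq_lintegral_rpow_enorm_toReal (by simpa using hp0) ENNReal.ofReal_ne_top,
    ENNReal.toReal_ofReal hp0.le, ← ENNReal.rpow_mul, one_div, inv_mul_cancel₀ hp0.ne',
    ENNReal.rpow_one]
  refine lintegral_congr fun x => ?_
  rw [← ENNReal.ofReal_rpow_of_nonneg (abs_nonneg _) hp0.le, ← Real.norm_eq_abs, ofReal_norm]

end PS

/-- Park–Sandberg: let `K : ℝ^r → ℝ` be bounded, Lebesgue-integrable with
`∫ K ≠ 0`, and almost everywhere continuous (its discontinuity set has Lebesgue measure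
zero).  Then for every `p ∈ [1, ∞)` the RBF networks `x ↦ ∑ᵢ wᵢ K((x - zᵢ)/σ)` are dense in
`L^p(ℝ^r)`: for every `f ∈ L^p` and `ε > 0` some RBF network `q` satisfies
`∫ |f - q|^p < ε^p`, i.e. `(∫ |f - q|^p)^{1/p} < ε`. -/
theorem park_sandberg (r : ℕ) (K : (Fin r → ℝ) → ℝ)
    (hb : ∃ C : ℝ, ∀ x, |K x| ≤ C)
    (hint : Integrable K volume)
    (hnz : (∫ x, K x) ≠ 0)
    (hdisc : volume {x | ¬ ContinuousAt K x} = 0)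
    (p : ℝ) (hp : 1 ≤ p)
    (f : (Fin r → ℝ) → ℝ) (hf : Measurable f)
    (hfp : ∫⁻ x, ENNReal.ofReal (|f x| ^ p) ∂volume < ⊤)
    (ε : ℝ) (hε : 0 < ε) :
    ∃ (M : ℕ) (w : Fin M → ℝ) (z : Fin M → Fin r → ℝ) (σ : ℝ), 0 < σ ∧
      ∫⁻ x, ENNReal.ofReal (|f x - ∑ i, w i * K (σ⁻¹ • (x - z i))| ^ p) ∂volume
        < ENNReal.ofReal (ε ^ p) := by
  obtain ⟨C, hC⟩ := hb
  have hp0 : 0 < p := by linarith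
  set P := ENNReal.ofReal p with hP
  have : Fact (1 ≤ P) := ⟨by simpa [hP] using hp⟩
  have : Fact (P ≠ ∞) := ⟨ENNReal.ofReal_ne_top⟩
  have hfP : MemLp f P volume := by
    refine ⟨hf.aestronglyMeasurable, ?_⟩
    rw [PS.elp hp] at hfp
    exact (ENNReal.rpow_lt_top_iff_of_pos hp0).1 hfp
  obtain ⟨g, hgs, hfg, hg, hgP⟩ := hfP.exists_hasCompactSupport_eLpNorm_sub_le
    ENNReal.ofReal_ne_top (ε := ENNReal.ofReal (ε / 3)) (by simpa using hε)
  set G := hgP.toLp g with hG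
  have hfg' : ‖hfP.toLp f - G‖ ≤ ε / 3 := by
    rw [hG, ← MemLp.toLp_sub, Lp.norm_toLp]
    exact ENNReal.toReal_le_of_le_ofReal (by positivity) hfg
  -- choose sigma
  have ht := (PS.tendsto_G hint G).const_smul (∫ u, K u)⁻¹
  rw [smul_smul, inv_mul_cancel₀ hnz, one_smul] at ht
  have hev := (Metric.tendsto_nhds.1 ht (ε / 3) (by positivity)).and self_mem_nhdsWithin
  obtain ⟨σ, hσd, hσ⟩ := hev.exists
  replace hσ : 0 < σ := hσ
  have hKi : Integrable (fun x => K (σ⁻¹ • x)) volume := hint.comp_smul (inv_ne_zero hσ.ne')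
  have hKP : MemLp (fun x => K (σ⁻¹ • x)) P volume := PS.memLp_bdd_int hKi (fun x => hC _) p hp
  set k := hKP.toLp _ with hk
  have hmem := PS.mem_closure (g := g) k
  rw [hk, PS.key hint hg hgs hgP hσ hKP, ← hk, ← hG] at hmem
  have hmem2 : (∫ u, K u)⁻¹ • ∫ u, K u • PS.T (σ • u) G ∈
      (Submodule.span ℝ (Set.range fun z => PS.T z k)).topologicalClosure := by
    have h := Submodule.smul_mem _ ((∫ u, K u)⁻¹ * (σ ^ r)⁻¹) hmem
    rwa [smul_smul, mul_assoc, inv_mul_cancel₀ (by positivity), mul_one] at h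
  obtain ⟨q, hq, hqd⟩ := Metric.mem_closure_iff.1 hmem2 (ε / 3) (by positivity)
  obtain ⟨M, w, b, hqe⟩ := Submodule.mem_span_set'.1 hq
  choose z hz using fun i => (b i).2
  refine ⟨M, w, z, σ, hσ, ?_⟩
  have hfin : ‖hfP.toLp f - q‖ < ε := by
    rw [← dist_eq_norm] at hfg' ⊢
    rw [dist_comm] at hσd
    have := dist_triangle4 (hfP.toLp f) G _ q |>.trans_lt (add_lt_add (add_lt_add_of_le_of_lt hfg' hσd) hqd)
    linarith
  rw [PS.elp hp, ← ENNReal.ofReal_rpow_of_pos hε]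
  refine ENNReal.rpow_lt_rpow ?_ hp0
  have hae : ⇑(hfP.toLp f - q) =ᵐ[volume]
      fun x => f x - ∑ i, w i * K (σ⁻¹ • (x - z i)) := by
    have h1 : ∀ i, ⇑(w i • (b i : Lp ℝ P (volume : Measure (Fin r → ℝ)))) =ᵐ[volume]
        fun x => w i * K (σ⁻¹ • (x - z i)) := fun i => by
      rw [← hz i]
      filter_upwards [Lp.coeFn_smul (w i) (PS.T (z i) k), PS.T_ae (z i) hKP] with x h1 h2
      rw [h1, Pi.smul_apply, h2, smul_eq_mul]
    have h2 := Lp.coeFn_finsetSum Finset.univ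
      (fun i => w i • (b i : Lp ℝ P (volume : Measure (Fin r → ℝ))))
    rw [hqe] at h2
    filter_upwards [Lp.coeFn_sub (hfP.toLp f) q, hfP.coeFn_toLp, h2, ae_all_iff.2 h1]
      with x a1 a2 a3 a4
    rw [a1, Pi.sub_apply, a2, a3, Finset.sum_apply]
    congr 1
    exact Finset.sum_congr rfl fun i _ => a4 i
  rw [← eLpNorm_congr_ae hae]
  rw [Lp.norm_def] at hfin
  exact (ENNReal.lt_ofReal_iff_toReal_lt (Lp.eLpNorm_ne_top _)).2 hfin
end

section
/- (Darken–Donahue–Gurvits–Sontag) Let (Y, 𝒩, ν) be a measure space, let p ∈ (1, ∞), set q = p/(p−1), a = min(p, q), b = max(p, q). Let G ⊆ L^p(Y, ν) and let f belong to the closure of the convex hull of G in L^p(Y, ν). If r > 0 is such that ‖f − g‖_{L^p} < r for every g ∈ G, then for every integer n ≥ 1 the distance in L^p(Y, ν) from f to span_n(G) is at most 2^{1/a} r / n^{1/b}. -/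
open MeasureTheory

namespace DDGS

lemma pow_mean {s u v : ℝ} (hs0 : 0 ≤ s) (hs1 : s ≤ 1) (hu : 0 ≤ u) (hv : 0 ≤ v) :
    u ^ s + v ^ s ≤ 2 * ((u + v) / 2) ^ s := by
  have h := (Real.concaveOn_rpow hs0 hs1).2 (Set.mem_Ici.2 hu) (Set.mem_Ici.2 hv)
    (by norm_num : (0 : ℝ) ≤ 1 / 2) (by norm_num : (0 : ℝ) ≤ 1 / 2) (by norm_num)
  simp only [smul_eq_mul] at h
  rw [show (u + v) / 2 = 1 / 2 * u + 1 / 2 * v by ring]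
  linarith

lemma scalar_low {p : ℝ} (hp : 0 < p) (hp2 : p ≤ 2) (x y : ℝ) :
    |x + y| ^ p + |x - y| ^ p ≤ 2 * (|x| ^ p + |y| ^ p) := by
  have key : ∀ z : ℝ, |z| ^ p = (z ^ 2) ^ (p / 2) := by
    intro z
    rw [← sq_abs, ← Real.rpow_natCast, ← Real.rpow_mul (abs_nonneg z)]
    congr 1; push_cast; ring
  simp only [key]
  have h1 := pow_mean (s := p / 2) (by linarith) (by linarith) (sq_nonneg (x + y))
    (sq_nonneg (x - y))
  rw [show ((x + y) ^ 2 + (x - y) ^ 2) / 2 = x ^ 2 + y ^ 2 by ring] at h1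
  have h2 := Real.rpow_add_le_add_rpow (sq_nonneg x) (sq_nonneg y) (p := p / 2) (by linarith)
    (by linarith)
  linarith

lemma interp {A B C D t : ℝ} (hA : 0 < A) (hB : 0 < B) (hC : 0 < C) (hD : 0 < D)
    (hAB : A + B = 1) (hCD : C + D = 1) (ht : 1 / 2 ≤ t) (ht1 : t ≤ 1) :
    C ^ t * (A ^ t + B ^ t) + D ^ t * (A ^ t - B ^ t) ≤ 2 ^ (1 - t) := by
  let F : ℂ → ℂ := fun z =>
    (C : ℂ) ^ (1 - z / 2) * ((A : ℂ) ^ (1 - z / 2) + (B : ℂ) ^ (1 - z / 2))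
      + (D : ℂ) ^ (1 - z / 2) * ((A : ℂ) ^ (1 - z / 2) - (B : ℂ) ^ (1 - z / 2))
  have hdiff : Differentiable ℂ F := by
    have h0 : Differentiable ℂ (fun z : ℂ => 1 - z / 2) := by fun_prop
    have h1 : ∀ X : ℝ, 0 < X → Differentiable ℂ (fun z : ℂ => (X : ℂ) ^ (1 - z / 2)) := by
      intro X hX
      exact h0.const_cpow (Or.inl (by exact_mod_cast hX.ne'))
    exact ((h1 C hC).mul ((h1 A hA).add (h1 B hB))).add ((h1 D hD).mul ((h1 A hA).sub (h1 B hB)))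
  have hnorm : ∀ X : ℝ, 0 < X → ∀ z : ℂ, ‖(X : ℂ) ^ (1 - z / 2)‖ = X ^ (1 - z.re / 2) := by
    intro X hX z
    rw [Complex.norm_cpow_eq_rpow_re_of_pos hX]
    simp
  have htri : ∀ z : ℂ, ‖F z‖ ≤ C ^ (1 - z.re / 2) * ‖(A : ℂ) ^ (1 - z / 2) + (B : ℂ) ^ (1 - z / 2)‖
      + D ^ (1 - z.re / 2) * ‖(A : ℂ) ^ (1 - z / 2) - (B : ℂ) ^ (1 - z / 2)‖ := by
    intro z
    refine (norm_add_le _ _).trans ?_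
    rw [norm_mul, norm_mul, hnorm C hC, hnorm D hD]
  have htri2 : ∀ z : ℂ, ‖F z‖ ≤ (C ^ (1 - z.re / 2) + D ^ (1 - z.re / 2)) *
      (A ^ (1 - z.re / 2) + B ^ (1 - z.re / 2)) := by
    intro z
    refine (htri z).trans ?_
    have e1 := norm_add_le ((A : ℂ) ^ (1 - z / 2)) ((B : ℂ) ^ (1 - z / 2))
    have e2 := norm_sub_le ((A : ℂ) ^ (1 - z / 2)) ((B : ℂ) ^ (1 - z / 2))
    rw [hnorm A hA, hnorm B hB] at e1 e2
    rw [add_mul]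
    gcongr
  have hbdd : BddAbove ((norm ∘ F) '' Complex.HadamardThreeLines.verticalClosedStrip 0 1) := by
    refine ⟨4, ?_⟩
    rintro _ ⟨z, hz, rfl⟩
    have hz' : 0 ≤ z.re ∧ z.re ≤ 1 := hz
    have hle : ∀ X : ℝ, 0 < X → X ≤ 1 → X ^ (1 - z.re / 2) ≤ 1 := fun X h0 h1 =>
      Real.rpow_le_one h0.le h1 (by linarith [hz'.2])
    refine (htri2 z).trans ?_
    have := hle A hA (by linarith)
    have := hle B hB (by linarith)
    have := hle C hC (by linarith)
    have := hle D hD (by linarith)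
    calc _ ≤ ((1 : ℝ) + 1) * (1 + 1) := by gcongr
      _ = 4 := by norm_num
  have h0 : ∀ z ∈ Complex.re ⁻¹' {0}, ‖F z‖ ≤ 1 := by
    intro z hz
    have hz' : z.re = 0 := hz
    have := htri2 z
    rw [hz'] at this
    simpa [hAB, hCD] using this
  have h1 : ∀ z ∈ Complex.re ⁻¹' {1}, ‖F z‖ ≤ Real.sqrt 2 := by
    intro z hz
    have hz' : z.re = 1 := hz
    refine (htri z).trans ?_
    have hh : ∀ X : ℝ, X ^ (1 - z.re / 2) = Real.sqrt X := by
      intro X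
      rw [hz', Real.sqrt_eq_rpow]; norm_num
    have pl := parallelogram_law_with_norm ℝ ((A : ℂ) ^ (1 - z / 2)) ((B : ℂ) ^ (1 - z / 2))
    rw [hnorm A hA, hnorm B hB] at pl
    simp only [hh] at pl ⊢
    rw [Real.sq_sqrt hA.le, Real.sq_sqrt hB.le, hAB] at pl
    apply Real.le_sqrt_of_sq_le
    set u := ‖(A : ℂ) ^ (1 - z / 2) + (B : ℂ) ^ (1 - z / 2)‖
    set v := ‖(A : ℂ) ^ (1 - z / 2) - (B : ℂ) ^ (1 - z / 2)‖
    have hc := Real.mul_self_sqrt hC.le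
    have hd := Real.mul_self_sqrt hD.le
    set c := Real.sqrt C
    set d := Real.sqrt D
    have : (c * u + d * v) ^ 2 + (c * v - d * u) ^ 2 = (c * c + d * d) * (u ^ 2 + v ^ 2) := by ring
    rw [hc, hd, hCD, pl] at this
    linarith [sq_nonneg (c * v - d * u)]
  have key := Complex.HadamardThreeLines.norm_le_interp_of_mem_verticalClosedStrip₀₁' F
    (z := ((2 - 2 * t : ℝ) : ℂ)) (a := 1) (b := Real.sqrt 2)
    (by simp only [Complex.HadamardThreeLines.verticalClosedStrip, Set.mem_preimage,
          Complex.ofReal_re, Set.mem_Icc]; constructor <;> linarith)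
    hdiff.diffContOnCl hbdd h0 h1
  rw [Complex.ofReal_re, Real.one_rpow, one_mul, Real.sqrt_eq_rpow,
    ← Real.rpow_mul (by norm_num), show 1 / 2 * (2 - 2 * t) = 1 - t by ring] at key
  refine le_trans ?_ key
  have hF : F ((2 - 2 * t : ℝ) : ℂ) =
      ((C ^ t * (A ^ t + B ^ t) + D ^ t * (A ^ t - B ^ t) : ℝ) : ℂ) := by
    have e : (1 : ℂ) - ((2 - 2 * t : ℝ) : ℂ) / 2 = (t : ℂ) := by push_cast; ring
    simp only [F, e]
    push_cast [Complex.ofReal_cpow hA.le, Complex.ofReal_cpow hB.le, Complex.ofReal_cpow hC.le,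
      Complex.ofReal_cpow hD.le]
    rfl
  rw [hF, Complex.norm_real]
  exact le_abs_self _

lemma clarkson_pos {p q a b : ℝ} (hp : 2 ≤ p) (hpq : (p - 1) * q = p) (hb : 0 < b) (hab : b < a) :
    (a + b) ^ p + (a - b) ^ p ≤ 2 * (a ^ q + b ^ q) ^ (p - 1) := by
  have ha : 0 < a := hb.trans hab
  have hq : 0 < q := by
    by_contra h
    nlinarith
  have hd : 0 < a - b := by linarith
  set S := (a + b) ^ p + (a - b) ^ p with hS
  set T := a ^ q + b ^ q with hT
  have hSpos : 0 < S := by positivity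
  have hTpos : 0 < T := by positivity
  have hpt : p * (1 / q) = p - 1 := by field_simp; linarith
  have hq2 : q ≤ 2 := by nlinarith
  have hq1 : 1 ≤ q := by nlinarith
  have hi : 1 - 1 / q = 1 / p := by field_simp; linarith
  have h := interp (A := a ^ q / T) (B := b ^ q / T) (C := (a + b) ^ p / S) (D := (a - b) ^ p / S)
    (t := 1 / q) (by positivity) (by positivity) (by positivity) (by positivity)
    (by rw [← add_div, ← hT, div_self hTpos.ne']) (by rw [← add_div, ← hS, div_self hSpos.ne'])
    (by rw [div_le_div_iff₀ (by norm_num) hq]; linarith)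
    (by rw [div_le_iff₀ hq]; linarith)
  have hab0 : 0 ≤ a + b := by positivity
  rw [Real.div_rpow (by positivity) hSpos.le, Real.div_rpow (by positivity) hSpos.le,
    Real.div_rpow (by positivity) hTpos.le, Real.div_rpow (by positivity) hTpos.le,
    ← Real.rpow_mul ha.le, ← Real.rpow_mul hb.le, ← Real.rpow_mul hab0, ← Real.rpow_mul hd.le,
    mul_one_div_cancel hq.ne', Real.rpow_one, Real.rpow_one, hpt, hi] at h
  have hsplit : ∀ z : ℝ, 0 < z → z ^ (p - 1) * z = z ^ p := by
    intro z hz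
    rw [← Real.rpow_add_one hz.ne']; congr 1; ring
  have hL : (a + b) ^ (p - 1) / S ^ (1 / q) * (a / T ^ (1 / q) + b / T ^ (1 / q)) +
      (a - b) ^ (p - 1) / S ^ (1 / q) * (a / T ^ (1 / q) - b / T ^ (1 / q))
      = S ^ (1 / p) / T ^ (1 / q) := by
    have : S ^ (1 / p) = S / S ^ (1 / q) := by
      rw [← hi, Real.rpow_sub hSpos, Real.rpow_one]
    rw [this]
    have e : S = (a + b) ^ (p - 1) * (a + b) + (a - b) ^ (p - 1) * (a - b) := by
      rw [hsplit _ (by positivity), hsplit _ hd]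
    rw [show S / S ^ (1 / q) = ((a + b) ^ (p - 1) * (a + b) + (a - b) ^ (p - 1) * (a - b)) /
      S ^ (1 / q) by rw [← e]]
    field_simp
  rw [hL, div_le_iff₀ (by positivity)] at h
  have h2 := Real.rpow_le_rpow (by positivity) h (by linarith : 0 ≤ p)
  rw [Real.mul_rpow (by positivity) (by positivity), ← Real.rpow_mul hSpos.le,
    ← Real.rpow_mul (by norm_num), ← Real.rpow_mul hTpos.le, one_div_mul_cancel (by linarith),
    Real.rpow_one, Real.rpow_one, mul_comm (1 / q), hpt] at h2
  exact h2

lemma clarkson_nonneg {p q a b : ℝ} (hp : 2 ≤ p) (hpq : (p - 1) * q = p) (hb : 0 ≤ b)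
    (hab : b ≤ a) :
    (a + b) ^ p + (a - b) ^ p ≤ 2 * (a ^ q + b ^ q) ^ (p - 1) := by
  have hq : 0 < q := by
    by_contra h
    nlinarith
  have ha : 0 ≤ a := hb.trans hab
  have hpow : ∀ z : ℝ, 0 ≤ z → (z ^ q) ^ (p - 1) = z ^ p := by
    intro z hz
    rw [← Real.rpow_mul hz, mul_comm, hpq]
  rcases hb.eq_or_lt with rfl | hb'
  · rw [Real.zero_rpow hq.ne', add_zero, add_zero, sub_zero, hpow a ha]
    linarith
  rcases hab.eq_or_lt with rfl | hab'
  · rw [sub_self, Real.zero_rpow (by linarith), ← two_mul, ← two_mul,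
      Real.mul_rpow (by norm_num) hb, Real.mul_rpow (by norm_num) (by positivity), hpow b hb,
      Real.rpow_sub_one (by norm_num)]
    apply le_of_eq; ring
  exact clarkson_pos hp hpq hb' hab'

lemma scalar_high {p q : ℝ} (hp : 2 ≤ p) (hpq : (p - 1) * q = p) (x y : ℝ) :
    |x + y| ^ p + |x - y| ^ p ≤ 2 * (|x| ^ q + |y| ^ q) ^ (p - 1) := by
  have key : ∀ x y : ℝ, |y| ≤ |x| →
      |x + y| ^ p + |x - y| ^ p ≤ 2 * (|x| ^ q + |y| ^ q) ^ (p - 1) := by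
    intro x y hxy
    have h := clarkson_nonneg hp hpq (abs_nonneg y) hxy
    rcases abs_cases x with ⟨hx, hx'⟩ | ⟨hx, hx'⟩ <;> rcases abs_cases y with ⟨hy, hy'⟩ | ⟨hy, hy'⟩
    · rw [show |x + y| = |x| + |y| by rw [abs_of_nonneg] <;> linarith,
        show |x - y| = |x| - |y| by rw [abs_of_nonneg] <;> linarith]
      exact h
    · rw [show |x + y| = |x| - |y| by rw [abs_of_nonneg] <;> linarith,
        show |x - y| = |x| + |y| by rw [abs_of_nonneg] <;> linarith, add_comm]
      exact h
    · rw [show |x + y| = |x| - |y| by rw [abs_of_nonpos] <;> linarith,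
        show |x - y| = |x| + |y| by rw [abs_of_nonpos] <;> linarith, add_comm]
      exact h
    · rw [show |x + y| = |x| + |y| by rw [abs_of_nonpos] <;> linarith,
        show |x - y| = |x| - |y| by rw [abs_of_nonpos] <;> linarith]
      exact h
  rcases le_total |y| |x| with h | h
  · exact key x y h
  · have := key y x h
    rwa [add_comm y x, abs_sub_comm y x, add_comm (|y| ^ q)] at this

/-- Greedy approximation in a space with a Clarkson inequality. -/
lemma greedy {E : Type*} [NormedAddCommGroup E] [NormedSpace ℝ E] {a : ℝ} (ha : 0 < a)
    (H : ∀ x y : E, ‖x + y‖ ^ a + ‖x - y‖ ^ a ≤ 2 * (‖x‖ ^ a + ‖y‖ ^ a))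
    {G : Set E} {f : E} (hf : f ∈ closure (convexHull ℝ G)) {r : ℝ}
    (hG : ∀ g ∈ G, ‖f - g‖ < r) {c : ℝ} (hc : 2 * r ^ a < c) (n : ℕ) :
    ∃ g : Fin n → E, (∀ i, g i ∈ G) ∧ ‖∑ i, (g i - f)‖ ^ a ≤ n * c := by
  have step : ∀ x : E, ∃ g ∈ G, ‖x + (g - f)‖ ^ a ≤ ‖x‖ ^ a + c := by
    intro x
    by_contra! hcon
    have hb : ∀ g ∈ G, ‖x - (g - f)‖ ^ a ≤ ‖x‖ ^ a - (c - 2 * r ^ a) := by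
      intro g hg
      have h1 := H x (g - f)
      have h2 := hcon g hg
      have h3 : ‖g - f‖ ^ a ≤ r ^ a := by
        rw [norm_sub_rev]
        exact Real.rpow_le_rpow (norm_nonneg _) (hG g hg).le ha.le
      linarith
    set R := ‖x‖ ^ a - (c - 2 * r ^ a) with hR
    have hGne : G.Nonempty := by
      have : (closure (convexHull ℝ G)).Nonempty := ⟨f, hf⟩
      simpa using this
    have hR0 : 0 ≤ R := by
      obtain ⟨g, hg⟩ := hGne
      exact (Real.rpow_nonneg (norm_nonneg _) a).trans (hb g hg)
    have hsub : G ⊆ Metric.closedBall (x + f) (R ^ a⁻¹) := by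
      intro g hg
      rw [Metric.mem_closedBall, dist_comm, dist_eq_norm]
      have := hb g hg
      rw [Real.le_rpow_inv_iff_of_pos (norm_nonneg _) hR0 ha]
      rwa [show x + f - g = x - (g - f) by abel]
    have hmem := closure_minimal (convexHull_min hsub (convex_closedBall _ _))
      Metric.isClosed_closedBall hf
    rw [Metric.mem_closedBall, dist_comm, dist_eq_norm, add_sub_cancel_right,
      Real.le_rpow_inv_iff_of_pos (norm_nonneg _) hR0 ha] at hmem
    linarith
  induction n with
  | zero => exact ⟨fun i => i.elim0, fun i => i.elim0, by simp [Real.zero_rpow ha.ne']⟩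
  | succ n ih =>
    obtain ⟨g, hg, hle⟩ := ih
    obtain ⟨g', hg', hle'⟩ := step (∑ i, (g i - f))
    refine ⟨Fin.snoc g g', ?_, ?_⟩
    · intro i
      refine Fin.lastCases ?_ (fun j => ?_) i
      · simpa using hg'
      · simpa using hg j
    · rw [Fin.sum_univ_castSucc]
      simp only [Fin.snoc_castSucc, Fin.snoc_last]
      push_cast
      linarith

lemma infDist_le {E : Type*} [NormedAddCommGroup E] [NormedSpace ℝ E] {a b : ℝ} (ha : 0 < a)
    (hab : 1 / a + 1 / b = 1)
    (H : ∀ x y : E, ‖x + y‖ ^ a + ‖x - y‖ ^ a ≤ 2 * (‖x‖ ^ a + ‖y‖ ^ a))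
    {G : Set E} {f : E} (hf : f ∈ closure (convexHull ℝ G)) {r : ℝ} (hr : 0 < r)
    (hG : ∀ g ∈ G, ‖f - g‖ < r) (n : ℕ) (hn : 1 ≤ n) :
    Metric.infDist f { y : E | ∃ (a : Fin n → ℝ) (g : Fin n → E),
            (∀ i, g i ∈ G) ∧ y = ∑ i, a i • g i } ≤ 2 ^ (1 / a) * r / (n : ℝ) ^ (1 / b) := by
  set K := { y : E | ∃ (a : Fin n → ℝ) (g : Fin n → E),
            (∀ i, g i ∈ G) ∧ y = ∑ i, a i • g i }
  have hn0 : (0 : ℝ) < n := by exact_mod_cast hn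
  set d := Metric.infDist f K with hd
  have hd0 : 0 ≤ d := Metric.infDist_nonneg
  have hmain : (n * d) ^ a ≤ n * (2 * r ^ a) := by
    have : (n * d) ^ a / n ≤ 2 * r ^ a := by
      apply le_of_forall_gt_imp_ge_of_dense
      intro c hc
      obtain ⟨g, hg, hle⟩ := greedy ha H hf hG hc n
      rw [div_le_iff₀ hn0, mul_comm c]
      refine le_trans (Real.rpow_le_rpow (by positivity) ?_ ha.le) hle
      have hmem : (∑ i, (1 / (n : ℝ)) • g i) ∈ K := ⟨fun _ => 1 / (n : ℝ), g, hg, rfl⟩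
      have h1 := Metric.infDist_le_dist_of_mem (x := f) hmem
      have h2 : (n : ℝ) * dist f (∑ i, (1 / (n : ℝ)) • g i) = ‖∑ i, (g i - f)‖ := by
        rw [dist_comm, dist_eq_norm, ← Real.norm_of_nonneg hn0.le, ← norm_smul,
          Real.norm_of_nonneg hn0.le]
        congr 1
        rw [smul_sub, ← Finset.smul_sum, smul_smul, mul_one_div_cancel hn0.ne', one_smul,
          Finset.sum_sub_distrib]
        simp [Nat.cast_smul_eq_nsmul]
      rw [← h2]
      gcongr
    rwa [div_le_iff₀ hn0, mul_comm _ (n : ℝ)] at this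
  have h3 := Real.rpow_le_rpow (by positivity) hmain (by positivity : 0 ≤ 1 / a)
  rw [← Real.rpow_mul (by positivity), mul_one_div_cancel ha.ne', Real.rpow_one,
    Real.mul_rpow (by positivity) (by positivity), Real.mul_rpow (by positivity) (by positivity),
    ← Real.rpow_mul hr.le, mul_one_div_cancel ha.ne', Real.rpow_one] at h3
  rw [le_div_iff₀ (by positivity)]
  have h4 : (n : ℝ) = (n : ℝ) ^ (1 / a) * (n : ℝ) ^ (1 / b) := by
    rw [← Real.rpow_add hn0, hab, Real.rpow_one]
  have h5 : 0 < (n : ℝ) ^ (1 / a) := by positivity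
  nth_rewrite 1 [h4] at h3
  rw [mul_assoc] at h3
  have := le_of_mul_le_mul_left h3 h5
  linarith

lemma enorm_pow {Y : Type*} [MeasurableSpace Y] {ν : Measure Y} {p : ℝ} (hp : 0 < p)
    (x : Lp ℝ (ENNReal.ofReal p) ν) : ‖x‖ₑ ^ p = ∫⁻ t, ‖x t‖ₑ ^ p ∂ν := by
  rw [Lp.enorm_def, eLpNorm_eq_lintegral_rpow_enorm_toReal (by simpa using hp) (by simp),
    ENNReal.toReal_ofReal hp.le, ← ENNReal.rpow_mul, one_div_mul_cancel hp.ne', ENNReal.rpow_one]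

lemma sum_pow {Y : Type*} [MeasurableSpace Y] {ν : Measure Y} {p : ℝ} (hp : 0 < p)
    (x y : Lp ℝ (ENNReal.ofReal p) ν) :
    ‖x + y‖ₑ ^ p + ‖x - y‖ₑ ^ p = ∫⁻ t, (‖x t + y t‖ₑ ^ p + ‖x t - y t‖ₑ ^ p) ∂ν := by
  rw [enorm_pow hp, enorm_pow hp, ← lintegral_add_left'
    ((Lp.aestronglyMeasurable (x + y)).enorm.pow_const p)]
  apply lintegral_congr_ae
  filter_upwards [Lp.coeFn_add x y, Lp.coeFn_sub x y] with t h1 h2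
  rw [h1, h2]; rfl

lemma clarkson_low {Y : Type*} [MeasurableSpace Y] {ν : Measure Y} {p : ℝ} (hp : 1 < p)
    (hp2 : p ≤ 2) [Fact (1 ≤ ENNReal.ofReal p)] (x y : Lp ℝ (ENNReal.ofReal p) ν) :
    ‖x + y‖ ^ p + ‖x - y‖ ^ p ≤ 2 * (‖x‖ ^ p + ‖y‖ ^ p) := by
  have hp0 : 0 < p := by linarith
  have h : ‖x + y‖ₑ ^ p + ‖x - y‖ₑ ^ p ≤ 2 * (‖x‖ₑ ^ p + ‖y‖ₑ ^ p) := by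
    rw [sum_pow hp0, enorm_pow hp0 x, enorm_pow hp0 y, ← lintegral_add_left'
      ((Lp.aestronglyMeasurable x).enorm.pow_const p), ← lintegral_const_mul' _ _ (by simp)]
    refine lintegral_mono fun t => ?_
    simp only [← ofReal_norm, Real.norm_eq_abs,
      ENNReal.ofReal_rpow_of_nonneg (abs_nonneg _) hp0.le]
    rw [← ENNReal.ofReal_add (by positivity) (by positivity),
      ← ENNReal.ofReal_add (by positivity) (by positivity), ← ENNReal.ofReal_ofNat 2,
      ← ENNReal.ofReal_mul (by norm_num)]
    exact ENNReal.ofReal_le_ofReal (scalar_low hp0 hp2 _ _)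
  simp only [← ofReal_norm, ENNReal.ofReal_rpow_of_nonneg (norm_nonneg _) hp0.le] at h
  rw [← ENNReal.ofReal_add (by positivity) (by positivity),
      ← ENNReal.ofReal_add (by positivity) (by positivity), ← ENNReal.ofReal_ofNat 2,
      ← ENNReal.ofReal_mul (by norm_num)] at h
  exact (ENNReal.ofReal_le_ofReal_iff (by positivity)).1 h

lemma clarkson_high {Y : Type*} [MeasurableSpace Y] {ν : Measure Y} {p q : ℝ} (hp : 2 ≤ p)
    (hpq : (p - 1) * q = p) [Fact (1 ≤ ENNReal.ofReal p)] (x y : Lp ℝ (ENNReal.ofReal p) ν) :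
    ‖x + y‖ ^ q + ‖x - y‖ ^ q ≤ 2 * (‖x‖ ^ q + ‖y‖ ^ q) := by
  have hp0 : 0 < p := by linarith
  have hp1 : 0 < p - 1 := by linarith
  have hq : 0 < q := by
    by_contra h
    nlinarith
  have hqp : p * (1 / (p - 1)) = q := by field_simp; linarith
  have hmink : ∫⁻ t, (‖x t‖ₑ ^ q + ‖y t‖ₑ ^ q) ^ (p - 1) ∂ν
      ≤ (‖x‖ₑ ^ q + ‖y‖ₑ ^ q) ^ (p - 1) := by
    have hm := ENNReal.lintegral_Lp_add_le (μ := ν) (p := p - 1)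
      ((Lp.aestronglyMeasurable x).enorm.pow_const q)
      ((Lp.aestronglyMeasurable y).enorm.pow_const q) (by linarith)
    simp only [Pi.add_apply, ← ENNReal.rpow_mul, mul_comm q, hpq] at hm
    rw [← enorm_pow hp0 x, ← enorm_pow hp0 y, ← ENNReal.rpow_mul, ← ENNReal.rpow_mul, hqp] at hm
    have := ENNReal.rpow_le_rpow hm hp1.le
    rwa [← ENNReal.rpow_mul, one_div_mul_cancel hp1.ne', ENNReal.rpow_one] at this
  have h : ‖x + y‖ₑ ^ p + ‖x - y‖ₑ ^ p ≤ 2 * (‖x‖ₑ ^ q + ‖y‖ₑ ^ q) ^ (p - 1) := by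
    rw [sum_pow hp0]
    refine le_trans ?_ (mul_le_mul_right hmink 2)
    rw [← lintegral_const_mul' _ _ (by simp)]
    refine lintegral_mono fun t => ?_
    simp only [← ofReal_norm, Real.norm_eq_abs,
      ENNReal.ofReal_rpow_of_nonneg (abs_nonneg _) hp0.le,
      ENNReal.ofReal_rpow_of_nonneg (abs_nonneg _) hq.le]
    rw [← ENNReal.ofReal_add (by positivity) (by positivity),
      ← ENNReal.ofReal_add (by positivity) (by positivity),
      ENNReal.ofReal_rpow_of_nonneg (by positivity) hp1.le, ← ENNReal.ofReal_ofNat 2,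
      ← ENNReal.ofReal_mul (by norm_num)]
    exact ENNReal.ofReal_le_ofReal (scalar_high hp hpq _ _)
  simp only [← ofReal_norm, ENNReal.ofReal_rpow_of_nonneg (norm_nonneg _) hp0.le,
    ENNReal.ofReal_rpow_of_nonneg (norm_nonneg _) hq.le] at h
  rw [← ENNReal.ofReal_add (by positivity) (by positivity),
      ← ENNReal.ofReal_add (by positivity) (by positivity),
      ENNReal.ofReal_rpow_of_nonneg (by positivity) hp1.le, ← ENNReal.ofReal_ofNat 2,
      ← ENNReal.ofReal_mul (by norm_num)] at h
  have h' := (ENNReal.ofReal_le_ofReal_iff (by positivity)).1 h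
  have hpm := pow_mean (s := 1 / (p - 1)) (u := ‖x + y‖ ^ p) (v := ‖x - y‖ ^ p) (by positivity)
    (by rw [div_le_iff₀ hp1]; linarith) (by positivity) (by positivity)
  rw [← Real.rpow_mul (norm_nonneg _), ← Real.rpow_mul (norm_nonneg _), hqp] at hpm
  refine hpm.trans ?_
  have h2 : ((‖x + y‖ ^ p + ‖x - y‖ ^ p) / 2) ^ (1 / (p - 1)) ≤
      ((‖x‖ ^ q + ‖y‖ ^ q) ^ (p - 1)) ^ (1 / (p - 1)) :=
    Real.rpow_le_rpow (by positivity) (by linarith) (by positivity)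
  rw [← Real.rpow_mul (by positivity), mul_one_div_cancel hp1.ne', Real.rpow_one] at h2
  linarith

end DDGS

open MeasureTheory

/-- Darken–Donahue–Gurvits–Sontag: let `(Y, 𝒩, ν)` be a measure space,
`p ∈ (1, ∞)`, `q = p/(p-1)`, `a = min(p,q)`, `b = max(p,q)`.  If `G ⊆ L^p(Y, ν)`,
`f` lies in the closure of the convex hull of `G`, and `‖f - g‖ < r` for every `g ∈ G`,
then for every `n ≥ 1` the distance from `f` to `span_n(G)` is at most
`2^{1/a} r / n^{1/b}`. -/
theorem darken_donahue_gurvits_sontag (Y : Type*) [MeasurableSpace Y] (ν : Measure Y)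
    (p : ℝ) (hp : 1 < p) [Fact (1 ≤ ENNReal.ofReal p)]
    (G : Set (Lp ℝ (ENNReal.ofReal p) ν))
    (f : Lp ℝ (ENNReal.ofReal p) ν)
    (hf : f ∈ closure (convexHull ℝ G))
    (r : ℝ) (hr : 0 < r) (hG : ∀ g ∈ G, ‖f - g‖ < r)
    (n : ℕ) (hn : 1 ≤ n) :
    Metric.infDist f
        { y : Lp ℝ (ENNReal.ofReal p) ν |
          ∃ (a : Fin n → ℝ) (g : Fin n → Lp ℝ (ENNReal.ofReal p) ν),
            (∀ i, g i ∈ G) ∧ y = ∑ i, a i • g i }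
      ≤ 2 ^ (1 / min p (p / (p - 1))) * r / (n : ℝ) ^ (1 / max p (p / (p - 1))) := by
  have hp1 : 0 < p - 1 := by linarith
  have hp0 : 0 < p := by linarith
  have hpq : (p - 1) * (p / (p - 1)) = p := mul_div_cancel₀ _ hp1.ne'
  have hsum : 1 / p + 1 / (p / (p - 1)) = 1 := by field_simp; ring
  rcases le_total p 2 with h2 | h2
  · have hle : p ≤ p / (p - 1) := by
      rw [le_div_iff₀ hp1]; nlinarith
    rw [min_eq_left hle, max_eq_right hle]
    exact DDGS.infDist_le hp0 hsum (DDGS.clarkson_low hp h2) hf hr hG n hn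
  · have hle : p / (p - 1) ≤ p := by
      rw [div_le_iff₀ hp1]; nlinarith
    rw [min_eq_right hle, max_eq_left hle]
    exact DDGS.infDist_le (by positivity) (by rw [add_comm]; exact hsum)
      (DDGS.clarkson_high h2 hpq) hf hr hG n hn
end

section
/- (Kůrková–Sanguineti) Let X be a real Hilbert space, let G ⊆ X be nonempty and bounded, and let s_G = sup_{g ∈ G} ‖g‖. Then for every f in the convex hull of G there exists τ_f ∈ [0, 1) such that for every integer n ≥ 1, the distance from f to conv_n(G) is at most √(τ_f^{n−1} (s_G² − ‖f‖²)). -/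
/-- `conv_n(G)`: the set of `n`-term convex combinations of elements of `G`. -/
def convN {X : Type*} [AddCommGroup X] [Module ℝ X] (n : ℕ) (G : Set X) : Set X :=
  { y | ∃ (a : Fin n → ℝ) (g : Fin n → X),
      (∀ i, 0 ≤ a i) ∧ (∑ i, a i = 1) ∧ (∀ i, g i ∈ G) ∧ y = ∑ i, a i • g i }

theorem convN_succ {X : Type*} [AddCommGroup X] [Module ℝ X] {G : Set X} (hG : G.Nonempty)
    (n : ℕ) : convN n G ⊆ convN (n + 1) G := by
  rintro y ⟨a, g, ha, hs, hg, rfl⟩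
  obtain ⟨g0, h0⟩ := hG
  refine ⟨Fin.cons 0 a, Fin.cons g0 g, ?_, ?_, ?_, ?_⟩
  · intro i
    refine Fin.cases ?_ (fun j => ?_) i
    · simp
    · simpa using ha j
  · simp [Fin.sum_univ_succ, hs]
  · intro i
    refine Fin.cases ?_ (fun j => ?_) i
    · simpa using h0
    · simpa using hg j
  · simp [Fin.sum_univ_succ]

theorem convN_mono' {X : Type*} [AddCommGroup X] [Module ℝ X] {G : Set X} (hG : G.Nonempty) :
    Monotone (fun n => convN n G) :=
  monotone_nat_of_le_succ (convN_succ hG)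

theorem avg_step {X : Type*} [NormedAddCommGroup X] [InnerProductSpace ℝ X] {m : ℕ}
    (a : Fin m → ℝ) (g : Fin m → X) (ha : ∀ i, 0 ≤ a i) (hs : ∑ i, a i = 1) (S : ℝ)
    (hS : ∀ i, ‖g i‖ ^ 2 ≤ S) (f : X) (hf : f = ∑ i, a i • g i) (u : X) :
    ∃ i, ‖u + f - g i‖ ^ 2 ≤ ‖u‖ ^ 2 + (S - ‖f‖ ^ 2) := by
  by_contra! hc
  have hin : ∑ i, a i * inner ℝ (u + f) (g i) = inner ℝ (u + f) f := by
    generalize u + f = v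
    rw [hf, inner_sum]
    simp [inner_smul_right]
  have h1 : ∀ i, a i * (‖u‖ ^ 2 + (S - ‖f‖ ^ 2)) ≤
      a i * ‖u + f - g i‖ ^ 2 := fun i => mul_le_mul_of_nonneg_left (hc i).le (ha i)
  obtain ⟨k, hk⟩ : ∃ k, 0 < a k := by
    by_contra! h
    have : ∑ i, a i ≤ 0 := Finset.sum_nonpos fun i _ => h i
    linarith
  have h2 : ∑ i, a i * (‖u‖ ^ 2 + (S - ‖f‖ ^ 2)) < ∑ i, a i * ‖u + f - g i‖ ^ 2 :=
    Finset.sum_lt_sum (fun i _ => h1 i) ⟨k, Finset.mem_univ _, mul_lt_mul_of_pos_left (hc k) hk⟩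
  have h3 : ∑ i, a i * ‖u + f - g i‖ ^ 2 ≤
      ∑ i, (a i * (‖u + f‖ ^ 2 + S) - 2 * (a i * inner ℝ (u + f) (g i))) := by
    refine Finset.sum_le_sum fun i _ => ?_
    rw [norm_sub_sq_real (u + f) (g i)]
    nlinarith [mul_le_mul_of_nonneg_left (hS i) (ha i)]
  rw [Finset.sum_sub_distrib, ← Finset.mul_sum, hin, ← Finset.sum_mul, hs] at h3
  rw [← Finset.sum_mul, hs] at h2
  rw [norm_add_sq_real, inner_add_left, real_inner_self_eq_norm_sq] at h3
  linarith

theorem mem_convN_of_hull {X : Type*} [AddCommGroup X] [Module ℝ X] {G : Set X} {f : X}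
    (hf : f ∈ convexHull ℝ G) : ∃ m, f ∈ convN m G := by
  obtain ⟨ι, _, w, z, hw, hs, hz, rfl⟩ := mem_convexHull_iff_exists_fintype.1 hf
  let e := (Fintype.equivFin ι).symm
  refine ⟨Fintype.card ι, w ∘ e, z ∘ e, fun i => hw _, ?_, fun i => hz _, ?_⟩
  · rw [← hs]; exact e.sum_comp w
  · exact (e.sum_comp (fun i => w i • z i)).symm

/-- Kůrková–Sanguineti: in a real Hilbert space, for a nonempty bounded
`G ⊆ X` with `s_G = sup_{g ∈ G} ‖g‖` and any `f` in the convex hull of `G`, there is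
`τ_f ∈ [0,1)` such that for every `n ≥ 1` the distance from `f` to `conv_n(G)` is at most
`√(τ_f^{n-1} (s_G² - ‖f‖²))`. -/
theorem kurkova_sanguineti (X : Type*) [NormedAddCommGroup X] [InnerProductSpace ℝ X]
    [CompleteSpace X]
    (G : Set X) (hG : G.Nonempty) (hbdd : ∃ C : ℝ, ∀ g ∈ G, ‖g‖ ≤ C)
    (f : X) (hf : f ∈ convexHull ℝ G) :
    ∃ τ : ℝ, 0 ≤ τ ∧ τ < 1 ∧ ∀ n : ℕ, 1 ≤ n →
      Metric.infDist f (convN n G)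
        ≤ Real.sqrt (τ ^ (n - 1) * ((sSup ((fun g : X => ‖g‖) '' G)) ^ 2 - ‖f‖ ^ 2)) := by
  obtain ⟨m, hm⟩ := mem_convN_of_hull hf
  obtain ⟨a, g, ha, hs, hg, hfe⟩ := id hm
  obtain ⟨C, hC⟩ := hbdd
  set s := sSup ((fun g : X => ‖g‖) '' G) with hsdef
  have hle : ∀ x ∈ G, ‖x‖ ≤ s := fun x hx =>
    le_csSup ⟨C, by rintro _ ⟨y, hy, rfl⟩; exact hC y hy⟩ ⟨x, hx, rfl⟩
  have hS : ∀ i, ‖g i‖ ^ 2 ≤ s ^ 2 := fun i =>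
    pow_le_pow_left₀ (norm_nonneg _) (hle _ (hg i)) 2
  obtain ⟨i, hi⟩ := avg_step a g ha hs (s ^ 2) hS f hfe 0
  simp only [zero_add, norm_zero, ne_eq, OfNat.ofNat_ne_zero, not_false_eq_true, zero_pow] at hi
  obtain ⟨j, hj⟩ := avg_step a g ha hs (s ^ 2) hS f hfe (f - g i)
  set D := s ^ 2 - ‖f‖ ^ 2 with hD
  have hD0 : 0 ≤ D := le_trans (sq_nonneg _) hi
  have hm0 : 1 ≤ m := by
    rcases Nat.eq_zero_or_pos m with h | h
    · subst h; simp at hs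
    · exact h
  have hmR : (1 : ℝ) ≤ m := by exact_mod_cast hm0
  have key : ∀ n y, y ∈ convN n G → ∀ B, ‖f - y‖ ^ 2 ≤ B →
      Metric.infDist f (convN n G) ≤ Real.sqrt B := by
    intro n y hy B hB
    refine (Metric.infDist_le_dist_of_mem hy).trans ?_
    rw [dist_eq_norm]
    exact Real.le_sqrt_of_sq_le hB
  have hq : 1 / (2 * (m : ℝ)) ≤ 1 / 2 := by
    apply one_div_le_one_div_of_le <;> linarith
  have hq0 : 0 < 1 / (2 * (m : ℝ)) := by positivity
  have hτ : 1 / 2 ≤ (1 - 1 / (2 * (m : ℝ))) ^ m := by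
    have := one_add_mul_le_pow (a := -(1 / (2 * (m : ℝ)))) (by linarith) m
    have e : (m : ℝ) * -(1 / (2 * (m : ℝ))) = -(1 / 2) := by field_simp
    rw [e, ← sub_eq_add_neg 1 (1 / (2 * (m : ℝ)))] at this
    linarith
  refine ⟨1 - 1 / (2 * (m : ℝ)), by linarith, by linarith, fun n hn => ?_⟩
  have hp : 0 ≤ (1 - 1 / (2 * (m : ℝ))) ^ (n - 1) := pow_nonneg (by linarith) _
  rcases le_total m n with hmn | hmn
  · refine key n f (convN_mono' hG hmn hm) _ ?_
    simpa using mul_nonneg hp hD0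
  rcases Nat.lt_or_ge n 2 with h2 | h2
  · obtain rfl : n = 1 := by omega
    refine key 1 (g i) ⟨fun _ => 1, fun _ => g i, by simp, by simp, by simp [hg], by simp⟩ _ ?_
    simpa using hi
  · have hmem : (1 / 2 : ℝ) • g i + (1 / 2 : ℝ) • g j ∈ convN 2 G :=
      ⟨fun _ => 1 / 2, ![g i, g j], fun _ => by norm_num, by norm_num,
        by intro k; fin_cases k <;> simp [hg], by simp⟩
    refine key n _ (convN_mono' hG h2 hmem) _ ?_
    have e : f - ((1 / 2 : ℝ) • g i + (1 / 2 : ℝ) • g j) = (1 / 2 : ℝ) • (f - g i + f - g j) := by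
      module
    rw [e, norm_smul, mul_pow]
    have h4 : (1 / 2 : ℝ) ≤ (1 - 1 / (2 * (m : ℝ))) ^ (n - 1) :=
      hτ.trans (pow_le_pow_of_le_one (by linarith) (by linarith) (by omega))
    have h5 := mul_le_mul_of_nonneg_right h4 hD0
    have h6 : ‖(1 / 2 : ℝ)‖ ^ 2 = 1 / 4 := by norm_num
    rw [h6]
    linarith
end
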